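/- Let n ≥ 2 and let θ satisfy 2·arccos(1/√3) < θ < 2π. Then the open cone 𝒪_θ ⊆ ℝⁿ has the backward uniqueness property (BU). In particular, the critical angle θ₀ (the infimum of opening angles for which (BU) holds) satisfies θ₀ ≤ 2·arccos(1/√3). -/

import Mathlib

open Real Set Filter

/-- The Laplacian of `f` at `x`, computed as the sum of the second partial
derivatives in the coordinate directions. -/
noncomputable def lap {n : ℕ} (f : EuclideanSpace ℝ (Fin n) → ℝ)
    (x : EuclideanSpace ℝ (Fin n)) : ℝ :=
  ∑ i, fderiv ℝ (fun y => fderiv ℝ f y (EuclideanSpace.single i 1)) x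
      (EuclideanSpace.single i 1)

/-- The open cone `𝒪_θ = {x : x₁ > |x| cos (θ/2)}` in `ℝⁿ`. -/
def cone (n : ℕ) [NeZero n] (θ : ℝ) : Set (EuclideanSpace ℝ (Fin n)) :=
  {x | ‖x‖ * Real.cos (θ / 2) < x 0}

/-- The backward uniqueness property (BU) for an open set `Ω ⊆ ℝⁿ`:
every bounded smooth solution of `|∂ₜ u - Δ u| ≤ c₁ (|∇u| + |u|)` on `Ω × (0, T)`
whose continuous extension vanishes at time `T` vanishes identically. -/
def HasBU (n : ℕ) (Ω : Set (EuclideanSpace ℝ (Fin n))) : Prop :=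
  ∀ T : ℝ, 0 < T → ∀ c₁ : ℝ, 0 ≤ c₁ →
    ∀ u : EuclideanSpace ℝ (Fin n) → ℝ → ℝ,
      ContDiffOn ℝ (⊤ : ℕ∞) (fun p : EuclideanSpace ℝ (Fin n) × ℝ => u p.1 p.2)
        (Ω ×ˢ Set.Ioo 0 T) →
      (∃ M : ℝ, ∀ x ∈ Ω, ∀ t ∈ Set.Ioo (0 : ℝ) T, |u x t| ≤ M) →
      (∀ x ∈ Ω, ∀ t ∈ Set.Ioo (0 : ℝ) T,
        |deriv (u x) t - lap (fun y => u y t) x| ≤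
          c₁ * (‖gradient (fun y => u y t) x‖ + |u x t|)) →
      (∀ x ∈ Ω, Filter.Tendsto (u x) (nhdsWithin T (Set.Iio T)) (nhds 0)) →
      ∀ x ∈ Ω, ∀ t ∈ Set.Ioo (0 : ℝ) T, u x t = 0

open MeasureTheory Topology
open scoped ContDiff

/-- The derivative of `F` in the direction `v`. -/
noncomputable def dirDeriv {W : Type*} [NormedAddCommGroup W] [NormedSpace ℝ W]
    (v : W) (F : W → ℝ) (p : W) : ℝ := fderiv ℝ F p v

section DirDeriv

variable {W : Type*} [NormedAddCommGroup W] [NormedSpace ℝ W] {v w : W} {F G : W → ℝ} {p : W}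

@[fun_prop]
theorem ContDiff.dirDeriv (hF : ContDiff ℝ ∞ F) : ContDiff ℝ ∞ (dirDeriv v F) := by
  have h : ContDiff ℝ ∞ (fderiv ℝ F) := hF.fderiv_right (m := ∞) (by simp)
  exact h.clm_apply contDiff_const

theorem Filter.EventuallyEq.dirDeriv (h : F =ᶠ[𝓝 p] G) :
    _root_.dirDeriv v F =ᶠ[𝓝 p] _root_.dirDeriv v G := by
  filter_upwards [h.fderiv (𝕜 := ℝ)] with q hq
  simp only [_root_.dirDeriv, hq]

theorem dirDeriv_const (c : ℝ) : dirDeriv v (fun _ : W => c) = fun _ => 0 := by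
  funext p; simp [dirDeriv]

theorem dirDeriv_add (hF : ContDiff ℝ ∞ F) (hG : ContDiff ℝ ∞ G) :
    dirDeriv v (fun p => F p + G p) = fun p => dirDeriv v F p + dirDeriv v G p := by
  funext p
  simp only [dirDeriv]
  rw [fderiv_fun_add (hF.contDiffAt.differentiableAt (by simp))
    (hG.contDiffAt.differentiableAt (by simp))]
  rfl

theorem dirDeriv_sub (hF : ContDiff ℝ ∞ F) (hG : ContDiff ℝ ∞ G) :
    dirDeriv v (fun p => F p - G p) = fun p => dirDeriv v F p - dirDeriv v G p := by
  funext p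
  simp only [dirDeriv]
  rw [fderiv_fun_sub (hF.contDiffAt.differentiableAt (by simp))
    (hG.contDiffAt.differentiableAt (by simp))]
  rfl

theorem dirDeriv_mul (hF : ContDiff ℝ ∞ F) (hG : ContDiff ℝ ∞ G) :
    dirDeriv v (fun p => F p * G p) = fun p => F p * dirDeriv v G p + dirDeriv v F p * G p := by
  funext p
  simp only [dirDeriv]
  rw [fderiv_fun_mul (hF.contDiffAt.differentiableAt (by simp))
    (hG.contDiffAt.differentiableAt (by simp))]
  simp [mul_comm]

theorem dirDeriv_const_mul (c : ℝ) (hF : ContDiff ℝ ∞ F) :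
    dirDeriv v (fun p => c * F p) = fun p => c * dirDeriv v F p := by
  rw [dirDeriv_mul contDiff_const hF, dirDeriv_const]
  simp

theorem dirDeriv_pow_two (hF : ContDiff ℝ ∞ F) :
    dirDeriv v (fun p => F p ^ 2) = fun p => 2 * F p * dirDeriv v F p := by
  simp only [pow_two]
  rw [dirDeriv_mul hF hF]
  funext p; ring

theorem dirDeriv_sum {ι : Type*} [Fintype ι] {F : ι → W → ℝ} (hF : ∀ i, ContDiff ℝ ∞ (F i)) :
    dirDeriv v (fun p => ∑ i, F i p) = fun p => ∑ i, dirDeriv v (F i) p := by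
  funext p
  simp only [dirDeriv]
  rw [fderiv_fun_sum (fun i _ => (hF i).contDiffAt.differentiableAt (by simp))]
  simp

theorem dirDeriv_comp {g : ℝ → ℝ} (hg : ContDiff ℝ ∞ g) (hF : ContDiff ℝ ∞ F) :
    dirDeriv v (fun p => g (F p)) = fun p => deriv g (F p) * dirDeriv v F p := by
  funext p
  simp only [dirDeriv]
  have h1 : HasDerivAt g (deriv g (F p)) (F p) :=
    (hg.contDiffAt.differentiableAt (by simp)).hasDerivAt
  have h2 : HasFDerivAt F (fderiv ℝ F p) p :=
    (hF.contDiffAt.differentiableAt (by simp)).hasFDerivAt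
  have h3 := (h1.comp_hasFDerivAt p h2).fderiv
  simp only [Function.comp_def] at h3
  rw [h3]
  simp

theorem dirDeriv_exp (hF : ContDiff ℝ ∞ F) :
    dirDeriv v (fun p => rexp (F p)) = fun p => rexp (F p) * dirDeriv v F p := by
  rw [dirDeriv_comp Real.contDiff_exp hF]
  simp

theorem dirDeriv_comm (hF : ContDiff ℝ ∞ F) :
    dirDeriv v (dirDeriv w F) = dirDeriv w (dirDeriv v F) := by
  have key : ∀ (a b : W) (p : W), dirDeriv a (dirDeriv b F) p
      = fderiv ℝ (fderiv ℝ F) p a b := by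
    intro a b p
    have h : ContDiff ℝ ∞ (fderiv ℝ F) := hF.fderiv_right (m := ∞) (by simp)
    have h1 : HasFDerivAt (fderiv ℝ F) (fderiv ℝ (fderiv ℝ F) p) p :=
      (h.contDiffAt.differentiableAt (by simp)).hasFDerivAt
    have h2 : HasFDerivAt (dirDeriv b F)
        ((ContinuousLinearMap.apply ℝ ℝ b).comp (fderiv ℝ (fderiv ℝ F) p)) p :=
      (ContinuousLinearMap.apply ℝ ℝ b).hasFDerivAt.comp p h1
    rw [dirDeriv, h2.fderiv]
    rfl
  funext p
  rw [key, key]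
  exact (hF.contDiffAt.isSymmSndFDerivAt (by
    simp only [minSmoothness_of_isRCLikeNormedField]
    exact WithTop.coe_le_coe.2 (le_top : (2 : ℕ∞) ≤ ⊤))) v w

theorem dirDeriv_smul (c : ℝ) : dirDeriv (c • v) F = fun p => c * dirDeriv v F p := by
  funext p; simp [dirDeriv]

theorem HasCompactSupport.dirDeriv (hF : HasCompactSupport F) :
    HasCompactSupport (dirDeriv v F) :=
  (hF.fderiv (𝕜 := ℝ)).mono fun p hp => by
    simp only [_root_.dirDeriv, Function.mem_support, ne_eq] at hp ⊢
    exact fun h => hp (by simp [h])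

theorem integral_dirDeriv_eq_zero [FiniteDimensional ℝ W] [MeasurableSpace W] [BorelSpace W]
    {μ : Measure W} [μ.IsAddHaarMeasure] (hF : ContDiff ℝ ∞ F) (hc : HasCompactSupport F) :
    ∫ p, dirDeriv v F p ∂μ = 0 := by
  have h := integral_mul_fderiv_eq_neg_fderiv_mul_of_integrable (μ := μ) (𝕜 := ℝ)
    (f := fun _ : W => (1 : ℝ)) (g := F) (v := v) (by simp) ?_ ?_ (by simp)
    (fun p _ => hF.differentiable (by simp) p)
  · simpa [dirDeriv] using h
  · simp only [one_mul]
    exact (hF.dirDeriv (v := v)).continuous.integrable_of_hasCompactSupport hc.dirDeriv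
  · simp only [one_mul]
    exact hF.continuous.integrable_of_hasCompactSupport hc

/-- A smooth cutoff function between a compact set and an open neighbourhood. -/
theorem exists_contDiff_cutoff [FiniteDimensional ℝ W] {K O : Set W} (hK : IsCompact K)
    (hO : IsOpen O) (hKO : K ⊆ O) :
    ∃ f : W → ℝ, ContDiff ℝ ∞ f ∧ HasCompactSupport f ∧ tsupport f ⊆ O ∧
      (∀ p, 0 ≤ f p ∧ f p ≤ 1) ∧ ∀ p ∈ K, f =ᶠ[𝓝 p] fun _ => 1 := by
  obtain ⟨L, hL, hKL, hLO⟩ := exists_compact_between hK hO hKO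
  obtain ⟨f, hf1, hf0, hf⟩ := exists_contMDiffMap_one_nhds_of_subset_interior
    (modelWithCornersSelf ℝ W) (n := ⊤) hK.isClosed hKL
  have hs : tsupport f ⊆ L := closure_minimal (fun p hp => by
    by_contra h
    exact hp (hf0 p h)) hL.isClosed
  refine ⟨f, f.contMDiff.contDiff, HasCompactSupport.intro hL hf0, hs.trans hLO, hf, ?_⟩
  intro p hp
  exact eventually_nhdsSet_iff_forall.1 hf1 p hp

end DirDeriv

theorem commutator_algebra {ι : Type*} (s : Finset ι) (c c' vt v V Vt b P N : ℝ)
    (vi vti φi φii vii Vi bi bii A B D : ι → ℝ)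
    (hP : ∑ i ∈ s, φi i * vi i = P) (hN : ∑ i ∈ s, vi i ^ 2 = N)
    (hBD : ∑ i ∈ s, vi i * B i = ∑ i ∈ s, φi i * D i) :
    c * (2 * (∑ i ∈ s, vii i + V * v) * (vt - 2 * P + b * v)) =
      c * (4 * ∑ i ∈ s, A i * vi i - 2 * (∑ i ∈ s, φii i + b) * N +
          (-Vt + 2 * ∑ i ∈ s, Vi i * φi i + 2 * V * ∑ i ∈ s, φii i + 2 * b * V
            + ∑ i ∈ s, bii i) * v ^ 2)
        + c' * (N - V * v ^ 2)
        + ∑ i ∈ s, c * (2 * vt * vii i + 2 * vti i * vi i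
            - (4 * vi i * (B i + A i) + 4 * vii i * P)
            + (2 * φi i * (2 * D i) + 2 * φii i * N)
            - (2 * V * v ^ 2 * φii i + (2 * V * (2 * v * vi i) + 2 * Vi i * v ^ 2) * φi i)
            + (2 * b * v * vii i + (2 * b * vi i + 2 * bi i * v) * vi i)
            - (v ^ 2 * bii i + 2 * v * vi i * bi i))
        + (c * (V * (2 * v * vt) + Vt * v ^ 2 - 2 * ∑ i ∈ s, vi i * vti i)
          + c' * (V * v ^ 2 - N)) := by
  have h : ∑ i ∈ s, c * (2 * vt * vii i + 2 * vti i * vi i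
            - (4 * vi i * (B i + A i) + 4 * vii i * P)
            + (2 * φi i * (2 * D i) + 2 * φii i * N)
            - (2 * V * v ^ 2 * φii i + (2 * V * (2 * v * vi i) + 2 * Vi i * v ^ 2) * φi i)
            + (2 * b * v * vii i + (2 * b * vi i + 2 * bi i * v) * vi i)
            - (v ^ 2 * bii i + 2 * v * vi i * bi i))
      = c * (2 * vt * ∑ i ∈ s, vii i + 2 * ∑ i ∈ s, vi i * vti i - 4 * ∑ i ∈ s, vi i * B i
        - 4 * ∑ i ∈ s, A i * vi i - 4 * P * ∑ i ∈ s, vii i + 4 * ∑ i ∈ s, φi i * D i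
        + 2 * N * ∑ i ∈ s, φii i - 2 * V * v ^ 2 * ∑ i ∈ s, φii i
        - 4 * V * v * ∑ i ∈ s, φi i * vi i - 2 * v ^ 2 * ∑ i ∈ s, Vi i * φi i
        + 2 * b * v * ∑ i ∈ s, vii i + 2 * b * ∑ i ∈ s, vi i ^ 2 - v ^ 2 * ∑ i ∈ s, bii i) := by
    simp only [Finset.mul_sum, ← Finset.sum_add_distrib, ← Finset.sum_sub_distrib]
    exact Finset.sum_congr rfl fun i _ => by ring
  rw [h, hBD, hP, hN]
  ring

section Carleman

variable {W : Type*} [NormedAddCommGroup W] [NormedSpace ℝ W] {ι : Type*} [Fintype ι]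

/-- The squared length of the gradient along the directions `e`. -/
noncomputable def gradSq (e : ι → W) (F : W → ℝ) (p : W) : ℝ := ∑ i, dirDeriv (e i) F p ^ 2

/-- The sum of the second derivatives along the directions `e`. -/
noncomputable def lapAlong (e : ι → W) (F : W → ℝ) (p : W) : ℝ :=
  ∑ i, dirDeriv (e i) (dirDeriv (e i) F) p

@[fun_prop]
theorem ContDiff.gradSq {e : ι → W} {F : W → ℝ} (hF : ContDiff ℝ ∞ F) :
    ContDiff ℝ ∞ (gradSq e F) :=
  ContDiff.sum fun _ _ => (hF.dirDeriv).pow 2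

@[fun_prop]
theorem ContDiff.lapAlong {e : ι → W} {F : W → ℝ} (hF : ContDiff ℝ ∞ F) :
    ContDiff ℝ ∞ (lapAlong e F) :=
  ContDiff.sum fun _ _ => hF.dirDeriv.dirDeriv

/-- The zeroth order coefficient in the symmetric part of the conjugated operator. -/
noncomputable def conjPotential (e : ι → W) (t : W) (φ : W → ℝ) (p : W) : ℝ :=
  gradSq e φ p - dirDeriv t φ p

@[fun_prop]
theorem ContDiff.conjPotential {e : ι → W} {t : W} {φ : W → ℝ} (hF : ContDiff ℝ ∞ φ) :
    ContDiff ℝ ∞ (conjPotential e t φ) := by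
  unfold _root_.conjPotential
  fun_prop

/-- The coefficient of `v ^ 2` in the commutator identity. -/
noncomputable def commPotential (e : ι → W) (t : W) (φ b : W → ℝ) (p : W) : ℝ :=
  -dirDeriv t (conjPotential e t φ) p
    + 2 * ∑ i, dirDeriv (e i) (conjPotential e t φ) p * dirDeriv (e i) φ p
    + 2 * conjPotential e t φ p * lapAlong e φ p + 2 * b p * conjPotential e t φ p
    + lapAlong e b p

/-- The coefficient form of the gradient in the commutator identity. -/
noncomputable def commForm (e : ι → W) (φ b : W → ℝ) (p : W) (ξ : ι → ℝ) : ℝ :=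
  4 * ∑ i, (∑ j, dirDeriv (e i) (dirDeriv (e j) φ) p * ξ j) * ξ i
    - 2 * (lapAlong e φ p + b p) * ∑ i, ξ i ^ 2

theorem commutator_pointwise {e : ι → W} {t : W} {v φ b χ V : W → ℝ} (hv : ContDiff ℝ ∞ v)
    (hφ : ContDiff ℝ ∞ φ) (hb : ContDiff ℝ ∞ b) (hχ : ContDiff ℝ ∞ χ) (hV : ContDiff ℝ ∞ V)
    (hχe : ∀ i, dirDeriv (e i) χ = fun _ => 0) (p : W) :
    χ p * (2 * (lapAlong e v p + V p * v p) *
        (dirDeriv t v p - 2 * ∑ i, dirDeriv (e i) φ p * dirDeriv (e i) v p + b p * v p)) =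
      χ p * (commForm e φ b p (fun i => dirDeriv (e i) v p)
        + (-dirDeriv t V p + 2 * ∑ i, dirDeriv (e i) V p * dirDeriv (e i) φ p
          + 2 * V p * lapAlong e φ p + 2 * b p * V p + lapAlong e b p) * v p ^ 2)
      + dirDeriv t χ p * (gradSq e v p - V p * v p ^ 2)
      + (∑ i, dirDeriv (e i) (fun p => χ p * (2 * dirDeriv t v p * dirDeriv (e i) v p
          - 4 * dirDeriv (e i) v p * (∑ j, dirDeriv (e j) φ p * dirDeriv (e j) v p)
          + 2 * dirDeriv (e i) φ p * (∑ j, dirDeriv (e j) v p ^ 2)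
          - 2 * V p * v p ^ 2 * dirDeriv (e i) φ p + 2 * b p * v p * dirDeriv (e i) v p
          - v p ^ 2 * dirDeriv (e i) b p)) p)
      + dirDeriv t (fun p => χ p * (V p * v p ^ 2 - ∑ j, dirDeriv (e j) v p ^ 2)) p := by
  simp (disch := fun_prop) only [dirDeriv_mul, dirDeriv_add, dirDeriv_sub, dirDeriv_sum,
    dirDeriv_const, dirDeriv_pow_two, hχe]
  simp only [commForm, gradSq, lapAlong]
  have hsymm : ∀ i j, dirDeriv (e i) (dirDeriv (e j) v) p = dirDeriv (e j) (dirDeriv (e i) v) p :=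
    fun i j => by rw [dirDeriv_comm hv]
  have hsymt : ∀ i, dirDeriv t (dirDeriv (e i) v) p = dirDeriv (e i) (dirDeriv t v) p :=
    fun i => by rw [dirDeriv_comm hv]
  simp only [hsymt]
  have hcross : ∑ i, dirDeriv (e i) v p * ∑ j, dirDeriv (e j) φ p *
        dirDeriv (e i) (dirDeriv (e j) v) p
      = ∑ i, dirDeriv (e i) φ p * ∑ j, dirDeriv (e j) v p *
        dirDeriv (e i) (dirDeriv (e j) v) p := by
    simp only [Finset.mul_sum]
    rw [Finset.sum_comm]
    refine Finset.sum_congr rfl fun i _ => Finset.sum_congr rfl fun j _ => ?_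
    rw [hsymm j i]; ring
  have h := commutator_algebra Finset.univ (χ p) (dirDeriv t χ p) (dirDeriv t v p) (v p) (V p)
    (dirDeriv t V p) (b p) _ _ (fun i => dirDeriv (e i) v p)
    (fun i => dirDeriv (e i) (dirDeriv t v) p) (fun i => dirDeriv (e i) φ p)
    (fun i => dirDeriv (e i) (dirDeriv (e i) φ) p) (fun i => dirDeriv (e i) (dirDeriv (e i) v) p)
    (fun i => dirDeriv (e i) V p) (fun i => dirDeriv (e i) b p)
    (fun i => dirDeriv (e i) (dirDeriv (e i) b) p)
    (fun i => ∑ j, dirDeriv (e i) (dirDeriv (e j) φ) p * dirDeriv (e j) v p)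
    _ _ rfl rfl hcross
  simp only [zero_mul, add_zero, Finset.sum_add_distrib, mul_assoc, ← Finset.mul_sum] at h ⊢
  exact h

end Carleman

section CarlemanIntegral

variable {W : Type*} [NormedAddCommGroup W] [NormedSpace ℝ W] {ι : Type*} [Fintype ι]

theorem dirDeriv_eq_zero_of_notMem_tsupport {F : W → ℝ} {p v : W} (hp : p ∉ tsupport F) :
    dirDeriv v F p = 0 := by
  have h : fderiv ℝ F p = 0 := by
    by_contra h
    exact hp (support_fderiv_subset ℝ h)
  simp [dirDeriv, h]

theorem dirDeriv_dirDeriv_eq_zero_of_notMem_tsupport {F : W → ℝ} {p v w : W}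
    (hp : p ∉ tsupport F) : dirDeriv v (dirDeriv w F) p = 0 := by
  refine dirDeriv_eq_zero_of_notMem_tsupport fun h => hp ?_
  refine closure_minimal (fun q hq => ?_) (isClosed_tsupport F) h
  by_contra hq'
  exact hq (dirDeriv_eq_zero_of_notMem_tsupport hq')

theorem gradSq_eq_zero_of_notMem_tsupport {e : ι → W} {F : W → ℝ} {p : W}
    (hp : p ∉ tsupport F) : gradSq e F p = 0 := by
  simp [gradSq, dirDeriv_eq_zero_of_notMem_tsupport hp]

theorem lapAlong_eq_zero_of_notMem_tsupport {e : ι → W} {F : W → ℝ} {p : W}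
    (hp : p ∉ tsupport F) : lapAlong e F p = 0 := by
  simp [lapAlong, dirDeriv_dirDeriv_eq_zero_of_notMem_tsupport hp]

theorem gradSq_nonneg (e : ι → W) (F : W → ℝ) (p : W) : 0 ≤ gradSq e F p :=
  Finset.sum_nonneg fun _ _ => sq_nonneg _

/-- Smooth functions vanishing off the support of a compactly supported one are integrable. -/
theorem ContDiff.integrable_of_eq_zero [MeasurableSpace W] [BorelSpace W]
    {μ : Measure W} [IsFiniteMeasureOnCompacts μ] {F U : W → ℝ}
    (hF : ContDiff ℝ ∞ F) (hU : HasCompactSupport U) (h : ∀ p, p ∉ tsupport U → F p = 0) :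
    Integrable F μ :=
  hF.continuous.integrable_of_hasCompactSupport (HasCompactSupport.intro hU.isCompact h)

@[fun_prop]
theorem ContDiff.commPotential {e : ι → W} {t : W} {φ b : W → ℝ} (hφ : ContDiff ℝ ∞ φ)
    (hb : ContDiff ℝ ∞ b) : ContDiff ℝ ∞ (commPotential e t φ b) := by
  unfold _root_.commPotential
  fun_prop

@[fun_prop]
theorem ContDiff.commForm {e : ι → W} {φ b : W → ℝ} (hφ : ContDiff ℝ ∞ φ)
    (hb : ContDiff ℝ ∞ b) {ξ : W → ι → ℝ} (hξ : ∀ i, ContDiff ℝ ∞ fun p => ξ p i) :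
    ContDiff ℝ ∞ fun p => commForm e φ b p (ξ p) := by
  unfold _root_.commForm
  fun_prop

variable [FiniteDimensional ℝ W] [MeasurableSpace W] [BorelSpace W]

theorem integral_commutator {μ : Measure W} [μ.IsAddHaarMeasure]
    {e : ι → W} {t : W} {v φ b χ : W → ℝ} (hv : ContDiff ℝ ∞ v) (hvc : HasCompactSupport v)
    (hφ : ContDiff ℝ ∞ φ) (hb : ContDiff ℝ ∞ b) (hχ : ContDiff ℝ ∞ χ)
    (hχe : ∀ i, dirDeriv (e i) χ = fun _ => 0) :
    ∫ p, χ p * (2 * (lapAlong e v p + conjPotential e t φ p * v p) *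
        (dirDeriv t v p - 2 * ∑ i, dirDeriv (e i) φ p * dirDeriv (e i) v p + b p * v p)) ∂μ =
    ∫ p, (χ p * (commForm e φ b p (fun i => dirDeriv (e i) v p)
        + commPotential e t φ b p * v p ^ 2)
      + dirDeriv t χ p * (gradSq e v p - conjPotential e t φ p * v p ^ 2)) ∂μ := by
  have hV : ContDiff ℝ ∞ (conjPotential e t φ) := by fun_prop
  have hz : ∀ p, p ∉ tsupport v → v p = 0 := fun p => image_eq_zero_of_notMem_tsupport
  have hz1 : ∀ p w, p ∉ tsupport v → dirDeriv w v p = 0 :=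
    fun p w => dirDeriv_eq_zero_of_notMem_tsupport
  simp_rw [commutator_pointwise hv hφ hb hχ hV hχe]
  have hI0 : ∀ i, ∫ p, dirDeriv (e i) (fun p => χ p * (2 * dirDeriv t v p * dirDeriv (e i) v p
          - 4 * dirDeriv (e i) v p * (∑ j, dirDeriv (e j) φ p * dirDeriv (e j) v p)
          + 2 * dirDeriv (e i) φ p * (∑ j, dirDeriv (e j) v p ^ 2)
          - 2 * conjPotential e t φ p * v p ^ 2 * dirDeriv (e i) φ p
          + 2 * b p * v p * dirDeriv (e i) v p
          - v p ^ 2 * dirDeriv (e i) b p)) p ∂μ = 0 := by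
    intro i
    refine integral_dirDeriv_eq_zero (by fun_prop) (HasCompactSupport.intro hvc.isCompact ?_)
    intro p hp
    simp [hz p hp, hz1 p _ hp]
  have hI1 : ∫ p, dirDeriv t (fun p => χ p * (conjPotential e t φ p * v p ^ 2
      - ∑ j, dirDeriv (e j) v p ^ 2)) p ∂μ = 0 := by
    refine integral_dirDeriv_eq_zero (by fun_prop) (HasCompactSupport.intro hvc.isCompact ?_)
    intro p hp
    simp [hz p hp, hz1 p _ hp]
  have hint : ∀ (F : W → ℝ) (w : W), ContDiff ℝ ∞ F → (∀ p, p ∉ tsupport v → F p = 0) →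
      Integrable (fun p => dirDeriv w F p) μ := by
    intro F w hF h
    exact (hF.dirDeriv (v := w)).continuous.integrable_of_hasCompactSupport
      (HasCompactSupport.intro hvc.isCompact h).dirDeriv
  rw [integral_add, integral_add, integral_finsetSum, Finset.sum_eq_zero (fun i _ => hI0 i),
    hI1, add_zero, add_zero]
  · rfl
  · intro i _
    refine hint _ _ (by fun_prop) fun p hp => ?_
    simp [hz p hp, hz1 p _ hp]
  · refine ContDiff.integrable_of_eq_zero (U := v) ?_ hvc fun p hp => ?_
    · fun_prop
    · simp [hz p hp, hz1 p _ hp, commForm, gradSq]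
  · refine integrable_finsetSum _ fun i _ => hint _ _ (by fun_prop) fun p hp => ?_
    simp [hz p hp, hz1 p _ hp]
  · refine Integrable.add ?_ ?_
    · refine ContDiff.integrable_of_eq_zero (U := v) ?_ hvc fun p hp => ?_
      · fun_prop
      · simp [hz p hp, hz1 p _ hp, commForm, gradSq]
    · refine integrable_finsetSum _ fun i _ => hint _ _ (by fun_prop) fun p hp => ?_
      simp [hz p hp, hz1 p _ hp]
  · refine hint _ _ (by fun_prop) fun p hp => ?_
    simp [hz p hp, hz1 p _ hp]

end CarlemanIntegral

section CarlemanEstimate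

variable {W : Type*} [NormedAddCommGroup W] [NormedSpace ℝ W] {ι : Type*} [Fintype ι]

theorem gradSq_mul_le {e : ι → W} {F G : W → ℝ} (hF : ContDiff ℝ ∞ F) (hG : ContDiff ℝ ∞ G)
    (p : W) : gradSq e (fun p => F p * G p) p ≤
      2 * (F p ^ 2 * gradSq e G p) + 2 * (G p ^ 2 * gradSq e F p) := by
  simp only [gradSq, dirDeriv_mul hF hG, Finset.mul_sum, ← Finset.sum_add_distrib]
  refine Finset.sum_le_sum fun i _ => ?_
  nlinarith [sq_nonneg (F p * dirDeriv (e i) G p - dirDeriv (e i) F p * G p)]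

theorem mul_gradSq_le {e : ι → W} {F G : W → ℝ} (hF : ContDiff ℝ ∞ F) (hG : ContDiff ℝ ∞ G)
    (p : W) : F p ^ 2 * gradSq e G p ≤
      2 * gradSq e (fun p => F p * G p) p + 2 * (G p ^ 2 * gradSq e F p) := by
  simp only [gradSq, dirDeriv_mul hF hG, Finset.mul_sum, ← Finset.sum_add_distrib]
  refine Finset.sum_le_sum fun i _ => ?_
  nlinarith [sq_nonneg (F p * dirDeriv (e i) G p + 2 * (dirDeriv (e i) F p * G p))]

theorem gradSq_exp {e : ι → W} {φ : W → ℝ} (hφ : ContDiff ℝ ∞ φ) (p : W) :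
    gradSq e (fun p => rexp (φ p)) p = rexp (φ p) ^ 2 * gradSq e φ p := by
  simp only [gradSq, dirDeriv_exp hφ, Finset.mul_sum, mul_pow]

theorem sum_dirDeriv_mul_sq_le (e : ι → W) (F G : W → ℝ) (p : W) :
    (∑ i, dirDeriv (e i) F p * dirDeriv (e i) G p) ^ 2 ≤ gradSq e F p * gradSq e G p :=
  Finset.sum_mul_sq_le_sq_mul_sq _ _ _

theorem lapAlong_mul {e : ι → W} {F G : W → ℝ} (hF : ContDiff ℝ ∞ F) (hG : ContDiff ℝ ∞ G)
    (p : W) : lapAlong e (fun p => F p * G p) p = F p * lapAlong e G p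
      + 2 * (∑ i, dirDeriv (e i) F p * dirDeriv (e i) G p) + lapAlong e F p * G p := by
  simp (disch := fun_prop) only [lapAlong, dirDeriv_mul, dirDeriv_add, Finset.mul_sum,
    Finset.sum_mul, ← Finset.sum_add_distrib]
  exact Finset.sum_congr rfl fun i _ => by ring

theorem lapAlong_exp {e : ι → W} {φ : W → ℝ} (hφ : ContDiff ℝ ∞ φ) (p : W) :
    lapAlong e (fun p => rexp (φ p)) p
      = rexp (φ p) * (lapAlong e φ p + gradSq e φ p) := by
  simp (disch := fun_prop) only [lapAlong, gradSq, dirDeriv_exp, dirDeriv_mul, Finset.mul_sum,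
    mul_add, ← Finset.sum_add_distrib]
  exact Finset.sum_congr rfl fun i _ => by ring

theorem conjugated_operator {e : ι → W} {t : W} {w φ : W → ℝ} (hw : ContDiff ℝ ∞ w)
    (hφ : ContDiff ℝ ∞ φ) (b : ℝ) (p : W) :
    (lapAlong e (fun p => rexp (φ p) * w p) p + conjPotential e t φ p * (rexp (φ p) * w p))
      + (dirDeriv t (fun p => rexp (φ p) * w p) p
        - 2 * ∑ i, dirDeriv (e i) φ p * dirDeriv (e i) (fun p => rexp (φ p) * w p) p
        + b * (rexp (φ p) * w p)) =
    rexp (φ p) * (dirDeriv t w p + lapAlong e w p)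
      + (lapAlong e φ p + b) * (rexp (φ p) * w p) := by
  have hexp : ContDiff ℝ ∞ fun p => rexp (φ p) := by fun_prop
  rw [lapAlong_mul hexp hw, lapAlong_exp hφ]
  simp only [dirDeriv_mul hexp hw, dirDeriv_exp hφ, conjPotential]
  have h1 : ∑ i, rexp (φ p) * dirDeriv (e i) φ p * dirDeriv (e i) w p
      = rexp (φ p) * ∑ i, dirDeriv (e i) φ p * dirDeriv (e i) w p := by
    rw [Finset.mul_sum]; exact Finset.sum_congr rfl fun i _ => by ring
  have h2 : ∑ i, dirDeriv (e i) φ p * (rexp (φ p) * dirDeriv (e i) w p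
        + rexp (φ p) * dirDeriv (e i) φ p * w p)
      = rexp (φ p) * (∑ i, dirDeriv (e i) φ p * dirDeriv (e i) w p)
        + rexp (φ p) * w p * gradSq e φ p := by
    simp only [gradSq, Finset.mul_sum, ← Finset.sum_add_distrib]
    exact Finset.sum_congr rfl fun i _ => by ring
  rw [h1, h2]
  ring

/-- The coefficient of the error terms produced by a cutoff function. -/
noncomputable def cutoffError (e : ι → W) (t : W) (c : ℝ) (η : W → ℝ) (p : W) : ℝ :=
  (16 + 4 * c) * gradSq e η p + 4 * (dirDeriv t η p + lapAlong e η p) ^ 2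

@[fun_prop]
theorem ContDiff.cutoffError {e : ι → W} {t : W} {c : ℝ} {η : W → ℝ} (hη : ContDiff ℝ ∞ η) :
    ContDiff ℝ ∞ (cutoffError e t c η) := by
  unfold _root_.cutoffError
  fun_prop

theorem cutoffError_nonneg {e : ι → W} {t : W} {c : ℝ} (hc : 0 ≤ c) (η : W → ℝ) (p : W) :
    0 ≤ cutoffError e t c η p := by
  unfold cutoffError
  have := gradSq_nonneg e η p
  positivity

theorem cutoffError_eq_zero_of_notMem_tsupport {e : ι → W} {t : W} {c : ℝ} {η : W → ℝ} {p : W}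
    (hp : p ∉ tsupport η) : cutoffError e t c η p = 0 := by
  simp [cutoffError, gradSq_eq_zero_of_notMem_tsupport hp,
    lapAlong_eq_zero_of_notMem_tsupport hp, dirDeriv_eq_zero_of_notMem_tsupport hp]

theorem carleman_pointwise {e : ι → W} {t : W} {U η φ : W → ℝ} (hU : ContDiff ℝ ∞ U)
    (hη : ContDiff ℝ ∞ η) (hφ : ContDiff ℝ ∞ φ) {c : ℝ} (hc : 0 ≤ c) (b : ℝ) (p : W)
    (hpde : (dirDeriv t U p + lapAlong e U p) ^ 2 ≤ c * (gradSq e U p + U p ^ 2)) :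
    2 * (lapAlong e (fun p => rexp (φ p) * (η p * U p)) p
          + conjPotential e t φ p * (rexp (φ p) * (η p * U p)))
      * (dirDeriv t (fun p => rexp (φ p) * (η p * U p)) p
        - 2 * ∑ i, dirDeriv (e i) φ p * dirDeriv (e i) (fun p => rexp (φ p) * (η p * U p)) p
        + b * (rexp (φ p) * (η p * U p))) ≤
    8 * c * gradSq e (fun p => rexp (φ p) * (η p * U p)) p
      + (8 * c * gradSq e φ p + 2 * c + (lapAlong e φ p + b) ^ 2)
        * (rexp (φ p) * (η p * U p)) ^ 2
      + cutoffError e t c η p * (gradSq e U p + U p ^ 2) * rexp (φ p) ^ 2 := by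
  have hw : ContDiff ℝ ∞ fun p => η p * U p := by fun_prop
  have hexp : ContDiff ℝ ∞ fun p => rexp (φ p) := by fun_prop
  have h1 := conjugated_operator (e := e) (t := t) hw hφ b p
  have h2 := mul_gradSq_le (e := e) hη hU p
  have h3 := mul_gradSq_le (e := e) hexp hw p
  rw [gradSq_exp hφ] at h3
  have h4 : dirDeriv t (fun p => η p * U p) p + lapAlong e (fun p => η p * U p) p
      = η p * (dirDeriv t U p + lapAlong e U p)
        + (2 * (∑ i, dirDeriv (e i) η p * dirDeriv (e i) U p)
          + U p * (dirDeriv t η p + lapAlong e η p)) := by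
    rw [lapAlong_mul hη hU, dirDeriv_mul hη hU]; ring
  have h5 := sum_dirDeriv_mul_sq_le e η U p
  rw [h4] at h1
  generalize lapAlong e (fun p => rexp (φ p) * (η p * U p)) p
      + conjPotential e t φ p * (rexp (φ p) * (η p * U p)) = X at *
  generalize dirDeriv t (fun p => rexp (φ p) * (η p * U p)) p
        - 2 * ∑ i, dirDeriv (e i) φ p * dirDeriv (e i) (fun p => rexp (φ p) * (η p * U p)) p
        + b * (rexp (φ p) * (η p * U p)) = Y at *
  generalize gradSq e (fun p => rexp (φ p) * (η p * U p)) p = Gv at *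
  generalize gradSq e (fun p => η p * U p) p = Gw at *
  generalize dirDeriv t U p + lapAlong e U p = P at *
  generalize (∑ i, dirDeriv (e i) η p * dirDeriv (e i) U p) = S at *
  unfold cutoffError
  generalize dirDeriv t η p + lapAlong e η p = D at *
  generalize lapAlong e φ p + b = a at *
  have g1 := gradSq_nonneg e η p
  have g2 := gradSq_nonneg e U p
  generalize gradSq e η p = Gη at *
  generalize gradSq e U p = GU at *
  generalize gradSq e φ p = Gφ at *
  generalize rexp (φ p) = E at *
  generalize η p = n at *
  generalize U p = u at *
  have k1 : 2 * X * Y ≤ (E * (n * P + (2 * S + u * D))) ^ 2 + (a * (E * (n * u))) ^ 2 := by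
    have : (X + Y) ^ 2 = (E * (n * P + (2 * S + u * D)) + a * (E * (n * u))) ^ 2 := by rw [h1]
    nlinarith [sq_nonneg (X - Y), sq_nonneg (E * (n * P + (2 * S + u * D)) - a * (E * (n * u)))]
  have k2 : (n * P + (2 * S + u * D)) ^ 2 ≤ 2 * c * (n ^ 2 * GU) + 2 * c * (n ^ 2 * u ^ 2)
      + 16 * (Gη * GU) + 4 * (u ^ 2 * D ^ 2) := by
    have a1 : (n * P + (2 * S + u * D)) ^ 2 ≤ 2 * (n ^ 2 * P ^ 2) + 2 * (2 * S + u * D) ^ 2 := by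
      nlinarith [sq_nonneg (n * P - (2 * S + u * D))]
    have a2 : n ^ 2 * P ^ 2 ≤ n ^ 2 * (c * (GU + u ^ 2)) := by gcongr
    have a3 : (2 * S + u * D) ^ 2 ≤ 8 * S ^ 2 + 2 * (u ^ 2 * D ^ 2) := by
      nlinarith [sq_nonneg (2 * S - u * D)]
    nlinarith
  have k3 : (n * P + (2 * S + u * D)) ^ 2 ≤ 4 * c * Gw + 4 * c * (u ^ 2 * Gη)
      + 2 * c * (n ^ 2 * u ^ 2) + 16 * (Gη * GU) + 4 * (u ^ 2 * D ^ 2) := by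
    nlinarith [mul_le_mul_of_nonneg_left h2 hc]
  have k4 := mul_le_mul_of_nonneg_left k3 (sq_nonneg E)
  have k5 := mul_le_mul_of_nonneg_left h3 hc
  have k6 : 0 ≤ E ^ 2 * (4 * c * (Gη * GU) + 16 * (Gη * u ^ 2) + 4 * (D ^ 2 * GU)) := by
    positivity
  nlinarith

variable [FiniteDimensional ℝ W] [MeasurableSpace W] [BorelSpace W]

/-- The Carleman estimate for the backward heat operator, for globally defined functions. -/
theorem carleman_estimate {μ : Measure W} [μ.IsAddHaarMeasure]
    {e : ι → W} {t : W} {U η φ b χ : W → ℝ} (hU : ContDiff ℝ ∞ U) (hUc : HasCompactSupport U)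
    (hη : ContDiff ℝ ∞ η) (hφ : ContDiff ℝ ∞ φ) (hb : ContDiff ℝ ∞ b) (hχ : ContDiff ℝ ∞ χ)
    (hχe : ∀ i, dirDeriv (e i) χ = fun _ => 0) (hχ0 : ∀ p, 0 ≤ χ p)
    (hχt : ∀ p, 0 ≤ dirDeriv t χ p) {c : ℝ} (hc : 0 ≤ c)
    (hpde : ∀ p ∈ tsupport η, χ p ≠ 0 →
      (dirDeriv t U p + lapAlong e U p) ^ 2 ≤ c * (gradSq e U p + U p ^ 2))
    (hform : ∀ p ∈ tsupport η, χ p ≠ 0 → ∀ ξ : ι → ℝ,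
      8 * c * ∑ i, ξ i ^ 2 ≤ commForm e φ b p ξ)
    (hpot : ∀ p ∈ tsupport η, χ p ≠ 0 →
      1 + 8 * c * gradSq e φ p + 2 * c + (lapAlong e φ p + b p) ^ 2
        ≤ commPotential e t φ b p) :
    ∫ p, χ p * (η p * rexp (φ p) * U p) ^ 2 ∂μ ≤
      ∫ p, χ p * (cutoffError e t c η p * (gradSq e U p + U p ^ 2) * rexp (φ p) ^ 2) ∂μ
      + ∫ p, dirDeriv t χ p * (conjPotential e t φ p * (η p * rexp (φ p) * U p) ^ 2) ∂μ := by
  set v : W → ℝ := fun p => rexp (φ p) * (η p * U p) with hv_def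
  have hv : ContDiff ℝ ∞ v := by fun_prop
  have hzU : ∀ p, p ∉ tsupport U → U p = 0 := fun p => image_eq_zero_of_notMem_tsupport
  have hvU : tsupport v ⊆ tsupport U := closure_minimal (fun p hp => by
    by_contra h
    exact hp (by simp [hv_def, hzU p h])) (isClosed_tsupport U)
  have hvη : tsupport v ⊆ tsupport η := closure_minimal (fun p hp => by
    by_contra h
    exact hp (by simp [hv_def, image_eq_zero_of_notMem_tsupport h])) (isClosed_tsupport η)
  have hvc : HasCompactSupport v := hUc.mono' ((subset_tsupport v).trans hvU)
  have hz : ∀ p, p ∉ tsupport U → v p = 0 := fun p hp =>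
    image_eq_zero_of_notMem_tsupport fun h => hp (hvU h)
  have hz1 : ∀ p w, p ∉ tsupport U → dirDeriv w v p = 0 :=
    fun p w hp => dirDeriv_eq_zero_of_notMem_tsupport fun h => hp (hvU h)
  have hz2 : ∀ p, p ∉ tsupport U → gradSq e U p = 0 :=
    fun p => gradSq_eq_zero_of_notMem_tsupport
  have hz3 : ∀ p, p ∉ tsupport U → gradSq e v p = 0 := fun p hp =>
    gradSq_eq_zero_of_notMem_tsupport fun h => hp (hvU h)
  have hA := integral_commutator (μ := μ) (t := t) hv hvc hφ hb hχ hχe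
  have hpoint : ∀ p, χ p * v p ^ 2
      + (χ p * (2 * (lapAlong e v p + conjPotential e t φ p * v p) *
        (dirDeriv t v p - 2 * ∑ i, dirDeriv (e i) φ p * dirDeriv (e i) v p + b p * v p))) ≤
      (χ p * (commForm e φ b p (fun i => dirDeriv (e i) v p)
        + commPotential e t φ b p * v p ^ 2)
      + dirDeriv t χ p * (gradSq e v p - conjPotential e t φ p * v p ^ 2))
      + (χ p * (cutoffError e t c η p * (gradSq e U p + U p ^ 2) * rexp (φ p) ^ 2)
      + dirDeriv t χ p * (conjPotential e t φ p * v p ^ 2)) := by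
    intro p
    have hg : 0 ≤ dirDeriv t χ p * gradSq e v p := mul_nonneg (hχt p) (gradSq_nonneg _ _ _)
    by_cases hp : p ∈ tsupport η ∧ χ p ≠ 0
    · have h1 := carleman_pointwise (e := e) (t := t) hU hη hφ hc (b p) p (hpde p hp.1 hp.2)
      have h2 := hform p hp.1 hp.2 (fun i => dirDeriv (e i) v p)
      have h3 := mul_le_mul_of_nonneg_right (hpot p hp.1 hp.2) (sq_nonneg (v p))
      change _ ≤ 8 * c * gradSq e v p + _ * v p ^ 2 + _ at h1
      have h4 : ∑ i, dirDeriv (e i) v p ^ 2 = gradSq e v p := rfl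
      rw [h4] at h2
      have h5 : v p ^ 2 + (2 * (lapAlong e v p + conjPotential e t φ p * v p) *
        (dirDeriv t v p - 2 * ∑ i, dirDeriv (e i) φ p * dirDeriv (e i) v p + b p * v p)) ≤
        (commForm e φ b p (fun i => dirDeriv (e i) v p)
        + commPotential e t φ b p * v p ^ 2)
        + cutoffError e t c η p * (gradSq e U p + U p ^ 2) * rexp (φ p) ^ 2 := by
        linarith
      have h6 := mul_le_mul_of_nonneg_left h5 (hχ0 p)
      linarith
    · rw [not_and_or, not_not] at hp
      rcases hp with hp | hp
      · have hp' : p ∉ tsupport v := fun h => hp (hvη h)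
        have a1 : v p = 0 := image_eq_zero_of_notMem_tsupport hp'
        have a2 : ∀ w, dirDeriv w v p = 0 := fun w => dirDeriv_eq_zero_of_notMem_tsupport hp'
        simp only [a1, a2, cutoffError_eq_zero_of_notMem_tsupport hp, commForm]
        simp
        linarith
      · simp only [hp]
        linarith
  have hint : ∀ F : W → ℝ, ContDiff ℝ ∞ F → (∀ p, p ∉ tsupport U → F p = 0) →
      Integrable F μ := fun F hF h => hF.integrable_of_eq_zero hUc h
  have i1 : Integrable (fun p => χ p * v p ^ 2) μ :=
    hint _ (by fun_prop) fun p hp => by simp [hz p hp]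
  have i2 : Integrable (fun p => χ p * (2 * (lapAlong e v p + conjPotential e t φ p * v p) *
        (dirDeriv t v p - 2 * ∑ i, dirDeriv (e i) φ p * dirDeriv (e i) v p + b p * v p))) μ :=
    hint _ (by fun_prop) fun p hp => by simp [hz p hp, hz1 p _ hp]
  have i3 : Integrable (fun p => χ p * (commForm e φ b p (fun i => dirDeriv (e i) v p)
        + commPotential e t φ b p * v p ^ 2)
      + dirDeriv t χ p * (gradSq e v p - conjPotential e t φ p * v p ^ 2)) μ :=
    hint _ (by fun_prop) fun p hp => by simp [hz p hp, hz1 p _ hp, hz3 p hp, commForm]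
  have i4 : Integrable (fun p => χ p *
      (cutoffError e t c η p * (gradSq e U p + U p ^ 2) * rexp (φ p) ^ 2)) μ :=
    hint _ (by fun_prop) fun p hp => by simp [hzU p hp, hz2 p hp]
  have i5 : Integrable (fun p => dirDeriv t χ p * (conjPotential e t φ p * v p ^ 2)) μ :=
    hint _ (by fun_prop) fun p hp => by simp [hz p hp]
  have hI := integral_mono (i1.add i2) (i3.add (i4.add i5)) hpoint
  rw [integral_add' i1 i2, integral_add' i3 (i4.add i5), integral_add' i4 i5, hA] at hI
  have e1 : ∀ p, (η p * rexp (φ p) * U p) ^ 2 = v p ^ 2 := fun p => by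
    simp only [hv_def]; ring
  simp only [e1]
  linarith

/-- The Caccioppoli inequality for globally defined functions. -/
theorem caccioppoli {μ : Measure W} [μ.IsAddHaarMeasure]
    {e : ι → W} {t : W} {U ζ χ : W → ℝ} (hU : ContDiff ℝ ∞ U) (hUc : HasCompactSupport U)
    (hζ : ContDiff ℝ ∞ ζ) (hχ : ContDiff ℝ ∞ χ)
    (hχe : ∀ i, dirDeriv (e i) χ = fun _ => 0) (hχ0 : ∀ p, 0 ≤ χ p)
    (hχt : ∀ p, 0 ≤ dirDeriv t χ p) {c : ℝ} (hc : 0 ≤ c)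
    (hpde : ∀ p ∈ tsupport ζ, χ p ≠ 0 →
      (dirDeriv t U p + lapAlong e U p) ^ 2 ≤ c * (gradSq e U p + U p ^ 2)) :
    ∫ p, χ p * (ζ p ^ 2 * gradSq e U p) ∂μ ≤
      2 * ∫ p, χ p * (((c + 3) * ζ p ^ 2 + 4 * gradSq e ζ p + dirDeriv t ζ p ^ 2)
        * U p ^ 2) ∂μ := by
  have hzU : ∀ p, p ∉ tsupport U → U p = 0 := fun p => image_eq_zero_of_notMem_tsupport
  have hz1 : ∀ p w, p ∉ tsupport U → dirDeriv w U p = 0 :=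
    fun p w hp => dirDeriv_eq_zero_of_notMem_tsupport hp
  have hz2 : ∀ p, p ∉ tsupport U → gradSq e U p = 0 :=
    fun p => gradSq_eq_zero_of_notMem_tsupport
  have hint : ∀ F : W → ℝ, ContDiff ℝ ∞ F → (∀ p, p ∉ tsupport U → F p = 0) →
      Integrable F μ := fun F hF h => hF.integrable_of_eq_zero hUc h
  have hint0 : ∀ (F : W → ℝ) (w : W), ContDiff ℝ ∞ F → (∀ p, p ∉ tsupport U → F p = 0) →
      ∫ p, dirDeriv w F p ∂μ = 0 := fun F w hF h =>
    integral_dirDeriv_eq_zero hF (HasCompactSupport.intro hUc.isCompact h)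
  have hint1 : ∀ (F : W → ℝ) (w : W), ContDiff ℝ ∞ F → (∀ p, p ∉ tsupport U → F p = 0) →
      Integrable (fun p => dirDeriv w F p) μ := fun F w hF h =>
    (hF.dirDeriv (v := w)).continuous.integrable_of_hasCompactSupport
      (HasCompactSupport.intro hUc.isCompact h).dirDeriv
  have hpoint : ∀ p, χ p * (ζ p ^ 2 * gradSq e U p) ≤
      2 * (χ p * (((c + 3) * ζ p ^ 2 + 4 * gradSq e ζ p + dirDeriv t ζ p ^ 2) * U p ^ 2))
      + 2 * ((∑ i, dirDeriv (e i) (fun p => χ p * (ζ p ^ 2 * (U p * dirDeriv (e i) U p))) p)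
      + (1 / 2 * dirDeriv t (fun p => χ p * (ζ p ^ 2 * U p ^ 2)) p)) := by
    intro p
    have hs : (∑ i, dirDeriv (e i) (fun p => χ p * (ζ p ^ 2 * (U p * dirDeriv (e i) U p))) p)
        = χ p * (ζ p ^ 2 * (gradSq e U p + U p * lapAlong e U p)
          + 2 * ζ p * U p * ∑ i, dirDeriv (e i) ζ p * dirDeriv (e i) U p) := by
      simp (disch := fun_prop) only [dirDeriv_mul, dirDeriv_pow_two, hχe, gradSq, lapAlong,
        Finset.mul_sum, ← Finset.sum_add_distrib]
      exact Finset.sum_congr rfl fun i _ => by ring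
    have ht : dirDeriv t (fun p => χ p * (ζ p ^ 2 * U p ^ 2)) p
        = χ p * (2 * ζ p ^ 2 * U p * dirDeriv t U p + 2 * ζ p * dirDeriv t ζ p * U p ^ 2)
          + dirDeriv t χ p * (ζ p ^ 2 * U p ^ 2) := by
      simp (disch := fun_prop) only [dirDeriv_mul, dirDeriv_pow_two]
      ring
    rw [hs, ht]
    have hpos : 0 ≤ dirDeriv t χ p * (ζ p ^ 2 * U p ^ 2) := mul_nonneg (hχt p) (by positivity)
    have hcs := sum_dirDeriv_mul_sq_le e ζ U p
    generalize (∑ i, dirDeriv (e i) ζ p * dirDeriv (e i) U p) = S at *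
    have g1 := gradSq_nonneg e ζ p
    have g2 := gradSq_nonneg e U p
    by_cases hp : p ∈ tsupport ζ ∧ χ p ≠ 0
    · have h1 := hpde p hp.1 hp.2
      have key : ζ p ^ 2 * gradSq e U p ≤
          2 * (((c + 3) * ζ p ^ 2 + 4 * gradSq e ζ p + dirDeriv t ζ p ^ 2) * U p ^ 2)
          + 2 * ((ζ p ^ 2 * (gradSq e U p + U p * lapAlong e U p) + 2 * ζ p * U p * S)
          + (ζ p ^ 2 * U p * dirDeriv t U p + ζ p * dirDeriv t ζ p * U p ^ 2)) := by
        generalize gradSq e ζ p = Gζ at *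
        generalize gradSq e U p = GU at *
        generalize dirDeriv t U p = Ut at *
        generalize lapAlong e U p = LU at *
        generalize dirDeriv t ζ p = ζt at *
        generalize ζ p = z at *
        generalize U p = u at *
        have q1 : |2 * u * (Ut + LU)| ≤ 1 / 2 * (GU + u ^ 2) + 2 * c * u ^ 2 := by
          refine abs_le_of_sq_le_sq ?_ (by positivity)
          nlinarith [mul_le_mul_of_nonneg_left h1 (sq_nonneg u),
            sq_nonneg (1 / 2 * (GU + u ^ 2) - 2 * c * u ^ 2)]
        have q2 : |4 * z * u * S| ≤ 1 / 2 * (z ^ 2 * GU) + 8 * (u ^ 2 * Gζ) := by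
          refine abs_le_of_sq_le_sq ?_ (by positivity)
          nlinarith [mul_le_mul_of_nonneg_left hcs (sq_nonneg (z * u)),
            sq_nonneg (1 / 2 * (z ^ 2 * GU) - 8 * (u ^ 2 * Gζ))]
        have q3 := mul_le_mul_of_nonneg_left (abs_le.1 q1).1 (sq_nonneg z)
        have q4 := (abs_le.1 q2).1
        have q5 : 0 ≤ (z + ζt) ^ 2 * u ^ 2 := by positivity
        have q6 : 0 ≤ ζt ^ 2 * u ^ 2 := by positivity
        have q7 : 0 ≤ z ^ 2 * u ^ 2 := by positivity
        linarith
      have := mul_le_mul_of_nonneg_left key (hχ0 p)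
      linarith
    · rw [not_and_or, not_not] at hp
      rcases hp with hp | hp
      · have a1 : ζ p = 0 := image_eq_zero_of_notMem_tsupport hp
        simp only [a1, gradSq_eq_zero_of_notMem_tsupport hp,
          dirDeriv_eq_zero_of_notMem_tsupport hp] at hpos ⊢
        simp
      · simp only [hp]
        linarith
  have i1 : Integrable (fun p => χ p * (ζ p ^ 2 * gradSq e U p)) μ :=
    hint _ (by fun_prop) fun p hp => by simp [hz2 p hp]
  have i2 : Integrable (fun p =>
      2 * (χ p * (((c + 3) * ζ p ^ 2 + 4 * gradSq e ζ p + dirDeriv t ζ p ^ 2) * U p ^ 2))) μ :=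
    hint _ (by fun_prop) fun p hp => by simp [hzU p hp]
  have i3 : Integrable (fun p =>
      ∑ i, dirDeriv (e i) (fun p => χ p * (ζ p ^ 2 * (U p * dirDeriv (e i) U p))) p) μ :=
    integrable_finsetSum _ fun i _ => hint1 _ _ (by fun_prop) fun p hp => by simp [hzU p hp]
  have i4 : Integrable (fun p => dirDeriv t (fun p => χ p * (ζ p ^ 2 * U p ^ 2)) p) μ :=
    hint1 _ _ (by fun_prop) fun p hp => by simp [hzU p hp]
  have hI := integral_mono i1 (i2.add ((i3.add (i4.const_mul (1 / 2))).const_mul 2)) hpoint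
  rw [integral_add' i2 ((i3.add (i4.const_mul (1 / 2))).const_mul 2), integral_const_mul,
    integral_const_mul, integral_add' i3 (i4.const_mul (1 / 2)), integral_const_mul,
    integral_finsetSum, hint0 _ _ (by fun_prop) (fun p hp => by simp [hzU p hp]),
    Finset.sum_eq_zero fun i _ => hint0 _ _ (by fun_prop) (fun p hp => by simp [hzU p hp])] at hI
  · linarith
  · intro i _
    exact hint1 _ _ (by fun_prop) fun p hp => by simp [hzU p hp]

end CarlemanEstimate

section SpaceTime

variable {n : ℕ}

/-- The coordinate directions in space, as vectors of space-time. -/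
noncomputable def spaceDir (i : Fin n) : EuclideanSpace ℝ (Fin n) × ℝ :=
  (EuclideanSpace.single i 1, 0)

/-- The time direction in space-time. -/
noncomputable def timeDir : EuclideanSpace ℝ (Fin n) × ℝ := (0, 1)

theorem dirDeriv_snd {v : EuclideanSpace ℝ (Fin n) × ℝ} :
    dirDeriv v (fun p : EuclideanSpace ℝ (Fin n) × ℝ => p.2) = fun _ => v.2 := by
  funext p
  have : HasFDerivAt (fun p : EuclideanSpace ℝ (Fin n) × ℝ => p.2)
    (ContinuousLinearMap.snd ℝ (EuclideanSpace ℝ (Fin n)) ℝ) p := hasFDerivAt_snd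
  rw [dirDeriv, this.fderiv]
  rfl

theorem dirDeriv_comp_snd {v : EuclideanSpace ℝ (Fin n) × ℝ} {g : ℝ → ℝ} (hg : ContDiff ℝ ∞ g) :
    dirDeriv v (fun p : EuclideanSpace ℝ (Fin n) × ℝ => g p.2) = fun p => deriv g p.2 * v.2 := by
  rw [dirDeriv_comp hg contDiff_snd, dirDeriv_snd]

/-- A cutoff in time, vanishing for times at most `δ`, equal to one for times at least `2 * δ`. -/
noncomputable def timeCutoff (δ : ℝ) (p : EuclideanSpace ℝ (Fin n) × ℝ) : ℝ :=
  smoothTransition ((p.2 - δ) / δ)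

theorem exists_deriv_smoothTransition_le :
    ∃ C : ℝ, 0 < C ∧ ∀ x, deriv smoothTransition x ≤ C := by
  have hc : Continuous (deriv smoothTransition) :=
    (smoothTransition.contDiff (n := 1)).continuous_deriv le_rfl
  obtain ⟨C, hC⟩ := (isCompact_Icc (a := (0 : ℝ)) (b := 1)).exists_bound_of_continuousOn
    hc.continuousOn
  refine ⟨max C 1, by positivity, fun x => ?_⟩
  rcases lt_or_ge x 0 with hx | hx
  · have : smoothTransition =ᶠ[𝓝 x] fun _ => 0 := by
      filter_upwards [Iio_mem_nhds hx] with y hy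
      exact smoothTransition.zero_of_nonpos (le_of_lt hy)
    rw [this.deriv_eq]; simp
  rcases lt_or_ge 1 x with hx1 | hx1
  · have : smoothTransition =ᶠ[𝓝 x] fun _ => 1 := by
      filter_upwards [Ioi_mem_nhds hx1] with y hy
      exact smoothTransition.one_of_one_le (le_of_lt hy)
    rw [this.deriv_eq]; simp
  exact ((le_abs_self _).trans (hC x ⟨hx, hx1⟩)).trans (le_max_left _ _)

section timeCutoff

variable {δ : ℝ}

@[fun_prop]
theorem contDiff_timeCutoff : ContDiff ℝ ∞ (timeCutoff (n := n) δ) := by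
  have h : ContDiff ℝ ∞ fun p : EuclideanSpace ℝ (Fin n) × ℝ => (p.2 - δ) / δ := by fun_prop
  exact smoothTransition.contDiff.comp h

theorem timeCutoff_nonneg (p : EuclideanSpace ℝ (Fin n) × ℝ) : 0 ≤ timeCutoff δ p :=
  smoothTransition.nonneg _

theorem timeCutoff_le_one (p : EuclideanSpace ℝ (Fin n) × ℝ) : timeCutoff δ p ≤ 1 :=
  smoothTransition.le_one _

theorem timeCutoff_eq_zero (hδ : 0 < δ) {p : EuclideanSpace ℝ (Fin n) × ℝ} (hp : p.2 ≤ δ) :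
    timeCutoff δ p = 0 :=
  smoothTransition.zero_of_nonpos (div_nonpos_of_nonpos_of_nonneg (by linarith) hδ.le)

theorem timeCutoff_eq_one (hδ : 0 < δ) {p : EuclideanSpace ℝ (Fin n) × ℝ} (hp : 2 * δ ≤ p.2) :
    timeCutoff δ p = 1 :=
  smoothTransition.one_of_one_le ((one_le_div hδ).2 (by linarith))

theorem dirDeriv_timeCutoff (v : EuclideanSpace ℝ (Fin n) × ℝ) :
    dirDeriv v (timeCutoff δ) = fun p => deriv smoothTransition ((p.2 - δ) / δ) * (v.2 / δ) := by
  have h : timeCutoff (n := n) δ = fun p => smoothTransition (δ⁻¹ * (p.2 - δ)) := by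
    funext p; rw [timeCutoff]; ring_nf
  rw [h, dirDeriv_comp smoothTransition.contDiff (by fun_prop)]
  simp (disch := fun_prop) only [dirDeriv_const_mul, dirDeriv_sub, dirDeriv_snd, dirDeriv_const]
  funext p
  rw [show δ⁻¹ * (p.2 - δ) = (p.2 - δ) / δ by ring]
  ring

theorem dirDeriv_spaceDir_timeCutoff (i : Fin n) :
    dirDeriv (spaceDir i) (timeCutoff (n := n) δ) = fun _ => 0 := by
  rw [dirDeriv_timeCutoff]
  simp [spaceDir]

theorem dirDeriv_timeDir_timeCutoff_nonneg (hδ : 0 < δ) (p : EuclideanSpace ℝ (Fin n) × ℝ) :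
    0 ≤ dirDeriv timeDir (timeCutoff δ) p := by
  rw [dirDeriv_timeCutoff]
  refine mul_nonneg ?_ (by simp [timeDir, hδ.le])
  exact smoothTransition.monotone.deriv_nonneg

theorem dirDeriv_timeDir_timeCutoff_eq_zero (hδ : 0 < δ) {p : EuclideanSpace ℝ (Fin n) × ℝ}
    (hp : p.2 ∉ Icc δ (2 * δ)) : dirDeriv timeDir (timeCutoff δ) p = 0 := by
  rw [mem_Icc, not_and_or, not_le, not_le] at hp
  rcases hp with hp | hp
  · have : timeCutoff δ =ᶠ[𝓝 p] fun _ => 0 := by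
      filter_upwards [(isOpen_Iio.preimage continuous_snd).mem_nhds hp] with q hq
      exact timeCutoff_eq_zero hδ (le_of_lt hq)
    rw [this.dirDeriv.eq_of_nhds, dirDeriv_const]
  · have : timeCutoff δ =ᶠ[𝓝 p] fun _ => 1 := by
      filter_upwards [(isOpen_Ioi.preimage continuous_snd).mem_nhds hp] with q hq
      exact timeCutoff_eq_one hδ (le_of_lt hq)
    rw [this.dirDeriv.eq_of_nhds, dirDeriv_const]

end timeCutoff

/-- Bounded solutions of a backward parabolic differential inequality on `Ω × (0, T)`
with vanishing initial values. -/
structure BackwardSol (Ω : Set (EuclideanSpace ℝ (Fin n))) (T c M : ℝ)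
    (U : EuclideanSpace ℝ (Fin n) × ℝ → ℝ) : Prop where
  isOpen : IsOpen Ω
  pos : 0 < T
  nonneg : 0 ≤ c
  contDiffOn : ContDiffOn ℝ ∞ U (Ω ×ˢ Ioo 0 T)
  bound : ∀ x ∈ Ω, ∀ s ∈ Ioo 0 T, |U (x, s)| ≤ M
  pde : ∀ p ∈ Ω ×ˢ Ioo 0 T, (dirDeriv timeDir U p + lapAlong spaceDir U p) ^ 2 ≤
    c * (gradSq spaceDir U p + U p ^ 2)
  tendsto : ∀ x ∈ Ω, Tendsto (fun s => U (x, s)) (𝓝[>] 0) (𝓝 0)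

end SpaceTime

section Localization

theorem Filter.EventuallyEq.gradSq {W : Type*} [NormedAddCommGroup W] [NormedSpace ℝ W]
    {ι : Type*} [Fintype ι] {e : ι → W} {F G : W → ℝ} {p : W} (h : F =ᶠ[𝓝 p] G) :
    _root_.gradSq e F p = _root_.gradSq e G p := by
  simp only [_root_.gradSq]
  exact Finset.sum_congr rfl fun i _ => by rw [h.dirDeriv.eq_of_nhds]

theorem Filter.EventuallyEq.lapAlong {W : Type*} [NormedAddCommGroup W] [NormedSpace ℝ W]
    {ι : Type*} [Fintype ι] {e : ι → W} {F G : W → ℝ} {p : W} (h : F =ᶠ[𝓝 p] G) :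
    _root_.lapAlong e F p = _root_.lapAlong e G p := by
  simp only [_root_.lapAlong]
  exact Finset.sum_congr rfl fun i _ => by rw [h.dirDeriv.dirDeriv.eq_of_nhds]

/-- A smooth function on an open set agrees near a given compact subset with a globally defined
one. -/
theorem ContDiffOn.exists_contDiff_eventuallyEq {W : Type*} [NormedAddCommGroup W]
    [NormedSpace ℝ W] [FiniteDimensional ℝ W] {U : W → ℝ} {O K : Set W} (hU : ContDiffOn ℝ ∞ U O)
    (hO : IsOpen O) (hK : IsCompact K) (hKO : K ⊆ O) :
    ∃ F : W → ℝ, ContDiff ℝ ∞ F ∧ HasCompactSupport F ∧ ∀ p ∈ K, F =ᶠ[𝓝 p] U := by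
  obtain ⟨ρ, hρ, hρc, hρs, -, hρ1⟩ := exists_contDiff_cutoff hK hO hKO
  refine ⟨fun p => ρ p * U p, ?_, hρc.mul_right, fun p hp => ?_⟩
  · rw [contDiff_iff_contDiffAt]
    intro p
    by_cases hp : p ∈ tsupport ρ
    · exact hρ.contDiffAt.mul (hU.contDiffAt (hO.mem_nhds (hρs hp)))
    · have : (fun p => ρ p * U p) =ᶠ[𝓝 p] fun _ => 0 := by
        filter_upwards [(isClosed_tsupport ρ).isOpen_compl.mem_nhds hp] with q hq
        rw [image_eq_zero_of_notMem_tsupport hq, zero_mul]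
      exact contDiffAt_const.congr_of_eventuallyEq this
  · filter_upwards [hρ1 p hp] with q hq
    rw [hq, one_mul]

end Localization

namespace BackwardSol

variable {n : ℕ} {Ω : Set (EuclideanSpace ℝ (Fin n))} {T c M : ℝ}
  {U : EuclideanSpace ℝ (Fin n) × ℝ → ℝ}

theorem isOpen_prod (h : BackwardSol Ω T c M U) : IsOpen (Ω ×ˢ Ioo 0 T) :=
  h.isOpen.prod isOpen_Ioo

instance isAddHaarMeasure_volume_prod :
    (volume : Measure (EuclideanSpace ℝ (Fin n) × ℝ)).IsAddHaarMeasure := by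
  rw [Measure.volume_eq_prod]
  infer_instance

/-- The set of positive times. -/
def posTime (n : ℕ) : Set (EuclideanSpace ℝ (Fin n) × ℝ) := {p | 0 < p.2}

theorem measurableSet_posTime : MeasurableSet (posTime n) :=
  measurableSet_lt measurable_const measurable_snd

theorem setLIntegral_posTime_le {F : EuclideanSpace ℝ (Fin n) × ℝ → ENNReal} {B : ENNReal}
    (h : ∀ᶠ δ in 𝓝[>] (0 : ℝ), ∫⁻ p in {p | 2 * δ ≤ p.2}, F p ≤ B) :
    ∫⁻ p in posTime n, F p ≤ B := by
  have hU : posTime n = ⋃ m : ℕ, {p | 1 / ((m : ℝ) + 1) ≤ p.2} := by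
    ext p
    simp only [posTime, mem_ofPred_eq, mem_iUnion]
    constructor
    · intro hp
      obtain ⟨m, hm⟩ := exists_nat_one_div_lt hp
      exact ⟨m, hm.le⟩
    · rintro ⟨m, hm⟩
      exact lt_of_lt_of_le (by positivity) hm
  rw [hU, setLIntegral_iUnion_of_directed]
  · refine iSup_le fun m => ?_
    have h2 : ∀ᶠ δ in 𝓝[>] (0 : ℝ), δ < 1 / ((m : ℝ) + 1) / 2 :=
      mem_nhdsWithin_of_mem_nhds (Iio_mem_nhds (by positivity))
    obtain ⟨δ, hδ, hδ2⟩ := (h.and h2).exists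
    refine le_trans (lintegral_mono_set fun p hp => ?_) hδ
    simp only [mem_ofPred_eq] at hp ⊢
    linarith
  · refine Monotone.directed_le fun a b hab p hp => ?_
    simp only [mem_ofPred_eq] at hp ⊢
    refine le_trans ?_ hp
    gcongr

theorem isCompact_tsupport_inter {η : EuclideanSpace ℝ (Fin n) × ℝ → ℝ}
    (hη : HasCompactSupport η) (δ : ℝ) : IsCompact (tsupport η ∩ {p | δ ≤ p.2}) :=
  hη.isCompact.inter_right (isClosed_le continuous_const continuous_snd)

/-- The spatial `L²` norms tend to zero at the initial time. -/
theorem tendsto_lintegral_sq (h : BackwardSol Ω T c M U) {K : Set (EuclideanSpace ℝ (Fin n))}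
    (hK : IsCompact K) (hKΩ : K ⊆ Ω) :
    Tendsto (fun s => ∫⁻ x in K, ENNReal.ofReal (U (x, s) ^ 2)) (𝓝[>] 0) (𝓝 0) := by
  have hI : Ioo (0 : ℝ) T ∈ 𝓝[>] (0 : ℝ) := Ioo_mem_nhdsGT h.pos
  have h0 : (0 : ENNReal) = ∫⁻ x in K, (fun _ : EuclideanSpace ℝ (Fin n) => 0) x := by simp
  rw [h0]
  refine tendsto_lintegral_filter_of_dominated_convergence' (fun _ => ENNReal.ofReal (M ^ 2))
    ?_ ?_ ?_ ?_
  · filter_upwards [hI] with s hs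
    have hc : ContinuousOn (fun x => U (x, s)) K := by
      refine h.contDiffOn.continuousOn.comp (by fun_prop) fun x hx => ⟨hKΩ hx, hs⟩
    exact ((hc.pow 2).aemeasurable hK.measurableSet).ennreal_ofReal
  · filter_upwards [hI] with s hs
    refine (ae_restrict_iff' hK.measurableSet).2 (Eventually.of_forall fun x hx => ?_)
    exact ENNReal.ofReal_le_ofReal (sq_le_sq' (abs_le.1 (h.bound x (hKΩ hx) s hs)).1
      (abs_le.1 (h.bound x (hKΩ hx) s hs)).2)
  · rw [setLIntegral_const]
    exact (ENNReal.mul_lt_top ENNReal.ofReal_lt_top hK.measure_lt_top).ne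
  · refine (ae_restrict_iff' hK.measurableSet).2 (Eventually.of_forall fun x hx => ?_)
    have := ((h.tendsto x (hKΩ hx)).pow 2)
    simpa using ENNReal.tendsto_ofReal this

/-- The contribution of a time cutoff near the initial time is negligible. -/
theorem eventually_setLIntegral_le (h : BackwardSol Ω T c M U)
    {K : Set (EuclideanSpace ℝ (Fin n))}
    (hK : IsCompact K) (hKΩ : K ⊆ Ω) {ε : ENNReal} (hε : 0 < ε) :
    ∀ᶠ δ in 𝓝[>] (0 : ℝ), ∫⁻ p in K ×ˢ Icc δ (2 * δ), ENNReal.ofReal (U p ^ 2)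
      ≤ ε * ENNReal.ofReal δ := by
  have h1 := (h.tendsto_lintegral_sq hK hKΩ).eventually (ge_mem_nhds hε)
  rw [eventually_nhdsWithin_iff, Metric.eventually_nhds_iff] at h1
  obtain ⟨r, hr, h1⟩ := h1
  have hI : Ioo (0 : ℝ) (min (T / 2) (r / 2)) ∈ 𝓝[>] (0 : ℝ) :=
    Ioo_mem_nhdsGT (by have := h.pos; positivity)
  filter_upwards [hI] with δ hδ
  have hδT : 2 * δ < T := by have := hδ.2.trans_le (min_le_left _ _); linarith
  have hδr : 2 * δ < r := by have := hδ.2.trans_le (min_le_right _ _); linarith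
  have hm : AEMeasurable (fun p => ENNReal.ofReal (U p ^ 2))
      (((volume : Measure (EuclideanSpace ℝ (Fin n))).restrict K).prod
        ((volume : Measure ℝ).restrict (Icc δ (2 * δ)))) := by
    rw [Measure.prod_restrict]
    refine (((h.contDiffOn.continuousOn.mono ?_).pow 2).aemeasurable
      (hK.measurableSet.prod measurableSet_Icc)).ennreal_ofReal
    rintro ⟨x, s⟩ ⟨hx, hs⟩
    exact ⟨hKΩ hx, lt_of_lt_of_le hδ.1 hs.1, lt_of_le_of_lt hs.2 hδT⟩
  rw [Measure.volume_eq_prod, ← Measure.prod_restrict, lintegral_prod_symm _ hm]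
  calc ∫⁻ s in Icc δ (2 * δ), ∫⁻ x in K, ENNReal.ofReal (U (x, s) ^ 2)
      ≤ ∫⁻ s in Icc δ (2 * δ), ε := by
        refine setLIntegral_mono measurable_const fun s hs => h1 ?_ (lt_of_lt_of_le hδ.1 hs.1)
        rw [Real.dist_eq, sub_zero, abs_of_pos (lt_of_lt_of_le hδ.1 hs.1)]
        exact lt_of_le_of_lt hs.2 hδr
    _ = ε * ENNReal.ofReal δ := by
        rw [setLIntegral_const, Real.volume_Icc]
        congr 2; ring

theorem exists_global (h : BackwardSol Ω T c M U) {η : EuclideanSpace ℝ (Fin n) × ℝ → ℝ}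
    (hηc : HasCompactSupport η) (hη : tsupport η ⊆ Ω ×ˢ Iio T) {δ : ℝ} (hδ : 0 < δ) :
    ∃ F : EuclideanSpace ℝ (Fin n) × ℝ → ℝ, ContDiff ℝ ∞ F ∧ HasCompactSupport F ∧
      ∀ p ∈ tsupport η, δ ≤ p.2 → F p = U p ∧ gradSq spaceDir F p = gradSq spaceDir U p
        ∧ (dirDeriv timeDir F p + lapAlong spaceDir F p) ^ 2 ≤
          c * (gradSq spaceDir F p + F p ^ 2) := by
  have hsub : tsupport η ∩ {p | δ ≤ p.2} ⊆ Ω ×ˢ Ioo 0 T := fun p hp =>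
    ⟨(hη hp.1).1, lt_of_lt_of_le hδ hp.2, (hη hp.1).2⟩
  obtain ⟨F, hF, hFc, hFU⟩ := h.contDiffOn.exists_contDiff_eventuallyEq h.isOpen_prod
    (isCompact_tsupport_inter hηc δ) hsub
  refine ⟨F, hF, hFc, fun p hp hδp => ?_⟩
  have hpK : p ∈ tsupport η ∩ {p | δ ≤ p.2} := ⟨hp, hδp⟩
  have hE := hFU p hpK
  refine ⟨hE.eq_of_nhds, hE.gradSq, ?_⟩
  rw [hE.gradSq, hE.lapAlong, hE.dirDeriv.eq_of_nhds, hE.eq_of_nhds]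
  exact h.pde p (hsub hpK)

/-- The Carleman estimate for a cut off bounded solution with vanishing initial values. -/
theorem carleman (h : BackwardSol Ω T c M U) {η φ b : EuclideanSpace ℝ (Fin n) × ℝ → ℝ}
    (hη : ContDiff ℝ ∞ η) (hφ : ContDiff ℝ ∞ φ) (hb : ContDiff ℝ ∞ b)
    (hηc : HasCompactSupport η) (hηs : tsupport η ⊆ Ω ×ˢ Iio T)
    (hform : ∀ p ∈ tsupport η, 0 < p.2 → ∀ ξ : Fin n → ℝ,
      8 * c * ∑ i, ξ i ^ 2 ≤ commForm spaceDir φ b p ξ)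
    (hpot : ∀ p ∈ tsupport η, 0 < p.2 →
      1 + 8 * c * gradSq spaceDir φ p + 2 * c + (lapAlong spaceDir φ p + b p) ^ 2
        ≤ commPotential spaceDir timeDir φ b p) :
    ∫⁻ p in posTime n, ENNReal.ofReal ((η p * rexp (φ p) * U p) ^ 2) ≤
      ∫⁻ p in posTime n, ENNReal.ofReal (cutoffError spaceDir timeDir c η p *
        (gradSq spaceDir U p + U p ^ 2) * rexp (φ p) ^ 2) := by
  refine ENNReal.le_of_forall_pos_le_add fun ε hε _ => ?_
  set K : Set (EuclideanSpace ℝ (Fin n)) := Prod.fst '' tsupport η with hKdef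
  have hK : IsCompact K := hηc.isCompact.image continuous_fst
  have hKΩ : K ⊆ Ω := by
    rintro x ⟨p, hp, rfl⟩
    exact (hηs hp).1
  obtain ⟨C₁, hC₁0, hC₁⟩ := exists_deriv_smoothTransition_le
  obtain ⟨C₂, hC₂⟩ : ∃ C, ∀ p, ‖conjPotential spaceDir timeDir φ p * (η p * rexp (φ p)) ^ 2‖ ≤ C := by
    refine Continuous.bounded_above_of_compact_support
      (f := fun p => conjPotential spaceDir timeDir φ p * (η p * rexp (φ p)) ^ 2)
      (ContDiff.continuous (𝕜 := ℝ) (n := ∞) (by fun_prop)) ?_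
    refine HasCompactSupport.intro hηc.isCompact fun p hp => ?_
    simp [image_eq_zero_of_notMem_tsupport hp]
  have hC₂0 : 0 ≤ C₂ := (norm_nonneg _).trans (hC₂ 0)
  set C := C₁ * (C₂ + 1) with hC
  have hC0 : 0 < C := by positivity
  refine setLIntegral_posTime_le ?_
  have hεC : 0 < (ε : ENNReal) / ENNReal.ofReal C :=
    ENNReal.div_pos (by exact_mod_cast hε.ne') ENNReal.ofReal_ne_top
  filter_upwards [h.eventually_setLIntegral_le hK hKΩ hεC, self_mem_nhdsWithin] with δ hδ hδ0
  rw [mem_Ioi] at hδ0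
  obtain ⟨F, hF, hFc, hFU⟩ := h.exists_global hηc hηs hδ0
  have hle : ∀ p : EuclideanSpace ℝ (Fin n) × ℝ, timeCutoff δ p ≠ 0 → δ ≤ p.2 :=
    fun p hp => by
      by_contra hlt
      exact hp (timeCutoff_eq_zero hδ0 (not_le.1 hlt).le)
  have hpos : ∀ p : EuclideanSpace ℝ (Fin n) × ℝ, timeCutoff δ p ≠ 0 → 0 < p.2 :=
    fun p hp => lt_of_lt_of_le hδ0 (hle p hp)
  have key := carleman_estimate (μ := volume) (e := spaceDir) (t := timeDir) hF hFc hη hφ hb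
    (contDiff_timeCutoff (n := n) (δ := δ)) (fun i => dirDeriv_spaceDir_timeCutoff i)
    timeCutoff_nonneg (dirDeriv_timeDir_timeCutoff_nonneg hδ0) h.nonneg
    (fun p hp hpt => (hFU p hp (hle p hpt)).2.2) (fun p hp hpt => hform p hp (hpos p hpt))
    (fun p hp hpt => hpot p hp (hpos p hpt))
  have hint : ∀ G : EuclideanSpace ℝ (Fin n) × ℝ → ℝ, ContDiff ℝ ∞ G →
      (∀ p, p ∉ tsupport η → G p = 0) → Integrable G volume :=
    fun G hG h => hG.integrable_of_eq_zero hηc h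
  have hz : ∀ p, p ∉ tsupport η → η p = 0 := fun p => image_eq_zero_of_notMem_tsupport
  have i1 : Integrable (fun p => timeCutoff δ p * (η p * rexp (φ p) * F p) ^ 2) volume :=
    hint _ (by fun_prop) fun p hp => by simp [hz p hp]
  have i2 : Integrable (fun p => timeCutoff δ p * (cutoffError spaceDir timeDir c η p *
      (gradSq spaceDir F p + F p ^ 2) * rexp (φ p) ^ 2)) volume :=
    hint _ (by fun_prop) fun p hp => by simp [cutoffError_eq_zero_of_notMem_tsupport hp]
  have key2 := ENNReal.ofReal_le_ofReal key
  refine le_trans ?_ (key2.trans (ENNReal.ofReal_add_le.trans (add_le_add ?_ ?_)))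
  · rw [ofReal_integral_eq_lintegral_ofReal i1
      (Eventually.of_forall fun p => mul_nonneg (timeCutoff_nonneg p) (sq_nonneg _))]
    rw [← lintegral_indicator (measurableSet_le measurable_const measurable_snd)]
    refine lintegral_mono fun p => ?_
    by_cases hp : p ∈ {p : EuclideanSpace ℝ (Fin n) × ℝ | 2 * δ ≤ p.2}
    · rw [indicator_of_mem hp, timeCutoff_eq_one hδ0 hp, one_mul]
      by_cases hpη : p ∈ tsupport η
      · rw [(hFU p hpη (by rw [mem_ofPred_eq] at hp; linarith)).1]
      · simp [hz p hpη]
    · rw [indicator_of_notMem hp]; exact zero_le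
  · rw [ofReal_integral_eq_lintegral_ofReal i2 (Eventually.of_forall fun p =>
      mul_nonneg (timeCutoff_nonneg p) (mul_nonneg (mul_nonneg (cutoffError_nonneg h.nonneg _ _)
        (add_nonneg (gradSq_nonneg _ _ _) (sq_nonneg _))) (sq_nonneg _)))]
    rw [← lintegral_indicator measurableSet_posTime]
    refine lintegral_mono fun p => ?_
    by_cases hpt : timeCutoff δ p = 0
    · simp [hpt]
    rw [indicator_of_mem (show p ∈ posTime n from hpos p hpt)]
    by_cases hpη : p ∈ tsupport η
    · rw [(hFU p hpη (hle p hpt)).1, (hFU p hpη (hle p hpt)).2.1]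
      refine ENNReal.ofReal_le_ofReal (mul_le_of_le_one_left ?_ (timeCutoff_le_one p))
      exact mul_nonneg (mul_nonneg (cutoffError_nonneg h.nonneg _ _)
        (add_nonneg (gradSq_nonneg _ _ _) (sq_nonneg _))) (sq_nonneg _)
    · simp [cutoffError_eq_zero_of_notMem_tsupport hpη]
  · have i3 : Integrable (fun p => dirDeriv timeDir (timeCutoff δ) p *
        (conjPotential spaceDir timeDir φ p * (η p * rexp (φ p) * F p) ^ 2)) volume :=
      hint _ (by fun_prop) fun p hp => by simp [hz p hp]
    have hb : ∀ p, dirDeriv timeDir (timeCutoff δ) p *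
        (conjPotential spaceDir timeDir φ p * (η p * rexp (φ p) * F p) ^ 2) ≤
        C / δ * F p ^ 2 := by
      intro p
      have a1 : dirDeriv timeDir (timeCutoff δ) p ≤ C₁ / δ := by
        rw [dirDeriv_timeCutoff]
        simp only [timeDir, mul_one_div]
        exact div_le_div_of_nonneg_right (hC₁ _) hδ0.le
      have a2 := dirDeriv_timeDir_timeCutoff_nonneg hδ0 p
      have a3 := (le_abs_self _).trans (hC₂ p)
      calc dirDeriv timeDir (timeCutoff δ) p *
            (conjPotential spaceDir timeDir φ p * (η p * rexp (φ p) * F p) ^ 2)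
          = dirDeriv timeDir (timeCutoff δ) p *
            ((conjPotential spaceDir timeDir φ p * (η p * rexp (φ p)) ^ 2) * F p ^ 2) := by ring
        _ ≤ dirDeriv timeDir (timeCutoff δ) p * ((C₂ + 1) * F p ^ 2) := by
            refine mul_le_mul_of_nonneg_left (mul_le_mul_of_nonneg_right ?_ (sq_nonneg _)) a2
            linarith
        _ ≤ C₁ / δ * ((C₂ + 1) * F p ^ 2) := by gcongr
        _ = C / δ * F p ^ 2 := by rw [hC]; ring
    calc ENNReal.ofReal (∫ p, dirDeriv timeDir (timeCutoff δ) p *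
        (conjPotential spaceDir timeDir φ p * (η p * rexp (φ p) * F p) ^ 2))
        ≤ ∫⁻ p, ENNReal.ofReal (dirDeriv timeDir (timeCutoff δ) p *
        (conjPotential spaceDir timeDir φ p * (η p * rexp (φ p) * F p) ^ 2)) := by
          rw [integral_eq_lintegral_pos_part_sub_lintegral_neg_part i3]
          refine ENNReal.ofReal_le_of_le_toReal ?_
          exact sub_le_self _ ENNReal.toReal_nonneg
      _ ≤ ∫⁻ p, (K ×ˢ Icc δ (2 * δ)).indicator
            (fun p => ENNReal.ofReal (C / δ) * ENNReal.ofReal (U p ^ 2)) p := by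
          refine lintegral_mono fun p => ?_
          by_cases hpη : p ∈ tsupport η
          · by_cases hps : p.2 ∈ Icc δ (2 * δ)
            · rw [indicator_of_mem (show p ∈ K ×ˢ Icc δ (2 * δ) from ⟨⟨p, hpη, rfl⟩, hps⟩),
                ← ENNReal.ofReal_mul (by positivity)]
              refine ENNReal.ofReal_le_ofReal ((hb p).trans ?_)
              rw [(hFU p hpη hps.1).1]
            · rw [dirDeriv_timeDir_timeCutoff_eq_zero hδ0 hps]; simp
          · simp [hz p hpη]
      _ = ENNReal.ofReal (C / δ) * ∫⁻ p in K ×ˢ Icc δ (2 * δ), ENNReal.ofReal (U p ^ 2) := by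
          rw [lintegral_indicator (hK.measurableSet.prod measurableSet_Icc),
            lintegral_const_mul' _ _ ENNReal.ofReal_ne_top]
      _ ≤ ENNReal.ofReal (C / δ) * (ε / ENNReal.ofReal C * ENNReal.ofReal δ) := by gcongr
      _ = ε := by
          rw [ENNReal.ofReal_div_of_pos hδ0, mul_comm (_ / _) (ENNReal.ofReal δ), ← mul_assoc,
            ENNReal.div_mul_cancel (by simpa using hδ0) ENNReal.ofReal_ne_top,
            ENNReal.mul_div_cancel (by simpa using hC0) ENNReal.ofReal_ne_top]

/-- The Caccioppoli inequality for a cut off bounded solution. -/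
theorem caccioppoli (h : BackwardSol Ω T c M U) {ζ : EuclideanSpace ℝ (Fin n) × ℝ → ℝ}
    (hζ : ContDiff ℝ ∞ ζ) (hζc : HasCompactSupport ζ) (hζs : tsupport ζ ⊆ Ω ×ˢ Iio T) :
    ∫⁻ p in posTime n, ENNReal.ofReal (ζ p ^ 2 * gradSq spaceDir U p) ≤
      ∫⁻ p in posTime n, ENNReal.ofReal (2 * (((c + 3) * ζ p ^ 2 + 4 * gradSq spaceDir ζ p
        + dirDeriv timeDir ζ p ^ 2) * U p ^ 2)) := by
  refine setLIntegral_posTime_le ?_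
  filter_upwards [self_mem_nhdsWithin] with δ hδ0
  rw [mem_Ioi] at hδ0
  obtain ⟨F, hF, hFc, hFU⟩ := h.exists_global hζc hζs hδ0
  have hle : ∀ p : EuclideanSpace ℝ (Fin n) × ℝ, timeCutoff δ p ≠ 0 → δ ≤ p.2 :=
    fun p hp => by
      by_contra hlt
      exact hp (timeCutoff_eq_zero hδ0 (not_le.1 hlt).le)
  have hpos : ∀ p : EuclideanSpace ℝ (Fin n) × ℝ, timeCutoff δ p ≠ 0 → 0 < p.2 :=
    fun p hp => lt_of_lt_of_le hδ0 (hle p hp)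
  have key := _root_.caccioppoli (μ := volume) (e := spaceDir) (t := timeDir) hF hFc hζ
    (contDiff_timeCutoff (n := n) (δ := δ)) (fun i => dirDeriv_spaceDir_timeCutoff i)
    timeCutoff_nonneg (dirDeriv_timeDir_timeCutoff_nonneg hδ0) h.nonneg
    (fun p hp hpt => (hFU p hp (hle p hpt)).2.2)
  rw [← integral_const_mul] at key
  have hint : ∀ G : EuclideanSpace ℝ (Fin n) × ℝ → ℝ, ContDiff ℝ ∞ G →
      (∀ p, p ∉ tsupport ζ → G p = 0) → Integrable G volume :=
    fun G hG h => hG.integrable_of_eq_zero hζc h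
  have hz : ∀ p, p ∉ tsupport ζ → ζ p = 0 := fun p => image_eq_zero_of_notMem_tsupport
  have hz1 : ∀ p, p ∉ tsupport ζ → (c + 3) * ζ p ^ 2 + 4 * gradSq spaceDir ζ p
        + dirDeriv timeDir ζ p ^ 2 = 0 := fun p hp => by
    simp [hz p hp, gradSq_eq_zero_of_notMem_tsupport hp, dirDeriv_eq_zero_of_notMem_tsupport hp]
  have hz2 : ∀ p, 0 ≤ (c + 3) * ζ p ^ 2 + 4 * gradSq spaceDir ζ p
        + dirDeriv timeDir ζ p ^ 2 := fun p => by
    have := gradSq_nonneg spaceDir ζ p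
    have := h.nonneg
    positivity
  have i1 : Integrable (fun p => timeCutoff δ p * (ζ p ^ 2 * gradSq spaceDir F p)) volume :=
    hint _ (by fun_prop) fun p hp => by simp [hz p hp]
  have i2 : Integrable (fun p => 2 * (timeCutoff δ p * (((c + 3) * ζ p ^ 2
      + 4 * gradSq spaceDir ζ p + dirDeriv timeDir ζ p ^ 2) * F p ^ 2))) volume :=
    hint _ (by fun_prop) fun p hp => by simp [hz1 p hp]
  refine le_trans ?_ ((ENNReal.ofReal_le_ofReal key).trans ?_)
  · rw [ofReal_integral_eq_lintegral_ofReal i1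
      (Eventually.of_forall fun p => mul_nonneg (timeCutoff_nonneg p)
        (mul_nonneg (sq_nonneg _) (gradSq_nonneg _ _ _)))]
    rw [← lintegral_indicator (measurableSet_le measurable_const measurable_snd)]
    refine lintegral_mono fun p => ?_
    by_cases hp : p ∈ {p : EuclideanSpace ℝ (Fin n) × ℝ | 2 * δ ≤ p.2}
    · rw [indicator_of_mem hp, timeCutoff_eq_one hδ0 hp, one_mul]
      by_cases hpη : p ∈ tsupport ζ
      · rw [(hFU p hpη (by rw [mem_ofPred_eq] at hp; linarith)).2.1]
      · simp [hz p hpη]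
    · rw [indicator_of_notMem hp]; exact zero_le
  · rw [ofReal_integral_eq_lintegral_ofReal i2 (Eventually.of_forall fun p =>
      mul_nonneg (by norm_num) (mul_nonneg (timeCutoff_nonneg p)
        (mul_nonneg (hz2 p) (sq_nonneg _))))]
    rw [← lintegral_indicator measurableSet_posTime]
    refine lintegral_mono fun p => ?_
    by_cases hpt : timeCutoff δ p = 0
    · simp [hpt]
    rw [indicator_of_mem (show p ∈ posTime n from hpos p hpt)]
    by_cases hpη : p ∈ tsupport ζ
    · rw [(hFU p hpη (hle p hpt)).1]
      refine ENNReal.ofReal_le_ofReal (mul_le_mul_of_nonneg_left ?_ (by norm_num))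
      exact mul_le_of_le_one_left (mul_nonneg (hz2 p) (sq_nonneg _)) (timeCutoff_le_one p)
    · simp [hz1 p hpη]

end BackwardSol

section Separable

variable {n : ℕ}

/-- The coordinate directions in space. -/
noncomputable def coordDir (i : Fin n) : EuclideanSpace ℝ (Fin n) := EuclideanSpace.single i 1

/-- The Hessian of `f`, as a quadratic form. -/
noncomputable def hessForm (f : EuclideanSpace ℝ (Fin n) → ℝ) (x : EuclideanSpace ℝ (Fin n))
    (ξ : Fin n → ℝ) : ℝ :=
  ∑ i, (∑ j, dirDeriv (coordDir i) (dirDeriv (coordDir j) f) x * ξ j) * ξ i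

theorem dirDeriv_comp_fst {v : EuclideanSpace ℝ (Fin n) × ℝ} {f : EuclideanSpace ℝ (Fin n) → ℝ}
    (hf : ContDiff ℝ ∞ f) : dirDeriv v (fun p : EuclideanSpace ℝ (Fin n) × ℝ => f p.1)
      = fun p => dirDeriv v.1 f p.1 := by
  funext p
  have h1 : HasFDerivAt f (fderiv ℝ f p.1) p.1 :=
    (hf.contDiffAt.differentiableAt (by simp)).hasFDerivAt
  have h2 := h1.comp p (hasFDerivAt_fst (𝕜 := ℝ) (p := p))
  simp only [Function.comp_def] at h2
  rw [dirDeriv, h2.fderiv]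
  rfl

variable {f m : EuclideanSpace ℝ (Fin n) → ℝ} {g ψ : ℝ → ℝ} {K : ℝ}

theorem dirDeriv_spaceDir_separable (hf : ContDiff ℝ ∞ f) (hg : ContDiff ℝ ∞ g)
    (hψ : ContDiff ℝ ∞ ψ) (i : Fin n) :
    dirDeriv (spaceDir i) (fun p : EuclideanSpace ℝ (Fin n) × ℝ => g p.2 * f p.1 + ψ p.2)
      = fun p => g p.2 * dirDeriv (coordDir i) f p.1 := by
  rw [dirDeriv_add (by fun_prop) (by fun_prop), dirDeriv_mul (by fun_prop) (by fun_prop),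
    dirDeriv_comp_snd hg, dirDeriv_comp_snd hψ, dirDeriv_comp_fst hf]
  funext p
  simp [spaceDir, coordDir]

theorem dirDeriv_timeDir_separable (hf : ContDiff ℝ ∞ f) (hg : ContDiff ℝ ∞ g)
    (hψ : ContDiff ℝ ∞ ψ) :
    dirDeriv timeDir (fun p : EuclideanSpace ℝ (Fin n) × ℝ => g p.2 * f p.1 + ψ p.2)
      = fun p => deriv g p.2 * f p.1 + deriv ψ p.2 := by
  rw [dirDeriv_add (by fun_prop) (by fun_prop), dirDeriv_mul (by fun_prop) (by fun_prop),
    dirDeriv_comp_snd hg, dirDeriv_comp_snd hψ, dirDeriv_comp_fst hf]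
  funext p
  simp [timeDir, dirDeriv]

theorem gradSq_separable (hf : ContDiff ℝ ∞ f) (hg : ContDiff ℝ ∞ g) (hψ : ContDiff ℝ ∞ ψ) :
    gradSq spaceDir (fun p : EuclideanSpace ℝ (Fin n) × ℝ => g p.2 * f p.1 + ψ p.2)
      = fun p => g p.2 ^ 2 * gradSq coordDir f p.1 := by
  funext p
  simp only [gradSq, dirDeriv_spaceDir_separable hf hg hψ, mul_pow, Finset.mul_sum]

theorem dirDeriv_dirDeriv_separable (hf : ContDiff ℝ ∞ f) (hg : ContDiff ℝ ∞ g)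
    (hψ : ContDiff ℝ ∞ ψ) (i j : Fin n) :
    dirDeriv (spaceDir i) (dirDeriv (spaceDir j)
      (fun p : EuclideanSpace ℝ (Fin n) × ℝ => g p.2 * f p.1 + ψ p.2))
      = fun p => g p.2 * dirDeriv (coordDir i) (dirDeriv (coordDir j) f) p.1 := by
  rw [dirDeriv_spaceDir_separable hf hg hψ]
  have h := dirDeriv_spaceDir_separable (hf.dirDeriv (v := coordDir j)) hg
    (contDiff_const (c := (0 : ℝ))) i
  simpa using h

theorem lapAlong_separable (hf : ContDiff ℝ ∞ f) (hg : ContDiff ℝ ∞ g) (hψ : ContDiff ℝ ∞ ψ) :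
    lapAlong spaceDir (fun p : EuclideanSpace ℝ (Fin n) × ℝ => g p.2 * f p.1 + ψ p.2)
      = fun p => g p.2 * lapAlong coordDir f p.1 := by
  funext p
  simp only [lapAlong, dirDeriv_dirDeriv_separable hf hg hψ, Finset.mul_sum]

theorem conjPotential_separable (hf : ContDiff ℝ ∞ f) (hg : ContDiff ℝ ∞ g)
    (hψ : ContDiff ℝ ∞ ψ) :
    conjPotential spaceDir timeDir
      (fun p : EuclideanSpace ℝ (Fin n) × ℝ => g p.2 * f p.1 + ψ p.2)
      = fun p => g p.2 ^ 2 * gradSq coordDir f p.1 - (deriv g p.2 * f p.1 + deriv ψ p.2) := by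
  funext p
  rw [conjPotential, gradSq_separable hf hg hψ, dirDeriv_timeDir_separable hf hg hψ]

theorem commForm_separable (hf : ContDiff ℝ ∞ f) (hg : ContDiff ℝ ∞ g)
    (hψ : ContDiff ℝ ∞ ψ) (p : EuclideanSpace ℝ (Fin n) × ℝ) (ξ : Fin n → ℝ) :
    commForm spaceDir (fun p : EuclideanSpace ℝ (Fin n) × ℝ => g p.2 * f p.1 + ψ p.2)
      (fun p => g p.2 * m p.1 + -K) p ξ = 4 * g p.2 * hessForm f p.1 ξ
        - 2 * (g p.2 * (lapAlong coordDir f p.1 + m p.1) - K) * ∑ i, ξ i ^ 2 := by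
  have h : ∑ i, (∑ j, g p.2 * dirDeriv (coordDir i) (dirDeriv (coordDir j) f) p.1 * ξ j) * ξ i
      = g p.2 * hessForm f p.1 ξ := by
    simp only [hessForm, Finset.mul_sum, Finset.sum_mul, mul_assoc]
  rw [commForm, lapAlong_separable hf hg hψ]
  simp only [dirDeriv_dirDeriv_separable hf hg hψ, h]
  ring

theorem dirDeriv_gradSq (hf : ContDiff ℝ ∞ f) (i : Fin n) (x : EuclideanSpace ℝ (Fin n)) :
    dirDeriv (coordDir i) (gradSq coordDir f) x
      = 2 * ∑ j, dirDeriv (coordDir i) (dirDeriv (coordDir j) f) x * dirDeriv (coordDir j) f x := by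
  have h : gradSq coordDir f = fun x => ∑ j, dirDeriv (coordDir j) f x ^ 2 := rfl
  rw [h, dirDeriv_sum (fun j => by fun_prop)]
  simp (disch := fun_prop) only [dirDeriv_pow_two, Finset.mul_sum]
  exact Finset.sum_congr rfl fun j _ => by ring

theorem commPotential_separable (hf : ContDiff ℝ ∞ f) (hm : ContDiff ℝ ∞ m) (hg : ContDiff ℝ ∞ g)
    (hψ : ContDiff ℝ ∞ ψ) (p : EuclideanSpace ℝ (Fin n) × ℝ) :
    commPotential spaceDir timeDir
      (fun p : EuclideanSpace ℝ (Fin n) × ℝ => g p.2 * f p.1 + ψ p.2)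
      (fun p => g p.2 * m p.1 + -K) p =
      4 * g p.2 ^ 3 * hessForm f p.1 (fun i => dirDeriv (coordDir i) f p.1)
      - 4 * g p.2 * deriv g p.2 * gradSq coordDir f p.1
      + deriv (deriv g) p.2 * f p.1 + deriv (deriv ψ) p.2
      + 2 * (g p.2 * (lapAlong coordDir f p.1 + m p.1) - K) *
        (g p.2 ^ 2 * gradSq coordDir f p.1 - deriv g p.2 * f p.1 - deriv ψ p.2)
      + g p.2 * lapAlong coordDir m p.1 := by
  have hg' : ContDiff ℝ ∞ (deriv g) := (contDiff_infty_iff_deriv.1 hg).2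
  have hψ' : ContDiff ℝ ∞ (deriv ψ) := (contDiff_infty_iff_deriv.1 hψ).2
  have hgf : ContDiff ℝ ∞ (gradSq coordDir f) := by fun_prop
  have hi : ∀ i, dirDeriv (spaceDir i) (fun p : EuclideanSpace ℝ (Fin n) × ℝ =>
      g p.2 ^ 2 * gradSq coordDir f p.1 - (deriv g p.2 * f p.1 + deriv ψ p.2)) p
      = g p.2 ^ 2 * (2 * ∑ j, dirDeriv (coordDir i) (dirDeriv (coordDir j) f) p.1
          * dirDeriv (coordDir j) f p.1) - deriv g p.2 * dirDeriv (coordDir i) f p.1 := by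
    intro i
    have h2 : dirDeriv (spaceDir i) (fun p : EuclideanSpace ℝ (Fin n) × ℝ =>
        g p.2 ^ 2 * gradSq coordDir f p.1) p
        = g p.2 ^ 2 * dirDeriv (coordDir i) (gradSq coordDir f) p.1 := by
      have h := dirDeriv_spaceDir_separable hgf (hg.pow 2) (contDiff_const (c := (0 : ℝ))) i
      simpa using congrFun h p
    rw [dirDeriv_sub (by fun_prop) (by fun_prop), dirDeriv_spaceDir_separable hf hg' hψ']
    simp only [h2, dirDeriv_gradSq hf]
  have ht : dirDeriv timeDir (fun p : EuclideanSpace ℝ (Fin n) × ℝ =>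
      g p.2 ^ 2 * gradSq coordDir f p.1 - (deriv g p.2 * f p.1 + deriv ψ p.2)) p
      = 2 * g p.2 * deriv g p.2 * gradSq coordDir f p.1
        - (deriv (deriv g) p.2 * f p.1 + deriv (deriv ψ) p.2) := by
    have h2 : dirDeriv timeDir (fun p : EuclideanSpace ℝ (Fin n) × ℝ =>
        g p.2 ^ 2 * gradSq coordDir f p.1) p
        = 2 * g p.2 * deriv g p.2 * gradSq coordDir f p.1 := by
      have h := dirDeriv_timeDir_separable hgf (hg.pow 2) (contDiff_const (c := (0 : ℝ)))
      have hd : deriv (fun s => g s ^ 2) p.2 = 2 * g p.2 * deriv g p.2 := by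
        have := ((hg.differentiable (by simp) p.2).hasDerivAt.pow 2).deriv
        simpa [Pi.pow_def] using this
      have h' := congrFun h p
      simpa [Pi.pow_def, hd] using h'
    rw [dirDeriv_sub (by fun_prop) (by fun_prop), dirDeriv_timeDir_separable hf hg' hψ']
    simp only [h2]
  have hsum : ∑ i, (g p.2 ^ 2 * (2 * ∑ j, dirDeriv (coordDir i) (dirDeriv (coordDir j) f) p.1
          * dirDeriv (coordDir j) f p.1) - deriv g p.2 * dirDeriv (coordDir i) f p.1)
        * (g p.2 * dirDeriv (coordDir i) f p.1)
      = 2 * g p.2 ^ 3 * hessForm f p.1 (fun i => dirDeriv (coordDir i) f p.1)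
        - g p.2 * deriv g p.2 * gradSq coordDir f p.1 := by
    simp only [hessForm, gradSq, Finset.mul_sum, ← Finset.sum_sub_distrib]
    refine Finset.sum_congr rfl fun i _ => ?_
    simp only [← Finset.mul_sum]
    ring
  rw [commPotential, conjPotential_separable hf hg hψ, lapAlong_separable hf hg hψ,
    lapAlong_separable hm hg contDiff_const, ht]
  simp only [hi, dirDeriv_spaceDir_separable hf hg hψ, hsum]
  ring

end Separable

section ScaledCutoff

variable {n : ℕ}

theorem dirDeriv_comp_scale {Θ : EuclideanSpace ℝ (Fin n) × ℝ → ℝ} (hΘ : ContDiff ℝ ∞ Θ)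
    (a : ℝ) (x₀ : EuclideanSpace ℝ (Fin n)) (v : EuclideanSpace ℝ (Fin n) × ℝ) :
    dirDeriv v (fun p : EuclideanSpace ℝ (Fin n) × ℝ => Θ (a • (p.1 - x₀), p.2))
      = fun p => dirDeriv (a • v.1, v.2) Θ (a • (p.1 - x₀), p.2) := by
  funext p
  have h1 : HasFDerivAt (fun p : EuclideanSpace ℝ (Fin n) × ℝ => (a • (p.1 - x₀), p.2))
      ((a • ContinuousLinearMap.fst ℝ (EuclideanSpace ℝ (Fin n)) ℝ).prod
        (ContinuousLinearMap.snd ℝ (EuclideanSpace ℝ (Fin n)) ℝ)) p :=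
    ((hasFDerivAt_fst.sub_const x₀).const_smul a).prodMk hasFDerivAt_snd
  have h2 : HasFDerivAt Θ (fderiv ℝ Θ (a • (p.1 - x₀), p.2)) (a • (p.1 - x₀), p.2) :=
    (hΘ.contDiffAt.differentiableAt (by simp)).hasFDerivAt
  have h3 := HasFDerivAt.comp p h2 h1
  simp only [Function.comp_def] at h3
  rw [dirDeriv, h3.fderiv]
  rfl

theorem dirDeriv_spaceDir_comp_scale {Θ : EuclideanSpace ℝ (Fin n) × ℝ → ℝ}
    (hΘ : ContDiff ℝ ∞ Θ) (a : ℝ) (x₀ : EuclideanSpace ℝ (Fin n)) (i : Fin n) :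
    dirDeriv (spaceDir i) (fun p : EuclideanSpace ℝ (Fin n) × ℝ => Θ (a • (p.1 - x₀), p.2))
      = fun p => a * dirDeriv (spaceDir i) Θ (a • (p.1 - x₀), p.2) := by
  have h : (a • (spaceDir i : EuclideanSpace ℝ (Fin n) × ℝ).1,
      (spaceDir i : EuclideanSpace ℝ (Fin n) × ℝ).2) = a • spaceDir i := by
    simp [spaceDir]
  rw [dirDeriv_comp_scale hΘ, h, dirDeriv_smul]

theorem gradSq_comp_scale {Θ : EuclideanSpace ℝ (Fin n) × ℝ → ℝ} (hΘ : ContDiff ℝ ∞ Θ) (a : ℝ)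
    (x₀ : EuclideanSpace ℝ (Fin n)) (p : EuclideanSpace ℝ (Fin n) × ℝ) :
    gradSq spaceDir (fun p : EuclideanSpace ℝ (Fin n) × ℝ => Θ (a • (p.1 - x₀), p.2)) p
      = a ^ 2 * gradSq spaceDir Θ (a • (p.1 - x₀), p.2) := by
  simp only [gradSq, dirDeriv_spaceDir_comp_scale hΘ, mul_pow, Finset.mul_sum]

theorem lapAlong_comp_scale {Θ : EuclideanSpace ℝ (Fin n) × ℝ → ℝ} (hΘ : ContDiff ℝ ∞ Θ) (a : ℝ)
    (x₀ : EuclideanSpace ℝ (Fin n)) (p : EuclideanSpace ℝ (Fin n) × ℝ) :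
    lapAlong spaceDir (fun p : EuclideanSpace ℝ (Fin n) × ℝ => Θ (a • (p.1 - x₀), p.2)) p
      = a ^ 2 * lapAlong spaceDir Θ (a • (p.1 - x₀), p.2) := by
  have hs : ContDiff ℝ ∞ fun p : EuclideanSpace ℝ (Fin n) × ℝ => (a • (p.1 - x₀), p.2) := by
    fun_prop
  simp only [lapAlong, Finset.mul_sum, dirDeriv_spaceDir_comp_scale hΘ]
  refine Finset.sum_congr rfl fun i _ => ?_
  have hc := (hΘ.dirDeriv (v := spaceDir i)).comp hs
  simp only [Function.comp_def] at hc
  rw [dirDeriv_const_mul a hc]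
  simp only [dirDeriv_spaceDir_comp_scale (hΘ.dirDeriv (v := spaceDir i))]
  ring

theorem dirDeriv_timeDir_comp_scale {Θ : EuclideanSpace ℝ (Fin n) × ℝ → ℝ} (hΘ : ContDiff ℝ ∞ Θ)
    (a : ℝ) (x₀ : EuclideanSpace ℝ (Fin n)) (p : EuclideanSpace ℝ (Fin n) × ℝ) :
    dirDeriv timeDir (fun p : EuclideanSpace ℝ (Fin n) × ℝ => Θ (a • (p.1 - x₀), p.2)) p
      = dirDeriv timeDir Θ (a • (p.1 - x₀), p.2) := by
  rw [dirDeriv_comp_scale hΘ]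
  simp [timeDir]

theorem exists_abs_le_of_hasCompactSupport {W : Type*} [TopologicalSpace W] [R1Space W]
    {F Θ : W → ℝ} (hF : Continuous F) (hΘ : HasCompactSupport Θ)
    (h : ∀ p ∉ tsupport Θ, F p = 0) : ∃ C, ∀ p, |F p| ≤ C :=
  (HasCompactSupport.intro hΘ h).exists_bound_of_continuous hF

/-- Cutoffs adapted to the balls of radius `R₁ * L < R₂ * L`, with derivative bounds that do not
depend on the centre and on the scale `L ≥ r₀`. -/
theorem exists_scaled_cutoff {r₀ R₁ R₂ t₁ t₂ : ℝ} (hr : 0 < r₀) (hR : R₁ < R₂) (ht : t₁ < t₂) :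
    ∃ B : ℝ, 0 ≤ B ∧ ∀ (x₀ : EuclideanSpace ℝ (Fin n)) (L : ℝ), r₀ ≤ L →
      ∃ η : EuclideanSpace ℝ (Fin n) × ℝ → ℝ, ContDiff ℝ ∞ η ∧ HasCompactSupport η ∧
        tsupport η ⊆ Metric.ball x₀ (R₂ * L) ×ˢ Iio t₂ ∧ (∀ p, 0 ≤ η p ∧ η p ≤ 1) ∧
        (∀ p ∈ Metric.closedBall x₀ (R₁ * L) ×ˢ Icc 0 t₁, η =ᶠ[𝓝 p] fun _ => 1) ∧
        ∀ p, gradSq spaceDir η p ≤ B ∧ |dirDeriv timeDir η p| ≤ B ∧ |lapAlong spaceDir η p| ≤ B := by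
  obtain ⟨Θ, hΘ, hΘc, hΘs, hΘ01, hΘ1⟩ := exists_contDiff_cutoff
    (K := Metric.closedBall (0 : EuclideanSpace ℝ (Fin n)) R₁ ×ˢ Icc 0 t₁)
    (O := Metric.ball (0 : EuclideanSpace ℝ (Fin n)) R₂ ×ˢ Iio t₂)
    ((isCompact_closedBall _ _).prod isCompact_Icc) (Metric.isOpen_ball.prod isOpen_Iio)
    (prod_mono (Metric.closedBall_subset_ball hR) fun s hs => hs.2.trans_lt ht)
  obtain ⟨B₁, hB₁⟩ := exists_abs_le_of_hasCompactSupport (F := gradSq spaceDir Θ)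
    (hΘ.gradSq.continuous) hΘc fun p hp => gradSq_eq_zero_of_notMem_tsupport hp
  obtain ⟨B₂, hB₂⟩ := exists_abs_le_of_hasCompactSupport (F := dirDeriv timeDir Θ)
    (hΘ.dirDeriv.continuous) hΘc fun p hp => dirDeriv_eq_zero_of_notMem_tsupport hp
  obtain ⟨B₃, hB₃⟩ := exists_abs_le_of_hasCompactSupport (F := lapAlong spaceDir Θ)
    (hΘ.lapAlong.continuous) hΘc fun p hp => lapAlong_eq_zero_of_notMem_tsupport hp
  have n1 : 0 ≤ B₁ := (abs_nonneg _).trans (hB₁ 0)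
  have n2 : 0 ≤ B₂ := (abs_nonneg _).trans (hB₂ 0)
  have n3 : 0 ≤ B₃ := (abs_nonneg _).trans (hB₃ 0)
  refine ⟨(r₀⁻¹) ^ 2 * B₁ + B₂ + (r₀⁻¹) ^ 2 * B₃, by positivity, fun x₀ L hL => ?_⟩
  have hL0 : 0 < L := hr.trans_le hL
  have hLr : (L⁻¹) ^ 2 ≤ (r₀⁻¹) ^ 2 := by gcongr
  have hs : ContDiff ℝ ∞ fun p : EuclideanSpace ℝ (Fin n) × ℝ => (L⁻¹ • (p.1 - x₀), p.2) := by
    fun_prop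
  have hsupp : tsupport (fun p : EuclideanSpace ℝ (Fin n) × ℝ => Θ (L⁻¹ • (p.1 - x₀), p.2))
      ⊆ (fun p : EuclideanSpace ℝ (Fin n) × ℝ => (L⁻¹ • (p.1 - x₀), p.2)) ⁻¹' tsupport Θ :=
    tsupport_comp_subset_preimage Θ hs.continuous
  refine ⟨fun p => Θ (L⁻¹ • (p.1 - x₀), p.2), hΘ.comp hs, ?_, ?_, fun p => hΘ01 _, ?_, ?_⟩
  · refine HasCompactSupport.of_support_subset_isCompact (hΘc.image
      (f := fun q : EuclideanSpace ℝ (Fin n) × ℝ => (L • q.1 + x₀, q.2)) (by fun_prop)) ?_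
    intro p hp
    exact ⟨_, hsupp (subset_tsupport _ hp), by simp [smul_smul, hL0.ne']⟩
  · intro p hp
    obtain ⟨h1, h2⟩ := hΘs (hsupp hp)
    refine ⟨?_, h2⟩
    rw [mem_ball_zero_iff, norm_smul, norm_inv, Real.norm_of_nonneg hL0.le,
      inv_mul_lt_iff₀ hL0] at h1
    rw [mem_ball_iff_norm, mul_comm]
    exact h1
  · intro p hp
    refine (hs.continuous.tendsto p).eventually (hΘ1 _ ⟨?_, hp.2⟩)
    have h1 := hp.1
    rw [mem_closedBall_iff_norm] at h1
    rw [mem_closedBall_zero_iff, norm_smul, norm_inv, Real.norm_of_nonneg hL0.le,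
      inv_mul_le_iff₀ hL0, mul_comm]
    exact h1
  · intro p
    rw [gradSq_comp_scale hΘ, lapAlong_comp_scale hΘ, dirDeriv_timeDir_comp_scale hΘ, abs_mul,
      abs_of_nonneg (sq_nonneg L⁻¹)]
    set q : EuclideanSpace ℝ (Fin n) × ℝ := (L⁻¹ • (p.1 - x₀), p.2)
    have b1 : (L⁻¹) ^ 2 * gradSq spaceDir Θ q ≤ (r₀⁻¹) ^ 2 * B₁ :=
      mul_le_mul hLr ((le_abs_self _).trans (hB₁ q)) (gradSq_nonneg _ _ _) (sq_nonneg _)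
    have b3 : (L⁻¹) ^ 2 * |lapAlong spaceDir Θ q| ≤ (r₀⁻¹) ^ 2 * B₃ :=
      mul_le_mul hLr (hB₃ q) (abs_nonneg _) (sq_nonneg _)
    have p1 : 0 ≤ (r₀⁻¹) ^ 2 * B₁ := by positivity
    have p3 : 0 ≤ (r₀⁻¹) ^ 2 * B₃ := by positivity
    exact ⟨by linarith, by linarith [hB₂ q], by linarith⟩

end ScaledCutoff

theorem setLIntegral_le_of_subset_support {α : Type*} [MeasurableSpace α] {μ : Measure α}
    {A S : Set α} (hA : MeasurableSet A) (hS : MeasurableSet S) {F G : α → ENNReal}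
    (h0 : ∀ p ∈ A, p ∉ S → F p = 0) (h1 : ∀ p ∈ A, p ∈ S → F p ≤ G p) :
    ∫⁻ p in A, F p ∂μ ≤ ∫⁻ p in S, G p ∂μ := by
  rw [← lintegral_indicator hA, ← lintegral_indicator hS]
  refine lintegral_mono fun p => ?_
  by_cases hpA : p ∈ A
  · by_cases hpS : p ∈ S
    · simp only [indicator_of_mem hpA, indicator_of_mem hpS, h1 p hpA hpS]
    · simp only [indicator_of_mem hpA, h0 p hpA hpS, zero_le]
  · simp only [indicator_of_notMem hpA, zero_le]

section Coordinates

variable {n : ℕ}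

theorem dirDeriv_norm_sub_sq {v x₀ : EuclideanSpace ℝ (Fin n)} :
    dirDeriv v (fun x : EuclideanSpace ℝ (Fin n) => ‖x - x₀‖ ^ 2)
      = fun x => 2 * inner ℝ (x - x₀) v := by
  funext x
  have h := ((hasFDerivAt_id (𝕜 := ℝ) x).sub_const x₀).norm_sq
  simp only [id] at h
  rw [dirDeriv, h.fderiv]
  simp [inner_sub_left]

theorem dirDeriv_inner {v e : EuclideanSpace ℝ (Fin n)} :
    dirDeriv v (fun x : EuclideanSpace ℝ (Fin n) => inner ℝ e x) = fun _ => inner ℝ e v := by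
  funext x
  have h := (innerSL ℝ e).hasFDerivAt (x := x)
  have h' : HasFDerivAt (fun x : EuclideanSpace ℝ (Fin n) => inner ℝ e x) (innerSL ℝ e) x := h
  rw [dirDeriv, h'.fderiv]
  simp

theorem inner_coordDir (x : EuclideanSpace ℝ (Fin n)) (i : Fin n) :
    inner ℝ x (coordDir i) = x i := by
  simp [coordDir, EuclideanSpace.inner_single_right]

theorem contDiff_norm_sub_sq (x₀ : EuclideanSpace ℝ (Fin n)) :
    ContDiff ℝ ∞ fun x : EuclideanSpace ℝ (Fin n) => ‖x - x₀‖ ^ 2 :=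
  (contDiff_id.sub contDiff_const).norm_sq ℝ

theorem dirDeriv_apply {v : EuclideanSpace ℝ (Fin n)} (i : Fin n) :
    dirDeriv v (fun x : EuclideanSpace ℝ (Fin n) => x i) = fun _ => v i := by
  have := dirDeriv_inner (v := v) (e := coordDir i)
  simpa only [real_inner_comm, inner_coordDir] using this

theorem coordDir_apply (i j : Fin n) :
    (coordDir i : EuclideanSpace ℝ (Fin n)) j = if j = i then 1 else 0 := by
  simp [coordDir]

theorem norm_sq_eq_sum (x : EuclideanSpace ℝ (Fin n)) : ‖x‖ ^ 2 = ∑ i, x i ^ 2 := by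
  simp [EuclideanSpace.norm_sq_eq]

end Coordinates

section Paraboloid

variable {n : ℕ} (x₀ : EuclideanSpace ℝ (Fin n))

theorem dirDeriv_coordDir_neg_norm_sub_sq (i : Fin n) :
    dirDeriv (coordDir i) (fun x : EuclideanSpace ℝ (Fin n) => -1 * ‖x - x₀‖ ^ 2)
      = fun x => -2 * (x i - x₀ i) := by
  rw [dirDeriv_const_mul _ (contDiff_norm_sub_sq x₀), dirDeriv_norm_sub_sq]
  funext x
  simp only [inner_coordDir, PiLp.sub_apply]
  ring

theorem dirDeriv_dirDeriv_coordDir_neg_norm_sub_sq (i j : Fin n) :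
    dirDeriv (coordDir i) (dirDeriv (coordDir j)
      (fun x : EuclideanSpace ℝ (Fin n) => -1 * ‖x - x₀‖ ^ 2))
      = fun _ => if j = i then -2 else 0 := by
  have hj : ContDiff ℝ ∞ fun x : EuclideanSpace ℝ (Fin n) => x j := by fun_prop
  rw [dirDeriv_coordDir_neg_norm_sub_sq]
  simp (disch := fun_prop) only [dirDeriv_const_mul, dirDeriv_sub, dirDeriv_const, dirDeriv_apply,
    coordDir_apply]
  funext x
  split_ifs <;> simp

theorem gradSq_neg_norm_sub_sq (x : EuclideanSpace ℝ (Fin n)) :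
    gradSq coordDir (fun x : EuclideanSpace ℝ (Fin n) => -1 * ‖x - x₀‖ ^ 2) x
      = 4 * ‖x - x₀‖ ^ 2 := by
  simp only [gradSq, dirDeriv_coordDir_neg_norm_sub_sq]
  rw [norm_sq_eq_sum, Finset.mul_sum]
  simp only [PiLp.sub_apply]
  exact Finset.sum_congr rfl fun i _ => by ring

theorem lapAlong_neg_norm_sub_sq (x : EuclideanSpace ℝ (Fin n)) :
    lapAlong coordDir (fun x : EuclideanSpace ℝ (Fin n) => -1 * ‖x - x₀‖ ^ 2) x = -2 * n := by
  simp only [lapAlong, dirDeriv_dirDeriv_coordDir_neg_norm_sub_sq]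
  simp [mul_comm]

theorem hessForm_neg_norm_sub_sq (x : EuclideanSpace ℝ (Fin n)) (ξ : Fin n → ℝ) :
    hessForm (fun x : EuclideanSpace ℝ (Fin n) => -1 * ‖x - x₀‖ ^ 2) x ξ = -2 * ∑ i, ξ i ^ 2 := by
  simp only [hessForm, dirDeriv_dirDeriv_coordDir_neg_norm_sub_sq, ite_mul, zero_mul,
    Finset.sum_ite_eq', Finset.mem_univ, if_true, Finset.mul_sum]
  exact Finset.sum_congr rfl fun i _ => by ring

end Paraboloid

theorem exists_pow_le_exp_sq (n : ℕ) {a : ℝ} (ha : 0 < a) :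
    ∃ C : ℝ, 0 < C ∧ ∀ L : ℝ, 0 ≤ L → L ^ n ≤ C * rexp (a * L ^ 2) := by
  refine ⟨1 + n.factorial / a ^ n, by positivity, fun L hL => ?_⟩
  have h1 := Real.pow_div_factorial_le_exp (a * L ^ 2) (by positivity) n
  have h2 : (L ^ n) ^ 2 ≤ n.factorial / a ^ n * rexp (a * L ^ 2) := by
    rw [div_le_iff₀ (by positivity), mul_pow] at h1
    rw [div_mul_eq_mul_div, le_div_iff₀ (by positivity)]
    calc (L ^ n) ^ 2 * a ^ n = a ^ n * (L ^ 2) ^ n := by ring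
      _ ≤ _ := by linarith
  have h3 : 1 ≤ rexp (a * L ^ 2) := one_le_exp (by positivity)
  nlinarith [sq_nonneg (L ^ n - 1)]

namespace BackwardSol

variable {n : ℕ} {Ω : Set (EuclideanSpace ℝ (Fin n))} {T c M : ℝ}
  {U : EuclideanSpace ℝ (Fin n) × ℝ → ℝ}

theorem exists_setLIntegral_gradSq_le (h : BackwardSol Ω T c M U) {r₀ R₁ R₂ t₁ t₂ : ℝ}
    (hr : 0 < r₀) (hR : R₁ < R₂) (ht : t₁ < t₂) (hT : t₂ ≤ T) :
    ∃ C : ℝ, 0 ≤ C ∧ ∀ (x₀ : EuclideanSpace ℝ (Fin n)) (L : ℝ), r₀ ≤ L →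
      Metric.ball x₀ (R₂ * L) ⊆ Ω →
      ∫⁻ p in Metric.ball x₀ (R₁ * L) ×ˢ Ioo 0 t₁, ENNReal.ofReal (gradSq spaceDir U p) ≤
        ENNReal.ofReal C *
          ∫⁻ p in Metric.ball x₀ (R₂ * L) ×ˢ Ioo 0 t₂, ENNReal.ofReal (U p ^ 2) := by
  obtain ⟨B, hB0, hB⟩ := exists_scaled_cutoff (n := n) hr hR ht
  have hc := h.nonneg
  refine ⟨2 * ((c + 3) + 4 * B + B ^ 2), by positivity, fun x₀ L hL hball => ?_⟩
  obtain ⟨ζ, hζ, hζc, hζs, hζ01, hζ1, hζB⟩ := hB x₀ L hL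
  have hm1 : MeasurableSet (Metric.ball x₀ (R₁ * L) ×ˢ Ioo 0 t₁) :=
    measurableSet_ball.prod measurableSet_Ioo
  have hm2 : MeasurableSet (Metric.ball x₀ (R₂ * L) ×ˢ Ioo 0 t₂) :=
    measurableSet_ball.prod measurableSet_Ioo
  have key := h.caccioppoli hζ hζc
    (hζs.trans (prod_mono hball (Iio_subset_Iio hT)))
  refine le_trans ?_ (key.trans ?_)
  · refine setLIntegral_le_of_subset_support hm1 measurableSet_posTime ?_ ?_
    · exact fun p hp hp' => (hp' hp.2.1).elim
    · intro p hp _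
      rw [(hζ1 p ⟨Metric.ball_subset_closedBall hp.1, Ioo_subset_Icc_self hp.2⟩).eq_of_nhds]
      simp
  · rw [← lintegral_const_mul' _ _ ENNReal.ofReal_ne_top]
    refine setLIntegral_le_of_subset_support measurableSet_posTime hm2 ?_ ?_
    · intro p hp hp'
      have hpt : p ∉ tsupport ζ := fun hpt => hp' ⟨(hζs hpt).1, hp, (hζs hpt).2⟩
      rw [gradSq_eq_zero_of_notMem_tsupport hpt, dirDeriv_eq_zero_of_notMem_tsupport hpt,
        image_eq_zero_of_notMem_tsupport hpt]
      simp
    · intro p _ _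
      rw [← ENNReal.ofReal_mul (by positivity)]
      refine ENNReal.ofReal_le_ofReal ?_
      rw [mul_assoc]
      obtain ⟨b1, b2, -⟩ := hζB p
      have b3 : dirDeriv timeDir ζ p ^ 2 ≤ B ^ 2 := sq_le_sq' (abs_le.1 b2).1 (abs_le.1 b2).2
      have b4 : ζ p ^ 2 ≤ 1 := pow_le_one₀ (hζ01 p).1 (hζ01 p).2
      have b5 : (c + 3) * ζ p ^ 2 ≤ (c + 3) * 1 := by gcongr
      gcongr
      linarith

end BackwardSol

theorem contDiff_exp_mul (a b : ℝ) : ContDiff ℝ ∞ fun s : ℝ => a * rexp (b * s) := by fun_prop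

theorem deriv_exp_mul (a b : ℝ) : deriv (fun s : ℝ => a * rexp (b * s))
    = fun s => (b * a) * rexp (b * s) := by
  funext s
  have h := (((hasDerivAt_id s).const_mul b).exp.const_mul a).deriv
  simp only [id, mul_one] at h
  rw [h]
  ring

section Paraboloid

variable {n : ℕ}

/-- The Carleman weight concentrating at the point `x₀`. -/
noncomputable def ballWeight (x₀ : EuclideanSpace ℝ (Fin n)) (ν μ A : ℝ)
    (p : EuclideanSpace ℝ (Fin n) × ℝ) : ℝ :=
  1 * rexp (-ν * p.2) * (-1 * ‖p.1 - x₀‖ ^ 2) + A * rexp (-μ * p.2)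

variable {x₀ : EuclideanSpace ℝ (Fin n)} {c ν μ A : ℝ}

theorem contDiff_ballWeight : ContDiff ℝ ∞ (ballWeight x₀ ν μ A) := by
  have h := (contDiff_norm_sub_sq x₀).comp
    (contDiff_fst (E := EuclideanSpace ℝ (Fin n)) (F := ℝ) (𝕜 := ℝ))
  simp only [Function.comp_def] at h
  unfold ballWeight
  fun_prop

theorem commForm_ballWeight (hc : 0 ≤ c) (hν : ν = 8 + 32 * c)
    (p : EuclideanSpace ℝ (Fin n) × ℝ) (ξ : Fin n → ℝ) :
    8 * c * ∑ i, ξ i ^ 2 ≤ commForm spaceDir (ballWeight x₀ ν μ A)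
      (fun p => 1 * rexp (-ν * p.2) * (fun _ => 2 * (n : ℝ) - 4) p.1 + -ν) p ξ := by
  have hf : ContDiff ℝ ∞ fun x : EuclideanSpace ℝ (Fin n) => -1 * ‖x - x₀‖ ^ 2 :=
    contDiff_const.mul (contDiff_norm_sub_sq x₀)
  have := commForm_separable (m := fun _ => 2 * (n : ℝ) - 4) (K := ν) hf (contDiff_exp_mul 1 (-ν))
    (contDiff_exp_mul A (-μ)) p ξ
  have hS : 0 ≤ ∑ i, ξ i ^ 2 := Finset.sum_nonneg fun i _ => sq_nonneg _
  unfold ballWeight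
  rw [this, hessForm_neg_norm_sub_sq, lapAlong_neg_norm_sub_sq]
  nlinarith [mul_nonneg hc hS]

theorem commPotential_ballWeight (hc : 0 ≤ c) (hν : ν = 8 + 32 * c) (hμ : μ = 9 + 2 * ν)
    {p : EuclideanSpace ℝ (Fin n) × ℝ} (hp : 0 < p.2)
    (hA : 1 + 2 * c + (4 + ν) ^ 2 ≤ A * rexp (-μ * p.2) * μ) :
    1 + 8 * c * gradSq spaceDir (ballWeight x₀ ν μ A) p + 2 * c
      + (lapAlong spaceDir (ballWeight x₀ ν μ A) p
        + (1 * rexp (-ν * p.2) * (fun _ => 2 * (n : ℝ) - 4) p.1 + -ν)) ^ 2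
      ≤ commPotential spaceDir timeDir (ballWeight x₀ ν μ A)
        (fun p => 1 * rexp (-ν * p.2) * (fun _ => 2 * (n : ℝ) - 4) p.1 + -ν) p := by
  have hf : ContDiff ℝ ∞ fun x : EuclideanSpace ℝ (Fin n) => -1 * ‖x - x₀‖ ^ 2 :=
    contDiff_const.mul (contDiff_norm_sub_sq x₀)
  have hg := contDiff_exp_mul 1 (-ν)
  have hψ := contDiff_exp_mul A (-μ)
  have h1 := commPotential_separable (m := fun _ => 2 * (n : ℝ) - 4) (K := ν) hf contDiff_const
    hg hψ p
  have h2 := congrFun (gradSq_separable hf hg hψ) p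
  have h3 := congrFun (lapAlong_separable hf hg hψ) p
  have h4 : lapAlong coordDir (fun _ : EuclideanSpace ℝ (Fin n) => 2 * (n : ℝ) - 4) p.1 = 0 := by
    simp [lapAlong, dirDeriv_const]
  have h5 : ∑ i, dirDeriv (coordDir i)
      (fun x : EuclideanSpace ℝ (Fin n) => -1 * ‖x - x₀‖ ^ 2) p.1 ^ 2 = 4 * ‖p.1 - x₀‖ ^ 2 :=
    gradSq_neg_norm_sub_sq x₀ p.1
  unfold ballWeight
  rw [h1, h2, h3, h4, gradSq_neg_norm_sub_sq, lapAlong_neg_norm_sub_sq, hessForm_neg_norm_sub_sq,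
    h5]
  simp only [deriv_exp_mul]
  have hν8 : 8 ≤ ν := by linarith
  have hg0 : 0 < rexp (-ν * p.2) := exp_pos _
  have hg1 : rexp (-ν * p.2) ≤ 1 := exp_le_one_iff.2 (by nlinarith)
  generalize rexp (-ν * p.2) = g at *
  generalize hψd : A * rexp (-μ * p.2) = w at *
  have hψ' : ∀ a, a * A * rexp (-μ * p.2) = a * w := fun a => by rw [← hψd]; ring
  simp only [hψ']
  have hρ : 0 ≤ ‖p.1 - x₀‖ ^ 2 := sq_nonneg _
  generalize ‖p.1 - x₀‖ ^ 2 = r at *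
  have hw : 0 < w := by
    by_contra hw
    have : w * μ ≤ 0 := mul_nonpos_of_nonpos_of_nonneg (not_lt.1 hw) (by linarith)
    nlinarith [sq_nonneg (4 + ν)]
  have e1 : 0 ≤ ν ^ 2 + 16 * ν * g - 64 * g ^ 2 - 32 * c * g := by
    nlinarith [mul_nonneg hg0.le (sub_nonneg.2 hg1), mul_nonneg hc (sub_nonneg.2 hg1),
      mul_nonneg hc hc, mul_nonneg hg0.le hc, sq_nonneg (1 - g)]
  have e2 : w * μ ≤ w * (μ * (μ - 8 * g - 2 * ν)) := by
    have : μ ≤ μ * (μ - 8 * g - 2 * ν) := le_mul_of_one_le_right (by linarith) (by linarith)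
    gcongr
  have e3 : (4 * g + ν) ^ 2 ≤ (4 + ν) ^ 2 := by gcongr; linarith
  have e4 := mul_nonneg (mul_nonneg hg0.le hρ) e1
  have hAA : -μ * (-μ * A) * rexp (-μ * p.2) = μ ^ 2 * w := by rw [← hψd]; ring
  rw [hAA]
  nlinarith [e4, e2, e3, hA]

end Paraboloid

theorem abs_cutoffError_le {n : ℕ} {c B : ℝ} (hc : 0 ≤ c) {η : EuclideanSpace ℝ (Fin n) × ℝ → ℝ}
    {p : EuclideanSpace ℝ (Fin n) × ℝ} (h1 : gradSq spaceDir η p ≤ B)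
    (h2 : |dirDeriv timeDir η p| ≤ B) (h3 : |lapAlong spaceDir η p| ≤ B) :
    cutoffError spaceDir timeDir c η p ≤ (16 + 4 * c) * B + 4 * (2 * B) ^ 2 := by
  have h4 : |dirDeriv timeDir η p + lapAlong spaceDir η p| ≤ 2 * B :=
    (abs_add_le _ _).trans (by linarith)
  have h5 : (dirDeriv timeDir η p + lapAlong spaceDir η p) ^ 2 ≤ (2 * B) ^ 2 :=
    sq_le_sq' (abs_le.1 h4).1 (abs_le.1 h4).2
  unfold cutoffError
  gcongr

theorem cutoffError_eq_zero_of_eventuallyEq {W : Type*} [NormedAddCommGroup W] [NormedSpace ℝ W]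
    {ι : Type*} [Fintype ι] {e : ι → W} {t : W} {c : ℝ} {η : W → ℝ} {p : W} {a : ℝ}
    (h : η =ᶠ[𝓝 p] fun _ => a) : cutoffError e t c η p = 0 := by
  have h1 : gradSq e η p = 0 := by
    rw [h.gradSq]; simp [gradSq, dirDeriv_const]
  have h2 : lapAlong e η p = 0 := by
    rw [h.lapAlong]; simp [lapAlong, dirDeriv_const]
  rw [cutoffError, h1, h2, h.dirDeriv.eq_of_nhds]
  simp [dirDeriv_const]

section BallWeight

variable {n : ℕ} {x₀ : EuclideanSpace ℝ (Fin n)} {ν μ α A₀ L r s t : ℝ}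
  {p : EuclideanSpace ℝ (Fin n) × ℝ}

theorem le_ballWeight (hν : 0 ≤ ν) (hμ : 0 ≤ μ) (hα : 0 ≤ α) (hA₀ : 0 ≤ A₀)
    (hx : ‖p.1 - x₀‖ ≤ r) (hp : 0 ≤ p.2) (hps : p.2 ≤ s) :
    α * L ^ 2 * rexp (-μ * s) - r ^ 2 ≤ ballWeight x₀ ν μ (α * L ^ 2 + A₀) p := by
  have g1 : rexp (-ν * p.2) ≤ 1 := exp_le_one_iff.2 (by nlinarith)
  have g2 : rexp (-μ * s) ≤ rexp (-μ * p.2) := exp_le_exp.2 (by nlinarith)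
  have g4 : rexp (-ν * p.2) * ‖p.1 - x₀‖ ^ 2 ≤ 1 * r ^ 2 := by gcongr
  have g5 : α * L ^ 2 * rexp (-μ * s) ≤ (α * L ^ 2 + A₀) * rexp (-μ * p.2) := by
    have : α * L ^ 2 ≤ α * L ^ 2 + A₀ := by linarith
    gcongr
  rw [ballWeight]
  linarith

theorem ballWeight_le (hν : 0 ≤ ν) (hμ : 0 ≤ μ) (hA₀ : 0 ≤ A₀) (hs : 0 ≤ s) (hp : 0 ≤ p.2)
    (hpt : p.2 ≤ t) (h : 1 / 4 * L ^ 2 ≤ ‖p.1 - x₀‖ ^ 2 ∨ s < p.2) :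
    ballWeight x₀ ν μ (rexp (-ν * t) / 4 * L ^ 2 + A₀) p
      ≤ rexp (-ν * t) / 4 * L ^ 2 * rexp (-μ * s) + A₀ := by
  rw [ballWeight]
  have hge : 0 ≤ rexp (-ν * p.2) * ‖p.1 - x₀‖ ^ 2 := by positivity
  rcases h with h | h
  · have g3 : rexp (-ν * t) ≤ rexp (-ν * p.2) := exp_le_exp.2 (by nlinarith)
    have g4 : rexp (-ν * t) * (1 / 4 * L ^ 2) ≤ rexp (-ν * p.2) * ‖p.1 - x₀‖ ^ 2 := by gcongr
    have g5 : rexp (-μ * p.2) ≤ 1 := exp_le_one_iff.2 (by nlinarith)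
    have g6 : (rexp (-ν * t) / 4 * L ^ 2 + A₀) * rexp (-μ * p.2)
        ≤ (rexp (-ν * t) / 4 * L ^ 2 + A₀) * 1 := by gcongr
    have g8 : 0 ≤ rexp (-ν * t) / 4 * L ^ 2 * rexp (-μ * s) := by positivity
    linarith
  · have g2 : rexp (-μ * p.2) ≤ rexp (-μ * s) := exp_le_exp.2 (by nlinarith)
    have g3 : (rexp (-ν * t) / 4 * L ^ 2 + A₀) * rexp (-μ * p.2)
        ≤ (rexp (-ν * t) / 4 * L ^ 2 + A₀) * rexp (-μ * s) := by gcongr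
    have g4 : rexp (-μ * s) ≤ 1 := exp_le_one_iff.2 (by nlinarith)
    have g5 : A₀ * rexp (-μ * s) ≤ A₀ * 1 := by gcongr
    linarith

end BallWeight

namespace BackwardSol

variable {n : ℕ} {Ω : Set (EuclideanSpace ℝ (Fin n))} {T c M : ℝ}
  {U : EuclideanSpace ℝ (Fin n) × ℝ → ℝ}

theorem setLIntegral_sq_le (h : BackwardSol Ω T c M U) {x₀ : EuclideanSpace ℝ (Fin n)} {R t : ℝ}
    (hR : 0 < R) (ht : t ≤ T) (hball : Metric.ball x₀ R ⊆ Ω) :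
    ∫⁻ p in Metric.ball x₀ R ×ˢ Ioo 0 t, ENNReal.ofReal (U p ^ 2) ≤
      ENNReal.ofReal (M ^ 2 * (R ^ n *
        (volume (Metric.ball (0 : EuclideanSpace ℝ (Fin n)) 1)).toReal * T)) := by
  have hm : MeasurableSet (Metric.ball x₀ R ×ˢ Ioo 0 t) := measurableSet_ball.prod measurableSet_Ioo
  have hT := h.pos
  calc ∫⁻ p in Metric.ball x₀ R ×ˢ Ioo 0 t, ENNReal.ofReal (U p ^ 2)
      ≤ ∫⁻ p in Metric.ball x₀ R ×ˢ Ioo 0 t, ENNReal.ofReal (M ^ 2) := by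
        refine setLIntegral_mono measurable_const fun p hp => ENNReal.ofReal_le_ofReal ?_
        have := h.bound p.1 (hball hp.1) p.2 ⟨hp.2.1, hp.2.2.trans_le ht⟩
        exact sq_le_sq' (abs_le.1 this).1 (abs_le.1 this).2
    _ = ENNReal.ofReal (M ^ 2) * (volume (Metric.ball x₀ R) * ENNReal.ofReal t) := by
        rw [setLIntegral_const, Measure.volume_eq_prod, Measure.prod_prod, Real.volume_Ioo, sub_zero]
    _ ≤ _ := by
        rw [Measure.addHaar_ball_of_pos _ _ hR, finrank_euclideanSpace_fin,
          ENNReal.ofReal_mul (sq_nonneg M), ENNReal.ofReal_mul (by positivity),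
          ENNReal.ofReal_mul (by positivity), ENNReal.ofReal_toReal measure_ball_lt_top.ne]
        gcongr

/-- Carleman estimate on a ball of radius `L`: a bounded solution is of size `exp (-a * L ^ 2)`
near the centre. -/
theorem exists_setLIntegral_sq_ball_le (h : BackwardSol Ω T c M U) {r₀ s₀ : ℝ} (hr : 0 < r₀)
    (hs₀ : 0 < s₀) (hsT : s₀ < T) :
    ∃ C a : ℝ, 0 < a ∧ 0 ≤ C ∧ ∀ (x₀ : EuclideanSpace ℝ (Fin n)) (L : ℝ), r₀ ≤ L →
      Metric.ball x₀ (2 * L) ⊆ Ω →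
      ∫⁻ p in Metric.ball x₀ (r₀ / 2) ×ˢ Ioo 0 s₀, ENNReal.ofReal (U p ^ 2) ≤
        ENNReal.ofReal (C * rexp (-a * L ^ 2)) := by
  obtain ⟨s₁, h01, h1T⟩ := exists_between hsT
  obtain ⟨s₂, h12, h2T⟩ := exists_between h1T
  have hc := h.nonneg
  have hT := h.pos
  obtain ⟨B, hB0, hB⟩ := exists_scaled_cutoff (n := n) (R₁ := 1 / 2) (R₂ := 1) hr (by norm_num) h12
  obtain ⟨B', hB'0, hB'⟩ := h.exists_setLIntegral_gradSq_le (R₁ := 1) (R₂ := 2) hr (by norm_num)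
    h2T le_rfl
  set ν : ℝ := 8 + 32 * c with hν
  set μ : ℝ := 9 + 2 * ν with hμ
  have hν0 : 0 < ν := by positivity
  have hμ0 : 0 < μ := by positivity
  set α : ℝ := rexp (-ν * s₂) / 4 with hα
  have hα0 : 0 < α := by positivity
  set A₀ : ℝ := (1 + 2 * c + (4 + ν) ^ 2) * rexp (μ * s₂) with hA₀
  have hA₀0 : 0 < A₀ := by positivity
  set D : ℝ := (16 + 4 * c) * B + 4 * (2 * B) ^ 2 with hD
  have hD0 : 0 ≤ D := by positivity
  set V : ℝ := (volume (Metric.ball (0 : EuclideanSpace ℝ (Fin n)) 1)).toReal with hV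
  have hV0 : 0 ≤ V := ENNReal.toReal_nonneg
  set a : ℝ := α * (rexp (-μ * s₀) - rexp (-μ * s₁)) with ha
  have ha0 : 0 < a := by
    have : rexp (-μ * s₁) < rexp (-μ * s₀) := exp_lt_exp.2 (by nlinarith)
    exact mul_pos hα0 (by linarith)
  obtain ⟨C₁, hC₁0, hC₁⟩ := exists_pow_le_exp_sq n ha0
  refine ⟨D * (B' + 1) * (M ^ 2 * (2 ^ n * C₁ * V * T)) * rexp (2 * A₀ + r₀ ^ 2 / 2), a, ha0,
    by positivity, fun x₀ L hL hball => ?_⟩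
  have hL0 : 0 < L := hr.trans_le hL
  have h12' : 0 < s₁ := hs₀.trans h01
  obtain ⟨η, hη, hηc, hηs, hη01, hη1, hηB⟩ := hB x₀ L hL
  rw [one_mul] at hηs
  set A : ℝ := α * L ^ 2 + A₀ with hA
  have hA0 : 0 < A := by positivity
  set φ := ballWeight x₀ ν μ A with hφ
  have hball' : Metric.ball x₀ L ⊆ Ω := (Metric.ball_subset_ball (by linarith)).trans hball
  have key := h.carleman (φ := φ) hη contDiff_ballWeight
    (b := fun p => 1 * rexp (-ν * p.2) * (fun _ => 2 * (n : ℝ) - 4) p.1 + -ν)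
    (by fun_prop) hηc (hηs.trans (prod_mono hball' (Iio_subset_Iio h2T.le)))
    (fun p _ _ ξ => commForm_ballWeight hc hν p ξ)
    (fun p hp hp0 => commPotential_ballWeight hc hν hμ hp0 (by
      have hp2 : p.2 < s₂ := (hηs hp).2
      have e1 : A₀ * rexp (-μ * s₂) = 1 + 2 * c + (4 + ν) ^ 2 := by
        rw [hA₀, mul_assoc, ← Real.exp_add]
        simp
      have e2 : A₀ * rexp (-μ * s₂) ≤ A * rexp (-μ * p.2) := by
        have : A₀ ≤ A := by rw [hA]; nlinarith [sq_nonneg L]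
        have : rexp (-μ * s₂) ≤ rexp (-μ * p.2) := exp_le_exp.2 (by nlinarith)
        gcongr
      calc _ = A₀ * rexp (-μ * s₂) := e1.symm
        _ ≤ A * rexp (-μ * p.2) := e2
        _ ≤ _ := le_mul_of_one_le_right (by positivity) (by linarith)))
  have hm0 : MeasurableSet (Metric.ball x₀ (r₀ / 2) ×ˢ Ioo 0 s₀) :=
    measurableSet_ball.prod measurableSet_Ioo
  have hm2 : MeasurableSet (Metric.ball x₀ L ×ˢ Ioo 0 s₂) :=
    measurableSet_ball.prod measurableSet_Ioo
  set w : ℝ := rexp (α * L ^ 2 * rexp (-μ * s₁) + A₀) with hw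
  set w' : ℝ := rexp (α * L ^ 2 * rexp (-μ * s₀) - (r₀ / 2) ^ 2) with hw'
  have lower : ENNReal.ofReal (w' ^ 2) * ∫⁻ p in Metric.ball x₀ (r₀ / 2) ×ˢ Ioo 0 s₀,
      ENNReal.ofReal (U p ^ 2) ≤
      ∫⁻ p in posTime n, ENNReal.ofReal ((η p * rexp (φ p) * U p) ^ 2) := by
    rw [← lintegral_const_mul' _ _ ENNReal.ofReal_ne_top]
    refine setLIntegral_le_of_subset_support hm0 measurableSet_posTime
      (fun p hp hp' => (hp' hp.2.1).elim) fun p hp _ => ?_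
    rw [← ENNReal.ofReal_mul (sq_nonneg _)]
    refine ENNReal.ofReal_le_ofReal ?_
    have hx : ‖p.1 - x₀‖ < r₀ / 2 := mem_ball_iff_norm.1 hp.1
    rw [(hη1 p ⟨mem_closedBall_iff_norm.2 (by linarith), hp.2.1.le, by linarith [hp.2.2]⟩).eq_of_nhds,
      one_mul, mul_pow]
    refine mul_le_mul_of_nonneg_right ?_ (sq_nonneg _)
    refine pow_le_pow_left₀ (exp_pos _).le (exp_le_exp.2 ?_) 2
    exact le_ballWeight hν0.le hμ0.le hα0.le hA₀0.le hx.le hp.2.1.le hp.2.2.le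
  have upper : ∫⁻ p in posTime n, ENNReal.ofReal (cutoffError spaceDir timeDir c η p *
      (gradSq spaceDir U p + U p ^ 2) * rexp (φ p) ^ 2) ≤
      ENNReal.ofReal (D * w ^ 2) * ∫⁻ p in Metric.ball x₀ L ×ˢ Ioo 0 s₂,
        ENNReal.ofReal (gradSq spaceDir U p + U p ^ 2) := by
    rw [← lintegral_const_mul' _ _ ENNReal.ofReal_ne_top]
    refine setLIntegral_le_of_subset_support measurableSet_posTime hm2 ?_ fun p hp0 hp => ?_
    · intro p hp hp'
      have hpt : p ∉ tsupport η := fun hpt => hp' ⟨(hηs hpt).1, hp, (hηs hpt).2⟩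
      rw [cutoffError_eq_zero_of_notMem_tsupport hpt]
      simp
    have hE0 := cutoffError_nonneg (e := spaceDir) (t := timeDir) hc η p
    have hU0 : 0 ≤ gradSq spaceDir U p + U p ^ 2 := by
      have := gradSq_nonneg spaceDir U p; positivity
    rw [← ENNReal.ofReal_mul (by positivity)]
    refine ENNReal.ofReal_le_ofReal ?_
    by_cases hin : p ∈ Metric.closedBall x₀ (1 / 2 * L) ×ˢ Icc 0 s₁
    · rw [cutoffError_eq_zero_of_eventuallyEq (hη1 p hin)]
      rw [zero_mul, zero_mul]
      positivity
    have hE := abs_cutoffError_le hc (hηB p).1 (hηB p).2.1 (hηB p).2.2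
    have hφw : rexp (φ p) ≤ w := by
      refine exp_le_exp.2 (ballWeight_le hν0.le hμ0.le hA₀0.le h12'.le hp.2.1.le hp.2.2.le ?_)
      by_contra! hcon
      refine hin ⟨mem_closedBall_iff_norm.2 ?_, hp.2.1.le, hcon.2⟩
      exact abs_le_of_sq_le_sq' (by linarith [hcon.1] : ‖p.1 - x₀‖ ^ 2 ≤ (1 / 2 * L) ^ 2) (by positivity) |>.2
    calc _ ≤ D * (gradSq spaceDir U p + U p ^ 2) * w ^ 2 := by gcongr
      _ = _ := by ring
  have hgrad := hB' x₀ L hL hball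
  rw [one_mul] at hgrad
  set I := ∫⁻ p in Metric.ball x₀ (2 * L) ×ˢ Ioo 0 T, ENNReal.ofReal (U p ^ 2) with hI
  have hsum : ∫⁻ p in Metric.ball x₀ L ×ˢ Ioo 0 s₂,
      ENNReal.ofReal (gradSq spaceDir U p + U p ^ 2) ≤ ENNReal.ofReal (B' + 1) * I := by
    have hUm : AEMeasurable (fun p => ENNReal.ofReal (U p ^ 2))
        (volume.restrict (Metric.ball x₀ L ×ˢ Ioo 0 s₂)) := by
      have hco : ContinuousOn U (Metric.ball x₀ L ×ˢ Ioo 0 s₂) :=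
        h.contDiffOn.continuousOn.mono (prod_mono hball' (Ioo_subset_Ioo_right h2T.le))
      exact ((hco.aemeasurable hm2).pow_const 2).ennreal_ofReal
    calc _ = ∫⁻ p in Metric.ball x₀ L ×ˢ Ioo 0 s₂,
          (ENNReal.ofReal (gradSq spaceDir U p) + ENNReal.ofReal (U p ^ 2)) := by
          refine lintegral_congr fun p => ENNReal.ofReal_add (gradSq_nonneg _ _ _) (sq_nonneg _)
      _ = (∫⁻ p in Metric.ball x₀ L ×ˢ Ioo 0 s₂, ENNReal.ofReal (gradSq spaceDir U p)) +
          ∫⁻ p in Metric.ball x₀ L ×ˢ Ioo 0 s₂, ENNReal.ofReal (U p ^ 2) :=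
          lintegral_add_right' _ hUm
      _ ≤ ENNReal.ofReal B' * I + I := by
          refine add_le_add hgrad (lintegral_mono_set ?_)
          exact prod_mono (Metric.ball_subset_ball (by linarith)) (Ioo_subset_Ioo_right h2T.le)
      _ = _ := by
          rw [ENNReal.ofReal_add hB'0 zero_le_one, add_mul, ENNReal.ofReal_one, one_mul]
  have hI' : I ≤ ENNReal.ofReal (M ^ 2 * (2 ^ n * C₁ * V * T) * rexp (a * L ^ 2)) := by
    refine (h.setLIntegral_sq_le (by positivity) le_rfl hball).trans (ENNReal.ofReal_le_ofReal ?_)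
    have := hC₁ L hL0.le
    calc M ^ 2 * ((2 * L) ^ n * V * T) = M ^ 2 * (2 ^ n * L ^ n * V * T) := by rw [mul_pow]
      _ ≤ M ^ 2 * (2 ^ n * (C₁ * rexp (a * L ^ 2)) * V * T) := by gcongr
      _ = _ := by ring
  have total : ENNReal.ofReal (w' ^ 2) * ∫⁻ p in Metric.ball x₀ (r₀ / 2) ×ˢ Ioo 0 s₀,
      ENNReal.ofReal (U p ^ 2) ≤ ENNReal.ofReal (D * w ^ 2) * (ENNReal.ofReal (B' + 1) *
        ENNReal.ofReal (M ^ 2 * (2 ^ n * C₁ * V * T) * rexp (a * L ^ 2))) :=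
    (lower.trans (key.trans upper)).trans (by gcongr; exact hsum.trans (by gcongr))
  have hw'0 : 0 < w' ^ 2 := by positivity
  rw [mul_comm, ← ENNReal.le_div_iff_mul_le (Or.inl (ENNReal.ofReal_pos.2 hw'0).ne')
    (Or.inl ENNReal.ofReal_ne_top), ← ENNReal.ofReal_mul (by positivity),
    ← ENNReal.ofReal_mul (by positivity), ← ENNReal.ofReal_div_of_pos hw'0] at total
  refine total.trans (ENNReal.ofReal_le_ofReal (le_of_eq ?_))
  have hww : w ^ 2 * rexp (a * L ^ 2) = rexp (2 * A₀ + r₀ ^ 2 / 2) * rexp (-a * L ^ 2) * w' ^ 2 := by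
    rw [hw, hw', ← Real.exp_nat_mul, ← Real.exp_nat_mul, ← Real.exp_add, ← Real.exp_add,
      ← Real.exp_add]
    congr 1
    rw [ha]
    push_cast
    ring
  rw [div_eq_iff hw'0.ne']
  linear_combination (D * (B' + 1) * (M ^ 2 * (2 ^ n * C₁ * V * T))) * hww

theorem exists_setLIntegral_gradSq_add_sq_ball_le (h : BackwardSol Ω T c M U) {r₀ s₀ : ℝ}
    (hr : 0 < r₀) (hs₀ : 0 < s₀) (hsT : s₀ < T) :
    ∃ C a : ℝ, 0 < a ∧ 0 ≤ C ∧ ∀ (x₀ : EuclideanSpace ℝ (Fin n)) (L : ℝ), r₀ ≤ L →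
      Metric.ball x₀ (2 * L) ⊆ Ω →
      ∫⁻ p in Metric.ball x₀ (r₀ / 4) ×ˢ Ioo 0 s₀,
        ENNReal.ofReal (gradSq spaceDir U p + U p ^ 2) ≤
        ENNReal.ofReal (C * rexp (-a * L ^ 2)) := by
  obtain ⟨s₁, h01, h1T⟩ := exists_between hsT
  obtain ⟨C, a, ha, hC0, hC⟩ := h.exists_setLIntegral_sq_ball_le hr (hs₀.trans h01) h1T
  obtain ⟨B, hB0, hB⟩ := h.exists_setLIntegral_gradSq_le (R₁ := 1 / 4) (R₂ := 1 / 2) hr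
    (by norm_num) h01 h1T.le
  refine ⟨(B + 1) * C, a, ha, by positivity, fun x₀ L hL hball => ?_⟩
  have h1 := hC x₀ L hL hball
  have h2 := hB x₀ r₀ le_rfl ((Metric.ball_subset_ball (by linarith)).trans hball)
  rw [show 1 / 4 * r₀ = r₀ / 4 by ring, show 1 / 2 * r₀ = r₀ / 2 by ring] at h2
  have hUm : AEMeasurable (fun p => ENNReal.ofReal (U p ^ 2))
      (volume.restrict (Metric.ball x₀ (r₀ / 4) ×ˢ Ioo 0 s₀)) := by
    have hco : ContinuousOn U (Metric.ball x₀ (r₀ / 4) ×ˢ Ioo 0 s₀) :=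
      h.contDiffOn.continuousOn.mono (prod_mono ((Metric.ball_subset_ball (by linarith)).trans hball)
        (Ioo_subset_Ioo_right hsT.le))
    exact ((hco.aemeasurable (measurableSet_ball.prod measurableSet_Ioo)).pow_const 2).ennreal_ofReal
  set J := ∫⁻ p in Metric.ball x₀ (r₀ / 2) ×ˢ Ioo 0 s₁, ENNReal.ofReal (U p ^ 2)
  calc _ = ∫⁻ p in Metric.ball x₀ (r₀ / 4) ×ˢ Ioo 0 s₀,
        (ENNReal.ofReal (gradSq spaceDir U p) + ENNReal.ofReal (U p ^ 2)) := by
        refine lintegral_congr fun p => ENNReal.ofReal_add (gradSq_nonneg _ _ _) (sq_nonneg _)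
    _ = (∫⁻ p in Metric.ball x₀ (r₀ / 4) ×ˢ Ioo 0 s₀, ENNReal.ofReal (gradSq spaceDir U p)) +
        ∫⁻ p in Metric.ball x₀ (r₀ / 4) ×ˢ Ioo 0 s₀, ENNReal.ofReal (U p ^ 2) :=
        lintegral_add_right' _ hUm
    _ ≤ ENNReal.ofReal B * J + J := by
        refine add_le_add h2 (lintegral_mono_set ?_)
        exact prod_mono (Metric.ball_subset_ball (by linarith)) (Ioo_subset_Ioo_right h01.le)
    _ = ENNReal.ofReal (B + 1) * J := by
        rw [ENNReal.ofReal_add hB0 zero_le_one, add_mul, ENNReal.ofReal_one, one_mul]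
    _ ≤ ENNReal.ofReal (B + 1) * ENNReal.ofReal (C * rexp (-a * L ^ 2)) := by gcongr
    _ = _ := by rw [← ENNReal.ofReal_mul (by positivity), mul_assoc]

end BackwardSol

section AxisCone

variable {n : ℕ}

/-- The open cone around the axis `e` whose opening half-angle has cosine `κ`. -/
def axisCone (e : EuclideanSpace ℝ (Fin n)) (κ : ℝ) : Set (EuclideanSpace ℝ (Fin n)) :=
  {x | κ * ‖x‖ < inner ℝ e x}

variable {e x : EuclideanSpace ℝ (Fin n)} {κ κ₀ δ : ℝ}

theorem isOpen_axisCone : IsOpen (axisCone e κ) :=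
  isOpen_lt (by fun_prop) (by fun_prop)

theorem ball_subset_axisCone (he : ‖e‖ = 1) (hκ₀ : 0 ≤ κ₀) (hδ : κ₀ * (1 + δ) ≤ κ - δ)
    (hx : x ∈ axisCone e κ) : Metric.ball x (δ * ‖x‖) ⊆ axisCone e κ₀ := by
  intro z hz
  rw [mem_ball_iff_norm] at hz
  have h1 : -(δ * ‖x‖) < inner ℝ e (z - x) := by
    have := abs_le.1 (abs_real_inner_le_norm e (z - x))
    rw [he, one_mul] at this
    linarith [this.1]
  have h2 : ‖z‖ ≤ (1 + δ) * ‖x‖ := by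
    have := norm_le_norm_add_norm_sub' z x
    linarith
  have h3 : κ * ‖x‖ < inner ℝ e x := hx
  change κ₀ * ‖z‖ < inner ℝ e z
  rw [inner_sub_right] at h1
  have h4 := mul_le_mul_of_nonneg_left h2 hκ₀
  have h5 := mul_le_mul_of_nonneg_right hδ (norm_nonneg x)
  linarith

end AxisCone

theorem integrable_exp_neg_mul_norm_sq {n : ℕ} {b : ℝ} (hb : 0 < b) :
    Integrable fun x : EuclideanSpace ℝ (Fin n) => rexp (-b * ‖x‖ ^ 2) := by
  by_contra h
  have h1 := GaussianFourier.integral_rexp_neg_mul_sq_norm (V := EuclideanSpace ℝ (Fin n)) hb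
  rw [integral_undef h] at h1
  have : 0 < (π / b) ^ ((Module.finrank ℝ (EuclideanSpace ℝ (Fin n)) : ℝ) / 2) := by positivity
  exact this.ne h1

theorem lintegral_lt_top_of_forall_ball {n : ℕ} {F : EuclideanSpace ℝ (Fin n) × ℝ → ENNReal}
    (hF : AEMeasurable F) {ρ C b : ℝ} (hρ : 0 < ρ) (hb : 0 < b)
    (h : ∀ z, ∫⁻ p, indicator {p : EuclideanSpace ℝ (Fin n) × ℝ | dist z p.1 < ρ} F p ≤
      ENNReal.ofReal (C * rexp (-b * ‖z‖ ^ 2))) : ∫⁻ p, F p < ⊤ := by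
  set v := volume (Metric.ball (0 : EuclideanSpace ℝ (Fin n)) ρ) with hv
  have hv0 : v ≠ 0 := (Metric.measure_ball_pos _ _ hρ).ne'
  have hvt : v ≠ ⊤ := measure_ball_lt_top.ne
  have hlt : (∫⁻ p, F p) * v < ⊤ := by
    calc (∫⁻ p, F p) * v = ∫⁻ p, F p * v := (lintegral_mul_const' _ _ hvt).symm
      _ = ∫⁻ p : EuclideanSpace ℝ (Fin n) × ℝ, ∫⁻ z : EuclideanSpace ℝ (Fin n),
          indicator {q : (EuclideanSpace ℝ (Fin n) × ℝ) × EuclideanSpace ℝ (Fin n) |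
            dist q.2 q.1.1 < ρ} (fun q => F q.1) (p, z) := by
          refine lintegral_congr fun p => ?_
          have : ∀ z : EuclideanSpace ℝ (Fin n), indicator
              {q : (EuclideanSpace ℝ (Fin n) × ℝ) × EuclideanSpace ℝ (Fin n) |
                dist q.2 q.1.1 < ρ} (fun q => F q.1) (p, z)
              = indicator (Metric.ball p.1 ρ) (fun _ => F p) z := fun z => rfl
          simp only [this]
          rw [lintegral_indicator measurableSet_ball, setLIntegral_const,
            Measure.addHaar_ball_center]
      _ = ∫⁻ z : EuclideanSpace ℝ (Fin n), ∫⁻ p : EuclideanSpace ℝ (Fin n) × ℝ,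
          indicator {q : (EuclideanSpace ℝ (Fin n) × ℝ) × EuclideanSpace ℝ (Fin n) |
            dist q.2 q.1.1 < ρ} (fun q => F q.1) (p, z) := by
          refine lintegral_lintegral_swap (AEMeasurable.indicator ?_ ?_)
          · exact hF.comp_quasiMeasurePreserving Measure.quasiMeasurePreserving_fst
          · exact (isOpen_lt (by fun_prop) (by fun_prop)).measurableSet
      _ ≤ ∫⁻ z : EuclideanSpace ℝ (Fin n), ENNReal.ofReal (C * rexp (-b * ‖z‖ ^ 2)) :=
          lintegral_mono fun z => h z
      _ < ⊤ := ((integrable_exp_neg_mul_norm_sq hb).const_mul C).lintegral_lt_top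
  exact (ENNReal.lt_top_of_mul_ne_top_left hlt.ne hv0)

namespace BackwardSol

variable {n : ℕ} {Ω : Set (EuclideanSpace ℝ (Fin n))} {T c M : ℝ}
  {U : EuclideanSpace ℝ (Fin n) × ℝ → ℝ}

theorem continuousOn_energy (h : BackwardSol Ω T c M U) :
    ContinuousOn (fun p => gradSq spaceDir U p + U p ^ 2) (Ω ×ˢ Ioo 0 T) := by
  have hd : ∀ i, ContinuousOn (dirDeriv (spaceDir i) U) (Ω ×ˢ Ioo 0 T) := fun i =>
    (h.contDiffOn.continuousOn_fderiv_of_isOpen h.isOpen_prod (by simp)).clm_apply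
      continuousOn_const
  refine ContinuousOn.add ?_ (h.contDiffOn.continuousOn.pow 2)
  exact continuousOn_finsetSum _ fun i _ => (hd i).pow 2

/-- A bounded solution in a cone, together with its gradient, has Gaussian decay in every
smaller cone. -/
theorem exists_lintegral_exp_mul_lt_top (h : BackwardSol Ω T c M U)
    {e : EuclideanSpace ℝ (Fin n)} {κ κ₀ : ℝ} (he : ‖e‖ = 1) (hκ₀ : 0 ≤ κ₀) (hκ : κ₀ < κ)
    (hκ1 : κ ≤ 1) (hΩ : axisCone e κ₀ ⊆ Ω) {r s : ℝ} (hr : 0 < r) (hs : 0 < s) (hsT : s < T) :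
    ∃ a : ℝ, 0 < a ∧ ∫⁻ p in {x | x ∈ axisCone e κ ∧ r ≤ ‖x‖} ×ˢ Ioo 0 s,
      ENNReal.ofReal (rexp (a * ‖p.1‖ ^ 2) * (gradSq spaceDir U p + U p ^ 2)) < ⊤ := by
  set δ : ℝ := (κ - κ₀) / (1 + κ₀) with hδ
  have hδ0 : 0 < δ := div_pos (by linarith) (by linarith)
  have hδ1 : δ ≤ 1 := (div_le_one (by linarith)).2 (by linarith)
  have hδκ : κ₀ * (1 + δ) ≤ κ - δ := by
    have : δ * (1 + κ₀) = κ - κ₀ := div_mul_cancel₀ _ (by linarith)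
    linarith
  set ρ : ℝ := δ * r / 64 with hρ
  have hρ0 : 0 < ρ := by positivity
  have hρr : ρ ≤ r / 64 := by rw [hρ]; nlinarith
  obtain ⟨C, a, ha, hC0, hC⟩ := h.exists_setLIntegral_gradSq_add_sq_ball_le (r₀ := 4 * ρ)
    (by positivity) hs hsT
  set a' : ℝ := a * δ ^ 2 / 64 with ha'
  have ha'0 : 0 < a' := by positivity
  refine ⟨a', ha'0, ?_⟩
  set S : Set (EuclideanSpace ℝ (Fin n)) := {x | x ∈ axisCone e κ ∧ r ≤ ‖x‖} with hS
  have hSm : MeasurableSet S := isOpen_axisCone.measurableSet.inter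
    (isClosed_le continuous_const continuous_norm).measurableSet
  have hSI : MeasurableSet (S ×ˢ Ioo 0 s) := hSm.prod measurableSet_Ioo
  have hSball : ∀ x ∈ S, Metric.ball x (δ * ‖x‖) ⊆ Ω := fun x hx =>
    (ball_subset_axisCone he hκ₀ hδκ hx.1).trans hΩ
  have hSΩ : S ⊆ Ω := fun x hx => hSball x hx
    (Metric.mem_ball_self (mul_pos hδ0 (hr.trans_le hx.2)))
  have hE0 : ∀ p, 0 ≤ gradSq spaceDir U p + U p ^ 2 := fun p =>
    add_nonneg (gradSq_nonneg _ _ _) (sq_nonneg _)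
  rw [← lintegral_indicator hSI]
  refine lintegral_lt_top_of_forall_ball (ρ := ρ) (C := C) (b := 2 * a') ?_ hρ0 (by positivity)
    fun z => ?_
  · rw [aemeasurable_indicator_iff hSI]
    refine AEMeasurable.ennreal_ofReal (ContinuousOn.aemeasurable ?_ hSI)
    refine ContinuousOn.mul (by fun_prop) (h.continuousOn_energy.mono ?_)
    exact prod_mono hSΩ (Ioo_subset_Ioo_right hsT.le)
  by_cases hz : ∃ x ∈ S, dist z x < ρ
  · obtain ⟨x, hx, hzx⟩ := hz
    have hxr : r ≤ ‖x‖ := hx.2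
    have hzx' : ‖z - x‖ < ρ := by rwa [← dist_eq_norm]
    have hz1 : 3 / 4 * ‖x‖ ≤ ‖z‖ := by
      have := norm_le_norm_add_norm_sub z x
      linarith
    have hz2 : ‖z‖ ≤ 5 / 4 * ‖x‖ := by
      have := norm_le_norm_add_norm_sub' z x
      linarith
    have hδx : δ * r ≤ δ * ‖x‖ := by gcongr
    have hδz1 : δ * (3 / 4 * ‖x‖) ≤ δ * ‖z‖ := by gcongr
    have hδz2 : δ * ‖z‖ ≤ δ * (5 / 4 * ‖x‖) := by gcongr
    have key := hC z (δ / 4 * ‖z‖) (by linarith) (by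
      refine (Metric.ball_subset_ball' ?_).trans (hSball x hx)
      linarith)
    rw [show 4 * ρ / 4 = ρ by ring] at key
    have hm : MeasurableSet (Metric.ball z ρ ×ˢ Ioo 0 s) :=
      measurableSet_ball.prod measurableSet_Ioo
    calc _ ≤ ∫⁻ p in Metric.ball z ρ ×ˢ Ioo 0 s, ENNReal.ofReal (rexp (2 * a' * ‖z‖ ^ 2)) *
          ENNReal.ofReal (gradSq spaceDir U p + U p ^ 2) := by
          rw [← lintegral_indicator hm]
          refine lintegral_mono fun p => ?_
          by_cases hp1 : dist z p.1 < ρ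
          · by_cases hp2 : p ∈ S ×ˢ Ioo 0 s
            · rw [indicator_of_mem (by exact hp1), indicator_of_mem hp2,
                indicator_of_mem (by exact ⟨by rwa [Metric.mem_ball'], hp2.2⟩),
                ← ENNReal.ofReal_mul (exp_pos _).le]
              refine ENNReal.ofReal_le_ofReal (mul_le_mul_of_nonneg_right ?_ (hE0 p))
              refine exp_le_exp.2 ?_
              have hpr : r ≤ ‖p.1‖ := hp2.1.2
              have hzp : ‖z - p.1‖ < ρ := by rwa [← dist_eq_norm]
              have h1 := norm_le_norm_add_norm_sub z p.1
              have h2 : ‖p.1‖ ≤ 4 / 3 * ‖z‖ := by linarith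
              have h3 : ‖p.1‖ ^ 2 ≤ (4 / 3 * ‖z‖) ^ 2 := by gcongr
              nlinarith [mul_le_mul_of_nonneg_left h3 ha'0.le, mul_nonneg ha'0.le (sq_nonneg ‖z‖)]
            · rw [indicator_of_mem (by exact hp1), indicator_of_notMem hp2]
              exact zero_le
          · rw [indicator_of_notMem (by exact hp1)]
            exact zero_le
      _ ≤ ENNReal.ofReal (rexp (2 * a' * ‖z‖ ^ 2)) *
          ENNReal.ofReal (C * rexp (-a * (δ / 4 * ‖z‖) ^ 2)) := by
          rw [lintegral_const_mul' _ _ ENNReal.ofReal_ne_top]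
          gcongr
      _ = _ := by
          rw [← ENNReal.ofReal_mul (exp_pos _).le, mul_left_comm, ← Real.exp_add]
          congr 3
          rw [ha']
          ring
  · have : indicator {p : EuclideanSpace ℝ (Fin n) × ℝ | dist z p.1 < ρ}
        (indicator (S ×ˢ Ioo 0 s) fun p => ENNReal.ofReal (rexp (a' * ‖p.1‖ ^ 2) *
          (gradSq spaceDir U p + U p ^ 2))) = fun _ => 0 := by
      funext p
      by_cases hp1 : dist z p.1 < ρ
      · rw [indicator_of_mem (by exact hp1), indicator_of_notMem]
        exact fun hp2 => hz ⟨p.1, hp2.1, hp1⟩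
      · exact indicator_of_notMem (by exact hp1) _
    rw [this]
    simp

end BackwardSol

section ConeWeight

variable {n : ℕ} {e : EuclideanSpace ℝ (Fin n)} {q ε : ℝ}

/-- The quadratic form defining a cone with axis `e`. -/
noncomputable def coneQuad (e : EuclideanSpace ℝ (Fin n)) (q : ℝ)
    (x : EuclideanSpace ℝ (Fin n)) : ℝ :=
  1 / 2 * (inner ℝ e x ^ 2 - q * ‖x‖ ^ 2)

/-- The function `1 / (1 + |x|²)`. -/
noncomputable def invJapanese (x : EuclideanSpace ℝ (Fin n)) : ℝ := (1 + ‖x‖ ^ 2)⁻¹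

/-- The slowly decaying factor `(1 + |x|²) ^ (-ε)`. -/
noncomputable def slowDecay (ε : ℝ) (x : EuclideanSpace ℝ (Fin n)) : ℝ := (1 + ‖x‖ ^ 2) ^ (-ε)

/-- The slightly subquadratic spatial weight adapted to a cone. -/
noncomputable def coneWeight (e : EuclideanSpace ℝ (Fin n)) (q ε : ℝ)
    (x : EuclideanSpace ℝ (Fin n)) : ℝ :=
  slowDecay ε x * coneQuad e q x

@[fun_prop]
theorem contDiff_inner_right (v : EuclideanSpace ℝ (Fin n)) :
    ContDiff ℝ ∞ fun x : EuclideanSpace ℝ (Fin n) => inner ℝ v x :=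
  contDiff_const.inner ℝ contDiff_id

@[fun_prop]
theorem contDiff_inner_left (v : EuclideanSpace ℝ (Fin n)) :
    ContDiff ℝ ∞ fun x : EuclideanSpace ℝ (Fin n) => inner ℝ x v :=
  contDiff_id.inner ℝ contDiff_const

@[fun_prop]
theorem contDiff_sq_norm : ContDiff ℝ ∞ fun x : EuclideanSpace ℝ (Fin n) => ‖x‖ ^ 2 :=
  contDiff_id.norm_sq ℝ

@[fun_prop]
theorem contDiff_coneQuad : ContDiff ℝ ∞ (coneQuad e q) := by
  unfold coneQuad; fun_prop

@[fun_prop]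
theorem contDiff_invJapanese : ContDiff ℝ ∞ (invJapanese (n := n)) := by
  unfold invJapanese
  exact ContDiff.inv (by fun_prop) fun x => by positivity

@[fun_prop]
theorem contDiff_slowDecay : ContDiff ℝ ∞ (slowDecay (n := n) ε) := by
  unfold slowDecay
  exact ContDiff.rpow_const_of_ne (by fun_prop) fun x => by positivity

@[fun_prop]
theorem contDiff_coneWeight : ContDiff ℝ ∞ (coneWeight e q ε) := by
  unfold coneWeight; fun_prop

variable {v w : EuclideanSpace ℝ (Fin n)}

theorem dirDeriv_sq_norm : dirDeriv v (fun x : EuclideanSpace ℝ (Fin n) => ‖x‖ ^ 2)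
    = fun x => 2 * inner ℝ x v := by
  have := dirDeriv_norm_sub_sq (v := v) (x₀ := 0)
  simpa using this

theorem dirDeriv_inner_left : dirDeriv v (fun x : EuclideanSpace ℝ (Fin n) => inner ℝ x w)
    = fun _ => inner ℝ v w := by
  have := dirDeriv_inner (v := v) (e := w)
  simpa only [real_inner_comm] using this

theorem dirDeriv_coneQuad : dirDeriv v (coneQuad e q)
    = fun x => inner ℝ e x * inner ℝ e v - q * inner ℝ x v := by
  have : coneQuad e q = fun x => 1 / 2 * (inner ℝ e x ^ 2 - q * ‖x‖ ^ 2) := rfl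
  rw [this]
  simp (disch := fun_prop) only [dirDeriv_const_mul, dirDeriv_sub, dirDeriv_pow_two,
    dirDeriv_inner, dirDeriv_sq_norm]
  funext x
  ring

theorem hasFDerivAt_sq_norm (x : EuclideanSpace ℝ (Fin n)) :
    HasFDerivAt (fun x : EuclideanSpace ℝ (Fin n) => ‖x‖ ^ 2)
      (fderiv ℝ (fun x : EuclideanSpace ℝ (Fin n) => ‖x‖ ^ 2) x) x :=
  (contDiff_sq_norm.contDiffAt.differentiableAt (by simp)).hasFDerivAt

theorem dirDeriv_invJapanese : dirDeriv v (invJapanese (n := n))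
    = fun x => -2 * invJapanese x ^ 2 * inner ℝ x v := by
  funext x
  have h0 : 1 + ‖x‖ ^ 2 ≠ 0 := by positivity
  have h := (hasDerivAt_inv h0).comp_hasFDerivAt x ((hasFDerivAt_sq_norm x).const_add 1)
  simp only [Function.comp_def] at h
  have h2 : fderiv ℝ (invJapanese (n := n)) x = _ := h.fderiv
  have h3 := congrFun (dirDeriv_sq_norm (v := v)) x
  simp only [dirDeriv] at h3
  rw [dirDeriv, h2, smul_apply, h3, invJapanese, smul_eq_mul]
  field_simp

theorem dirDeriv_slowDecay : dirDeriv v (slowDecay (n := n) ε)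
    = fun x => -2 * ε * (invJapanese x * slowDecay ε x * inner ℝ x v) := by
  funext x
  have h0 : 0 < 1 + ‖x‖ ^ 2 := by positivity
  have h := ((hasFDerivAt_sq_norm x).const_add 1).rpow_const (p := -ε) (Or.inl h0.ne')
  have h2 : fderiv ℝ (slowDecay (n := n) ε) x = _ := h.fderiv
  have h3 := congrFun (dirDeriv_sq_norm (v := v)) x
  simp only [dirDeriv] at h3
  rw [dirDeriv, h2, smul_apply, h3, invJapanese, smul_eq_mul, slowDecay,
    Real.rpow_sub_one h0.ne']
  field_simp

theorem dirDeriv_dirDeriv_slowDecay : dirDeriv w (dirDeriv v (slowDecay (n := n) ε))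
    = fun x => slowDecay ε x * (4 * ε * (1 + ε) * invJapanese x ^ 2 * inner ℝ x v * inner ℝ x w
      - 2 * ε * invJapanese x * inner ℝ w v) := by
  rw [dirDeriv_slowDecay]
  simp (disch := fun_prop) only [dirDeriv_const_mul, dirDeriv_mul, dirDeriv_slowDecay,
    dirDeriv_invJapanese, dirDeriv_inner_left]
  funext x
  ring

theorem dirDeriv_coneWeight : dirDeriv v (coneWeight e q ε) = fun x => slowDecay ε x *
    (inner ℝ e x * inner ℝ e v - q * inner ℝ x v
      - 2 * ε * (invJapanese x * coneQuad e q x * inner ℝ x v)) := by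
  have : coneWeight e q ε = fun x => slowDecay ε x * coneQuad e q x := rfl
  rw [this]
  simp (disch := fun_prop) only [dirDeriv_mul, dirDeriv_slowDecay, dirDeriv_coneQuad]
  funext x
  ring

theorem dirDeriv_dirDeriv_coneWeight : dirDeriv w (dirDeriv v (coneWeight e q ε))
    = fun x => slowDecay ε x * (inner ℝ e w * inner ℝ e v
      - (q + 2 * ε * invJapanese x * coneQuad e q x) * inner ℝ w v
      - 2 * ε * invJapanese x * (inner ℝ x w * (inner ℝ e x * inner ℝ e v - q * inner ℝ x v)
        + inner ℝ x v * (inner ℝ e x * inner ℝ e w - q * inner ℝ x w))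
      + 4 * ε * (1 + ε) * invJapanese x ^ 2 * coneQuad e q x * inner ℝ x v * inner ℝ x w) := by
  rw [dirDeriv_coneWeight]
  simp (disch := fun_prop) only [dirDeriv_const_mul, dirDeriv_mul, dirDeriv_sub,
    dirDeriv_slowDecay, dirDeriv_invJapanese, dirDeriv_inner_left, dirDeriv_inner,
    dirDeriv_coneQuad, dirDeriv_const]
  funext x
  ring

end ConeWeight

section ConeWeightFormulas

variable {n : ℕ} {e : EuclideanSpace ℝ (Fin n)} {q ε : ℝ}

/-- The coefficient of the position vector in the gradient of `coneWeight e q ε`. -/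
noncomputable def coneCoeff (e : EuclideanSpace ℝ (Fin n)) (q ε : ℝ)
    (x : EuclideanSpace ℝ (Fin n)) : ℝ :=
  q + 2 * ε * (invJapanese x * coneQuad e q x)

theorem dirDeriv_coordDir_coneWeight (i : Fin n) (x : EuclideanSpace ℝ (Fin n)) :
    dirDeriv (coordDir i) (coneWeight e q ε) x
      = slowDecay ε x * (inner ℝ e x * e i - coneCoeff e q ε x * x i) := by
  rw [dirDeriv_coneWeight]
  simp only [inner_coordDir, coneCoeff]
  ring

theorem dirDeriv_dirDeriv_coordDir_coneWeight (i j : Fin n) (x : EuclideanSpace ℝ (Fin n)) :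
    dirDeriv (coordDir i) (dirDeriv (coordDir j) (coneWeight e q ε)) x
      = slowDecay ε x * ((e i - 2 * ε * invJapanese x * inner ℝ e x * x i) * e j
        + (4 * ε * invJapanese x * q * x i - 2 * ε * invJapanese x * inner ℝ e x * e i
          + 4 * ε * (1 + ε) * invJapanese x ^ 2 * coneQuad e q x * x i) * x j
        - coneCoeff e q ε x * (if j = i then 1 else 0)) := by
  rw [dirDeriv_dirDeriv_coneWeight]
  simp only [inner_coordDir, coordDir_apply, coneCoeff]
  ring

theorem inner_eq_sum_mul (x y : EuclideanSpace ℝ (Fin n)) : inner ℝ x y = ∑ i, x i * y i := by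
  rw [PiLp.inner_apply]
  exact Finset.sum_congr rfl fun i _ => by simp [mul_comm]

theorem gradSq_coneWeight (he : ‖e‖ = 1) (x : EuclideanSpace ℝ (Fin n)) :
    gradSq coordDir (coneWeight e q ε) x = slowDecay ε x ^ 2 *
      ((1 - 2 * coneCoeff e q ε x) * inner ℝ e x ^ 2 + coneCoeff e q ε x ^ 2 * ‖x‖ ^ 2) := by
  have h1 : ∑ i, e i * e i = 1 := by
    rw [← inner_eq_sum_mul, real_inner_self_eq_norm_sq, he, one_pow]
  have h2 := (inner_eq_sum_mul x x).symm
  rw [real_inner_self_eq_norm_sq] at h2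
  have h3 := (inner_eq_sum_mul e x).symm
  simp only [gradSq, dirDeriv_coordDir_coneWeight]
  generalize coneCoeff e q ε x = α at *
  generalize inner ℝ e x = y at *
  have : ∀ i, (slowDecay ε x * (y * e i - α * x i)) ^ 2 = slowDecay ε x ^ 2 *
      (y ^ 2 * (e i * e i) + α ^ 2 * (x i * x i) - 2 * α * y * (e i * x i)) := fun i => by ring
  simp only [this, ← Finset.mul_sum, Finset.sum_add_distrib, Finset.sum_sub_distrib, h1, h2, h3]
  ring

theorem hessForm_coneWeight (x ξ : EuclideanSpace ℝ (Fin n)) :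
    hessForm (coneWeight e q ε) x ξ = slowDecay ε x *
      (inner ℝ e ξ ^ 2 - coneCoeff e q ε x * ‖ξ‖ ^ 2
        - 4 * ε * invJapanese x * inner ℝ x ξ * (inner ℝ e x * inner ℝ e ξ - q * inner ℝ x ξ)
        + 4 * ε * (1 + ε) * invJapanese x ^ 2 * coneQuad e q x * inner ℝ x ξ ^ 2) := by
  have h1 := (inner_eq_sum_mul e ξ).symm
  have h2 := (inner_eq_sum_mul x ξ).symm
  have h3 := (inner_eq_sum_mul ξ ξ).symm
  rw [real_inner_self_eq_norm_sq] at h3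
  simp only [hessForm, dirDeriv_dirDeriv_coordDir_coneWeight]
  generalize coneCoeff e q ε x = α at *
  generalize slowDecay ε x = w
  generalize inner ℝ e x = y
  generalize 4 * ε * (1 + ε) * invJapanese x ^ 2 * coneQuad e q x = k
  generalize invJapanese x = z
  generalize inner ℝ e ξ = a at *
  generalize inner ℝ x ξ = b at *
  generalize ‖ξ‖ ^ 2 = S at *
  have inn : ∀ i, ∑ j, w * ((e i - 2 * ε * z * y * x i) * e j
      + (4 * ε * z * q * x i - 2 * ε * z * y * e i + k * x i) * x j
      - α * (if j = i then 1 else 0)) * ξ j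
      = w * ((e i - 2 * ε * z * y * x i) * a
      + (4 * ε * z * q * x i - 2 * ε * z * y * e i + k * x i) * b - α * ξ i) := by
    intro i
    have : ∀ j, w * ((e i - 2 * ε * z * y * x i) * e j
        + (4 * ε * z * q * x i - 2 * ε * z * y * e i + k * x i) * x j
        - α * (if j = i then 1 else 0)) * ξ j
        = w * ((e i - 2 * ε * z * y * x i) * (e j * ξ j)
        + (4 * ε * z * q * x i - 2 * ε * z * y * e i + k * x i) * (x j * ξ j)
        - α * (if j = i then ξ j else 0)) := fun j => by split_ifs <;> ring
    simp only [this, ← Finset.mul_sum, Finset.sum_add_distrib, Finset.sum_sub_distrib, h1, h2,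
      Finset.sum_ite_eq', Finset.mem_univ, if_true]
  simp only [inn]
  have : ∀ i, w * ((e i - 2 * ε * z * y * x i) * a
      + (4 * ε * z * q * x i - 2 * ε * z * y * e i + k * x i) * b - α * ξ i) * ξ i
      = w * ((a - 2 * ε * z * y * b) * (e i * ξ i) +
        (4 * ε * z * q * b + k * b - 2 * ε * z * y * a) * (x i * ξ i) - α * (ξ i * ξ i)) :=
    fun i => by ring
  simp only [this, ← Finset.mul_sum, Finset.sum_add_distrib, Finset.sum_sub_distrib, h1, h2, h3]
  ring

theorem lapAlong_coneWeight (he : ‖e‖ = 1) (x : EuclideanSpace ℝ (Fin n)) :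
    lapAlong coordDir (coneWeight e q ε) x = slowDecay ε x *
      (1 - n * coneCoeff e q ε x - 8 * ε * (invJapanese x * coneQuad e q x)
        + 4 * ε * (1 + ε) * (invJapanese x * coneQuad e q x) * (invJapanese x * ‖x‖ ^ 2)) := by
  have h1 : ∑ i, e i * e i = 1 := by
    rw [← inner_eq_sum_mul, real_inner_self_eq_norm_sq, he, one_pow]
  have h2 := (inner_eq_sum_mul x x).symm
  rw [real_inner_self_eq_norm_sq] at h2
  have h3 := (inner_eq_sum_mul e x).symm
  have hQ : 8 * ε * (invJapanese x * coneQuad e q x)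
      = 4 * ε * invJapanese x * (inner ℝ e x ^ 2 - q * ‖x‖ ^ 2) := by
    rw [coneQuad]; ring
  rw [hQ]
  simp only [lapAlong, dirDeriv_dirDeriv_coordDir_coneWeight, if_true]
  generalize coneCoeff e q ε x = α at *
  generalize slowDecay ε x = w
  generalize inner ℝ e x = y at *
  generalize coneQuad e q x = Q at *
  generalize invJapanese x = z
  have : ∀ i, w * ((e i - 2 * ε * z * y * x i) * e i
      + (4 * ε * z * q * x i - 2 * ε * z * y * e i + 4 * ε * (1 + ε) * z ^ 2 * Q * x i) * x i
      - α * 1) = w * (e i * e i - 4 * ε * z * y * (e i * x i)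
        + (4 * ε * z * q + 4 * ε * (1 + ε) * z ^ 2 * Q) * (x i * x i) - α) := fun i => by ring
  simp only [this, ← Finset.mul_sum, Finset.sum_add_distrib, Finset.sum_sub_distrib, h1, h2, h3,
    Finset.sum_const, Finset.card_univ, Fintype.card_fin, nsmul_eq_mul]
  ring

theorem lapAlong_slowDecay (x : EuclideanSpace ℝ (Fin n)) :
    lapAlong coordDir (slowDecay ε) x = slowDecay ε x *
      (4 * ε * (1 + ε) * invJapanese x * (invJapanese x * ‖x‖ ^ 2)
        - 2 * n * ε * invJapanese x) := by
  have h2 := (inner_eq_sum_mul x x).symm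
  rw [real_inner_self_eq_norm_sq] at h2
  simp only [lapAlong, dirDeriv_dirDeriv_slowDecay, inner_coordDir, coordDir_apply,
    if_true]
  have : ∀ i, slowDecay ε x * (4 * ε * (1 + ε) * invJapanese x ^ 2 * x i * x i
      - 2 * ε * invJapanese x * 1) = slowDecay ε x * (4 * ε * (1 + ε) * invJapanese x ^ 2
        * (x i * x i) - 2 * ε * invJapanese x) := fun i => by ring
  simp only [this, ← Finset.mul_sum, Finset.sum_sub_distrib, h2,
    Finset.sum_const, Finset.card_univ, Fintype.card_fin, nsmul_eq_mul]
  ring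

theorem hessForm_coneWeight_gradient (he : ‖e‖ = 1) (x : EuclideanSpace ℝ (Fin n)) :
    ∃ ξ : EuclideanSpace ℝ (Fin n),
      (fun i => dirDeriv (coordDir i) (coneWeight e q ε) x) = ξ ∧
      inner ℝ e ξ = slowDecay ε x * ((1 - coneCoeff e q ε x) * inner ℝ e x) ∧
      ‖ξ‖ ^ 2 = gradSq coordDir (coneWeight e q ε) x := by
  refine ⟨slowDecay ε x • (inner ℝ e x • e - coneCoeff e q ε x • x), ?_, ?_, ?_⟩
  · funext i
    rw [dirDeriv_coordDir_coneWeight]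
    simp
  · rw [real_inner_smul_right, inner_sub_right, real_inner_smul_right, real_inner_smul_right,
      real_inner_self_eq_norm_sq, he]
    ring
  · rw [norm_sq_eq_sum, gradSq]
    refine Finset.sum_congr rfl fun i _ => ?_
    rw [dirDeriv_coordDir_coneWeight]
    simp

end ConeWeightFormulas

section ConeWeightBounds

variable {n : ℕ} {e : EuclideanSpace ℝ (Fin n)} {q ε : ℝ}

theorem slowDecay_pos (x : EuclideanSpace ℝ (Fin n)) : 0 < slowDecay ε x := by
  unfold slowDecay; positivity

theorem slowDecay_le_one (hε : 0 ≤ ε) (x : EuclideanSpace ℝ (Fin n)) : slowDecay ε x ≤ 1 :=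
  Real.rpow_le_one_of_one_le_of_nonpos (by nlinarith [sq_nonneg ‖x‖]) (by linarith)

theorem invJapanese_pos (x : EuclideanSpace ℝ (Fin n)) : 0 < invJapanese x := by
  unfold invJapanese; positivity

theorem invJapanese_le_one (x : EuclideanSpace ℝ (Fin n)) : invJapanese x ≤ 1 :=
  inv_le_one_of_one_le₀ (by nlinarith [sq_nonneg ‖x‖])

theorem invJapanese_mul_sq_norm_le_one (x : EuclideanSpace ℝ (Fin n)) :
    invJapanese x * ‖x‖ ^ 2 ≤ 1 := by
  have h : 0 < 1 + ‖x‖ ^ 2 := by positivity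
  rw [invJapanese, inv_mul_le_iff₀ h]
  linarith

theorem sq_inner_le_sq_norm (he : ‖e‖ = 1) (x : EuclideanSpace ℝ (Fin n)) :
    inner ℝ e x ^ 2 ≤ ‖x‖ ^ 2 := by
  have h := abs_real_inner_le_norm e x
  rw [he, one_mul] at h
  exact sq_le_sq' (by linarith [abs_le.1 h]) (by linarith [abs_le.1 h])

theorem coneQuad_le (he : ‖e‖ = 1) (hq : 0 ≤ q) (x : EuclideanSpace ℝ (Fin n)) :
    coneQuad e q x ≤ ‖x‖ ^ 2 / 2 := by
  have := sq_inner_le_sq_norm he x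
  unfold coneQuad
  nlinarith [mul_nonneg hq (sq_nonneg ‖x‖)]

theorem invJapanese_mul_coneQuad_le (he : ‖e‖ = 1) (hq : 0 ≤ q) (x : EuclideanSpace ℝ (Fin n)) :
    invJapanese x * coneQuad e q x ≤ 1 / 2 := by
  have h1 := invJapanese_mul_sq_norm_le_one x
  have h2 := mul_le_mul_of_nonneg_left (coneQuad_le he hq x) (invJapanese_pos x).le
  linarith

theorem coneCoeff_mem (he : ‖e‖ = 1) (hq : 0 ≤ q) (hε : 0 ≤ ε) {x : EuclideanSpace ℝ (Fin n)}
    (hx : 0 ≤ coneQuad e q x) : coneCoeff e q ε x ∈ Icc q (q + ε) := by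
  have h1 := mul_le_mul_of_nonneg_left (invJapanese_mul_coneQuad_le he hq x) hε
  have h2 := mul_nonneg hε (mul_nonneg (invJapanese_pos x).le hx)
  rw [coneCoeff]
  constructor <;> linarith

theorem le_hessForm_coneWeight (he : ‖e‖ = 1) (hq : 0 ≤ q) (hε : 0 ≤ ε)
    {x : EuclideanSpace ℝ (Fin n)} (hx : 0 ≤ coneQuad e q x) (ξ : EuclideanSpace ℝ (Fin n)) :
    slowDecay ε x * (inner ℝ e ξ ^ 2 - (q + 5 * ε) * ‖ξ‖ ^ 2)
      ≤ hessForm (coneWeight e q ε) x ξ := by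
  rw [hessForm_coneWeight]
  refine mul_le_mul_of_nonneg_left ?_ (slowDecay_pos x).le
  have hz := invJapanese_pos x
  have h1 : inner ℝ x ξ * (inner ℝ e x * inner ℝ e ξ) ≤ ‖x‖ ^ 2 * ‖ξ‖ ^ 2 := by
    have a1 := abs_real_inner_le_norm x ξ
    have a2 := abs_real_inner_le_norm e x
    have a3 := abs_real_inner_le_norm e ξ
    rw [he, one_mul] at a2 a3
    refine (le_abs_self _).trans ?_
    rw [abs_mul, abs_mul]
    calc _ ≤ (‖x‖ * ‖ξ‖) * (‖x‖ * ‖ξ‖) := by gcongr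
      _ = _ := by ring
  have h2 : invJapanese x * (inner ℝ x ξ * (inner ℝ e x * inner ℝ e ξ)) ≤ ‖ξ‖ ^ 2 :=
    calc _ ≤ invJapanese x * (‖x‖ ^ 2 * ‖ξ‖ ^ 2) := by gcongr
      _ = invJapanese x * ‖x‖ ^ 2 * ‖ξ‖ ^ 2 := by ring
      _ ≤ 1 * ‖ξ‖ ^ 2 := by gcongr; exact invJapanese_mul_sq_norm_le_one x
      _ = _ := one_mul _
  have h3 := mul_le_mul_of_nonneg_left h2 hε
  have h4 := mul_le_mul_of_nonneg_right (coneCoeff_mem he hq hε hx).2 (sq_nonneg ‖ξ‖)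
  have h5 : 0 ≤ ε * invJapanese x * q * inner ℝ x ξ ^ 2 := by positivity
  have h6 : 0 ≤ 4 * ε * (1 + ε) * invJapanese x ^ 2 * coneQuad e q x * inner ℝ x ξ ^ 2 := by
    positivity
  nlinarith

/-- The constant multiple of `slowDecay` that corrects the Laplacian of `coneWeight`. -/
def coneConst (n : ℕ) (q : ℝ) : ℝ := -(2 - (n + 1) * q)

/-- The corrected Laplacian of `coneWeight`. -/
noncomputable def coneLap (e : EuclideanSpace ℝ (Fin n)) (q ε : ℝ)
    (x : EuclideanSpace ℝ (Fin n)) : ℝ :=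
  lapAlong coordDir (coneWeight e q ε) x + coneConst n q * slowDecay ε x

theorem coneLap_mem (he : ‖e‖ = 1) (hq : 0 ≤ q) (hε : 0 ≤ ε) (hε1 : ε ≤ 1)
    {x : EuclideanSpace ℝ (Fin n)} (hx : 0 ≤ coneQuad e q x) :
    ∃ b ∈ Icc (-(1 - q) - (n + 4) * ε) (-(1 - q) + 4 * ε),
      coneLap e q ε x = slowDecay ε x * b := by
  refine ⟨_, ?_, by rw [coneLap, lapAlong_coneWeight he, coneConst, mul_comm (-_), ← mul_add]⟩
  have h1 := invJapanese_mul_coneQuad_le he hq x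
  have h2 := mul_nonneg (invJapanese_pos x).le hx
  have h3 := invJapanese_mul_sq_norm_le_one x
  have h4 := mul_nonneg (invJapanese_pos x).le (sq_nonneg ‖x‖)
  obtain ⟨h5, h6⟩ := coneCoeff_mem he hq hε hx
  have hn : (0 : ℝ) ≤ n := n.cast_nonneg
  have h7 := mul_le_mul_of_nonneg_left h5 hn
  have h8 := mul_le_mul_of_nonneg_left h6 hn
  generalize invJapanese x * coneQuad e q x = t at *
  generalize invJapanese x * ‖x‖ ^ 2 = u at *
  generalize coneCoeff e q ε x = α at *
  have h9 : 4 * ε * (1 + ε) * t * u ≤ 4 * ε := by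
    calc 4 * ε * (1 + ε) * t * u ≤ 4 * ε * (1 + 1) * (1 / 2) * 1 := by gcongr
      _ = _ := by ring
  have h10 : 0 ≤ 4 * ε * (1 + ε) * t * u := by positivity
  have h11 : ε * t ≤ ε * (1 / 2) := by gcongr
  have h12 : 0 ≤ ε * t := by positivity
  constructor <;> linarith

/-- Conditions under which the weight `coneWeight e q ε` is pseudoconvex. -/
structure ConeParams (e : EuclideanSpace ℝ (Fin n)) (q ε : ℝ) : Prop where
  norm_eq : ‖e‖ = 1
  q_pos : 0 < q
  ε_pos : 0 < ε
  small : 300 * (n + 1) * ε ≤ (1 - 3 * q) * q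

namespace ConeParams

theorem gap_pos (h : ConeParams e q ε) : 0 < 1 - 3 * q := by
  have h1 : 0 < 300 * ((n : ℝ) + 1) * ε := mul_pos (by positivity) h.ε_pos
  exact pos_of_mul_pos_left (h1.trans_le h.small) h.q_pos.le

theorem bounds (h : ConeParams e q ε) : 300 * ε ≤ (1 - 3 * q) * q ∧
    0 ≤ n * ε ∧ 300 * (n * ε) + 300 * ε ≤ (1 - 3 * q) * q ∧ ε ≤ 1 / 300 ∧
    (1 - 3 * q) * q ≤ 1 - 3 * q ∧ (1 - 3 * q) * q ≤ q := by
  have h0 := h.ε_pos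
  have h1 := h.q_pos
  have h2 := h.small
  have h3 := h.gap_pos
  have h4 : 0 ≤ n * ε := by positivity
  refine ⟨by nlinarith, h4, by linarith, by nlinarith, by nlinarith, by nlinarith⟩

theorem le_commForm (h : ConeParams e q ε) {x : EuclideanSpace ℝ (Fin n)}
    (hx : 0 ≤ coneQuad e q x) {c g : ℝ} (hg : 0 ≤ g) (ξ : EuclideanSpace ℝ (Fin n)) :
    8 * c * ‖ξ‖ ^ 2 ≤ 4 * g * hessForm (coneWeight e q ε) x ξ
      - 2 * (g * coneLap e q ε x - 4 * c) * ‖ξ‖ ^ 2 := by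
  obtain ⟨b1, b2, b3, b4, b5, b6⟩ := h.bounds
  have hH := le_hessForm_coneWeight h.norm_eq h.q_pos.le h.ε_pos.le hx ξ
  obtain ⟨b, hb, hb'⟩ := coneLap_mem h.norm_eq h.q_pos.le h.ε_pos.le (by linarith) hx
  rw [hb']
  have hw := slowDecay_pos (ε := ε) x
  generalize slowDecay ε x = w at *
  have h1 := mul_le_mul_of_nonneg_left hH hg
  have hS := sq_nonneg ‖ξ‖
  have h2 : 0 ≤ g * w * (inner ℝ e ξ ^ 2) := by positivity
  have h3 : 0 ≤ g * w * (‖ξ‖ ^ 2 * (-4 * (q + 5 * ε) - 2 * b)) := by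
    refine mul_nonneg (by positivity) (mul_nonneg hS ?_)
    linarith [hb.2, h.gap_pos]
  nlinarith

theorem scalar_bounds (h : ConeParams e q ε) {y ρ α : ℝ} (hα : α ∈ Icc q (q + ε))
    (hy : y ^ 2 ≤ ρ) :
    (1 - 2 * q - 2 * ε) * y ^ 2 + q ^ 2 * ρ ≤ (1 - 2 * α) * y ^ 2 + α ^ 2 * ρ ∧
    (1 - 2 * α) * y ^ 2 + α ^ 2 * ρ ≤ (1 - 2 * q) * y ^ 2 + q ^ 2 * ρ + 2 * ε * ρ ∧
    (1 - 2 * α) * y ^ 2 + α ^ 2 * ρ ≤ 2 * ρ ∧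
    ((1 - q) ^ 2 - 2 * ε) * y ^ 2 ≤ (1 - α) ^ 2 * y ^ 2 := by
  obtain ⟨b1, b2, b3, b4, b5, b6⟩ := h.bounds
  have hq := h.q_pos
  have hε := h.ε_pos
  have hd := h.gap_pos
  obtain ⟨h1, h2⟩ := hα
  have hyy := sq_nonneg y
  have hρ : 0 ≤ ρ := hyy.trans hy
  have e1 : q ^ 2 ≤ α ^ 2 := by gcongr
  have e2 : α ^ 2 ≤ q ^ 2 + 2 * ε := by nlinarith
  have e3 : (1 - q) ^ 2 - 2 * ε ≤ (1 - α) ^ 2 := by nlinarith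
  generalize y ^ 2 = Y at *
  refine ⟨?_, ?_, ?_, ?_⟩
  · have := mul_le_mul_of_nonneg_right e1 hρ
    have := mul_le_mul_of_nonneg_right h2 hyy
    linarith
  · have := mul_le_mul_of_nonneg_right e2 hρ
    have := mul_le_mul_of_nonneg_right h1 hyy
    linarith
  · have : α ^ 2 ≤ 1 := by nlinarith
    have := mul_le_mul_of_nonneg_right this hρ
    have := mul_nonneg (hq.le.trans h1) hyy
    linarith
  · exact mul_le_mul_of_nonneg_right e3 hyy

theorem gradSq_le (h : ConeParams e q ε) {x : EuclideanSpace ℝ (Fin n)}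
    (hx : 0 ≤ coneQuad e q x) :
    gradSq coordDir (coneWeight e q ε) x ≤ 2 * slowDecay ε x ^ 2 * ‖x‖ ^ 2 := by
  have hα := coneCoeff_mem h.norm_eq h.q_pos.le h.ε_pos.le hx
  have hy := sq_inner_le_sq_norm h.norm_eq x
  have := (h.scalar_bounds hα hy).2.2.1
  rw [gradSq_coneWeight h.norm_eq]
  nlinarith [sq_nonneg (slowDecay ε x)]

theorem le_cubic (h : ConeParams e q ε) {x : EuclideanSpace ℝ (Fin n)}
    (hx : 0 ≤ coneQuad e q x) :
    (1 - 3 * q) * q * (slowDecay ε x ^ 3 * ‖x‖ ^ 2)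
      ≤ 4 * hessForm (coneWeight e q ε) x (fun i => dirDeriv (coordDir i) (coneWeight e q ε) x)
        + 2 * coneLap e q ε x * gradSq coordDir (coneWeight e q ε) x := by
  obtain ⟨b1, b2, b3, b4, b5, b6⟩ := h.bounds
  have hq := h.q_pos
  have hε := h.ε_pos
  have hd := h.gap_pos
  have hα := coneCoeff_mem h.norm_eq h.q_pos.le h.ε_pos.le hx
  have hy := sq_inner_le_sq_norm h.norm_eq x
  have hy' : q * ‖x‖ ^ 2 ≤ inner ℝ e x ^ 2 := by rw [coneQuad] at hx; linarith
  obtain ⟨s1, s2, s3, s4⟩ := h.scalar_bounds hα hy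
  obtain ⟨ξ, hξ, hξ1, hξ2⟩ := hessForm_coneWeight_gradient (q := q) (ε := ε) h.norm_eq x
  obtain ⟨b, hb, hb'⟩ := coneLap_mem h.norm_eq h.q_pos.le h.ε_pos.le (by linarith) hx
  have hH := le_hessForm_coneWeight h.norm_eq h.q_pos.le h.ε_pos.le hx ξ
  rw [hξ2, hξ1, gradSq_coneWeight h.norm_eq] at hH
  rw [hξ, hb', gradSq_coneWeight h.norm_eq]
  have hw := slowDecay_pos (ε := ε) x
  generalize slowDecay ε x = w at *
  generalize coneCoeff e q ε x = α at *
  have hG0 : 0 ≤ (1 - 2 * α) * inner ℝ e x ^ 2 + α ^ 2 * ‖x‖ ^ 2 :=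
    (add_nonneg (mul_nonneg (by linarith) (sq_nonneg _)) (by positivity)).trans s1
  rw [mul_pow w, mul_pow (1 - α)] at hH
  have hρ := sq_nonneg ‖x‖
  have hYY := sq_nonneg (inner ℝ e x)
  generalize ‖x‖ ^ 2 = ρ at *
  generalize inner ℝ e x ^ 2 = Y at *
  generalize (1 - 2 * α) * Y + α ^ 2 * ρ = G at *
  generalize (1 - α) ^ 2 * Y = A at *
  have key : (1 - 3 * q) * q * ρ ≤ 4 * A - 4 * (q + 5 * ε) * G + 2 * b * G := by
    have k1 : 4 * A - (2 + 2 * q + (2 * n + 28) * ε) * G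
        ≤ 4 * A - 4 * (q + 5 * ε) * G + 2 * b * G := by
      have := mul_le_mul_of_nonneg_right hb.1 hG0
      linarith
    refine le_trans ?_ k1
    have k2 : (2 * n + 28) * ε * G ≤ (2 * n + 28) * ε * (2 * ρ) := by gcongr
    have k3 : (2 + 2 * q) * G ≤ (2 + 2 * q) * ((1 - 2 * q) * Y + q ^ 2 * ρ + 2 * ε * ρ) := by
      gcongr
    have k4 : (2 + 2 * q) * (q * (q * ρ)) ≤ (2 + 2 * q) * (q * Y) := by gcongr
    have k5 : 2 * ((1 - q) * (1 - 3 * q)) * (q * ρ) ≤ 2 * ((1 - q) * (1 - 3 * q)) * Y := by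
      have : 0 ≤ 1 - q := by linarith
      gcongr
    have k6 : ε * Y ≤ ε * ρ := by gcongr
    have k7 : ε * (q * ρ) ≤ ε * ρ := by
      have : q * ρ ≤ 1 * ρ := by gcongr; linarith
      nlinarith
    have k8 : (300 * (n * ε) + 300 * ε) * ρ ≤ (1 - 3 * q) * q * ρ := by gcongr
    have k9 : 0 ≤ n * ε * ρ := by positivity
    have k10 : 2 / 3 * ((1 - 3 * q) * (q * ρ)) ≤ (1 - q) * ((1 - 3 * q) * (q * ρ)) := by
      have : 2 / 3 ≤ 1 - q := by linarith
      gcongr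
    have k11 : 0 ≤ ε * ρ := by positivity
    linarith
  calc (1 - 3 * q) * q * (w ^ 3 * ρ) = w ^ 3 * ((1 - 3 * q) * q * ρ) := by ring
    _ ≤ w ^ 3 * (4 * A - 4 * (q + 5 * ε) * G + 2 * b * G) := by gcongr
    _ = 4 * (w * (w ^ 2 * A - (q + 5 * ε) * (w ^ 2 * G))) + 2 * (w * b) * (w ^ 2 * G) := by ring
    _ ≤ _ := by linarith

theorem neg_coneLap_mul_le (h : ConeParams e q ε) {x : EuclideanSpace ℝ (Fin n)}
    (hx : 0 ≤ coneQuad e q x) :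
    -coneLap e q ε x * coneWeight e q ε x ≤ gradSq coordDir (coneWeight e q ε) x := by
  obtain ⟨b1, b2, b3, b4, b5, b6⟩ := h.bounds
  have hq := h.q_pos
  have hε := h.ε_pos
  have hd := h.gap_pos
  have hα := coneCoeff_mem h.norm_eq h.q_pos.le h.ε_pos.le hx
  have hy := sq_inner_le_sq_norm h.norm_eq x
  have hy' : q * ‖x‖ ^ 2 ≤ inner ℝ e x ^ 2 := by rw [coneQuad] at hx; linarith
  have s1 := (h.scalar_bounds hα hy).1
  obtain ⟨b, hb, hb'⟩ := coneLap_mem h.norm_eq h.q_pos.le h.ε_pos.le (by linarith) hx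
  rw [hb', gradSq_coneWeight h.norm_eq, coneWeight]
  have k1 := mul_le_mul_of_nonneg_right hb.1 hx
  have hρ := sq_nonneg ‖x‖
  have hYY := sq_nonneg (inner ℝ e x)
  calc -(slowDecay ε x * b) * (slowDecay ε x * coneQuad e q x)
      = slowDecay ε x ^ 2 * (-b * coneQuad e q x) := by ring
    _ ≤ _ := by
      refine mul_le_mul_of_nonneg_left (le_trans ?_ s1) (sq_nonneg _)
      rw [coneQuad] at k1 ⊢
      generalize ‖x‖ ^ 2 = ρ at *
      generalize inner ℝ e x ^ 2 = Y at *
      have k2 : 0 ≤ ((1 - 3 * q) / 2 - (4 + n / 2) * ε) * Y := mul_nonneg (by linarith) hYY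
      have k3 : 0 ≤ (1 - q + (n + 4) * ε) * q * ρ :=
        mul_nonneg (mul_nonneg (by nlinarith) hq.le) hρ
      have k4 : 0 ≤ q ^ 2 * ρ := by positivity
      linarith

theorem coneLap_sq_le (h : ConeParams e q ε) {x : EuclideanSpace ℝ (Fin n)}
    (hx : 0 ≤ coneQuad e q x) : coneLap e q ε x ^ 2 ≤ 4 * slowDecay ε x ^ 2 := by
  obtain ⟨b1, b2, b3, b4, b5, b6⟩ := h.bounds
  obtain ⟨b, hb, hb'⟩ := coneLap_mem h.norm_eq h.q_pos.le h.ε_pos.le (by linarith) hx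
  have hq := h.q_pos
  have hd := h.gap_pos
  rw [hb', mul_pow, mul_comm]
  have : b ^ 2 ≤ 2 ^ 2 := sq_le_sq' (by linarith [hb.1]) (by linarith [hb.2])
  nlinarith [sq_nonneg (slowDecay ε x)]

theorem abs_lapAlong_slowDecay_le (h : ConeParams e q ε) (x : EuclideanSpace ℝ (Fin n)) :
    |lapAlong coordDir (slowDecay ε) x| ≤ (8 + 2 * n) * slowDecay ε x := by
  obtain ⟨b1, b2, b3, b4, b5, b6⟩ := h.bounds
  have hε := h.ε_pos
  rw [lapAlong_slowDecay, abs_mul, abs_of_pos (slowDecay_pos x), mul_comm]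
  refine mul_le_mul_of_nonneg_right ?_ (slowDecay_pos x).le
  have h1 := invJapanese_pos x
  have h2 := invJapanese_le_one x
  have h3 := invJapanese_mul_sq_norm_le_one x
  have h4 := mul_nonneg h1.le (sq_nonneg ‖x‖)
  generalize invJapanese x * ‖x‖ ^ 2 = u at *
  generalize invJapanese x = z at *
  have k1 : 4 * ε * (1 + ε) * z * u ≤ 4 * 1 * (1 + 1) * 1 * 1 := by gcongr <;> linarith
  have k2 : 0 ≤ 4 * ε * (1 + ε) * z * u := by positivity
  have k3 : 2 * (n * ε * z) ≤ 2 * (n * 1 * 1) := by gcongr; linarith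
  have k4 : 0 ≤ n * ε * z := by positivity
  have hn : (0 : ℝ) ≤ n := n.cast_nonneg
  rw [abs_le]
  constructor <;> linarith

end ConeParams

end ConeWeightBounds

section ConeCarleman

variable {n : ℕ} {e : EuclideanSpace ℝ (Fin n)} {q ε c : ℝ}

theorem coneWeight_nonneg_iff {x : EuclideanSpace ℝ (Fin n)} :
    0 ≤ coneWeight e q ε x ↔ 0 ≤ coneQuad e q x := by
  rw [coneWeight, mul_nonneg_iff_of_pos_left (slowDecay_pos x)]

theorem two_mul_coneWeight_le (he : ‖e‖ = 1) (hq : 0 ≤ q) (x : EuclideanSpace ℝ (Fin n)) :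
    2 * coneWeight e q ε x ≤ slowDecay ε x * ‖x‖ ^ 2 := by
  have := mul_le_mul_of_nonneg_left (coneQuad_le he hq x) (slowDecay_pos (ε := ε) x).le
  rw [coneWeight]
  linarith

theorem ConeParams.commForm_le (h : ConeParams e q ε) {g : ℝ → ℝ} (hg : ContDiff ℝ ∞ g)
    {p : EuclideanSpace ℝ (Fin n) × ℝ} (hp : 0 ≤ coneQuad e q p.1) (hg0 : 0 ≤ g p.2)
    (ξ : Fin n → ℝ) : 8 * c * ∑ i, ξ i ^ 2 ≤
      commForm spaceDir (fun p => g p.2 * coneWeight e q ε p.1 + (fun _ => (0 : ℝ)) p.2)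
        (fun p => g p.2 * (fun x => coneConst n q * slowDecay ε x) p.1 + -(4 * c)) p ξ := by
  rw [commForm_separable (m := fun x => coneConst n q * slowDecay ε x) (K := 4 * c)
    contDiff_coneWeight hg contDiff_const p ξ]
  have := h.le_commForm hp (c := c) hg0 (WithLp.toLp 2 ξ)
  rw [norm_sq_eq_sum] at this
  exact this

/-- A lower bound for the Carleman weight that makes it admissible. -/
structure ConeThreshold (n : ℕ) (q c A : ℝ) : Prop where
  const_le : 1 + 2 * c + 2 * (4 * c) ^ 2 + |coneConst n q| * (8 + 2 * n) ≤ A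
  quad_le : 8 + |coneConst n q| * (8 + 2 * n) ≤ 2 * ((1 - 3 * q) * q) * A

theorem ConeParams.le_commPotential (h : ConeParams e q ε) (hc : 0 ≤ c) {g : ℝ → ℝ}
    (hg : ContDiff ℝ ∞ g) {p : EuclideanSpace ℝ (Fin n) × ℝ} (hp : 0 ≤ coneQuad e q p.1)
    (hg0 : 0 ≤ g p.2) {g₁ A : ℝ} (hg1 : deriv g p.2 = -(8 * c + 1) * g₁) (hgg : g p.2 ≤ g₁)
    (hg2 : deriv (deriv g) p.2 = (8 * c + 1) ^ 2 * g₁) (hA : A ≤ g p.2 * coneWeight e q ε p.1)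
    (hAA : ConeThreshold n q c A) :
    1 + 8 * c * gradSq spaceDir
        (fun p => g p.2 * coneWeight e q ε p.1 + (fun _ => (0 : ℝ)) p.2) p + 2 * c
      + (lapAlong spaceDir (fun p => g p.2 * coneWeight e q ε p.1 + (fun _ => (0 : ℝ)) p.2) p
        + (g p.2 * (fun x => coneConst n q * slowDecay ε x) p.1 + -(4 * c))) ^ 2
      ≤ commPotential spaceDir timeDir
        (fun p => g p.2 * coneWeight e q ε p.1 + (fun _ => (0 : ℝ)) p.2)
        (fun p => g p.2 * (fun x => coneConst n q * slowDecay ε x) p.1 + -(4 * c)) p := by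
  have hm : ContDiff ℝ ∞ fun x : EuclideanSpace ℝ (Fin n) => coneConst n q * slowDecay ε x := by
    fun_prop
  have hf : ContDiff ℝ ∞ (coneWeight e q ε) := contDiff_coneWeight
  have hψ : ContDiff ℝ ∞ fun _ : ℝ => (0 : ℝ) := contDiff_const
  rw [commPotential_separable (m := fun x => coneConst n q * slowDecay ε x) (K := 4 * c) hf hm hg
    hψ p, congrFun (gradSq_separable hf hg hψ) p, congrFun (lapAlong_separable hf hg hψ) p]
  have hlap : lapAlong coordDir (fun x : EuclideanSpace ℝ (Fin n) =>
      coneConst n q * slowDecay ε x) p.1 = coneConst n q * lapAlong coordDir (slowDecay ε) p.1 := by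
    simp (disch := fun_prop) only [lapAlong, dirDeriv_const_mul, Finset.mul_sum]
  have hN : lapAlong coordDir (coneWeight e q ε) p.1 + coneConst n q * slowDecay ε p.1
      = coneLap e q ε p.1 := rfl
  have hL : lapAlong coordDir (coneWeight e q ε) p.1
      = coneLap e q ε p.1 - coneConst n q * slowDecay ε p.1 := by rw [← hN]; ring
  have i1 := h.le_cubic hp
  have i2 := h.neg_coneLap_mul_le hp
  have i5 := two_mul_coneWeight_le (ε := ε) h.norm_eq h.q_pos.le p.1
  have i6 := mul_le_mul_of_nonneg_left (h.abs_lapAlong_slowDecay_le p.1)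
    (abs_nonneg (coneConst n q))
  rw [← abs_mul] at i6
  have i7 := h.coneLap_sq_le hp
  have hG := gradSq_nonneg coordDir (coneWeight e q ε) p.1
  have hF := (coneWeight_nonneg_iff (ε := ε)).2 hp
  have hσ : 0 < (1 - 3 * q) * q := mul_pos h.gap_pos h.q_pos
  have hw := slowDecay_pos (ε := ε) p.1
  obtain ⟨a1, a2⟩ := hAA
  have hC : 0 ≤ |coneConst n q| * (8 + 2 * (n : ℝ)) := by positivity
  simp only [hlap, hg1, hg2, deriv_const', hL]
  have i8 := neg_le_of_abs_le i6
  generalize coneConst n q * lapAlong coordDir (slowDecay ε) p.1 = D at *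
  generalize hk : |coneConst n q| * (8 + 2 * (n : ℝ)) = C at *
  rw [← mul_assoc, hk] at i8
  generalize coneConst n q = m₀ at *
  generalize coneLap e q ε p.1 = N at *
  generalize hessForm (coneWeight e q ε) p.1
    (fun i => dirDeriv (coordDir i) (coneWeight e q ε) p.1) = H at *
  generalize gradSq coordDir (coneWeight e q ε) p.1 = G at *
  generalize coneWeight e q ε p.1 = F at *
  generalize slowDecay ε p.1 = w at *
  generalize ‖p.1‖ ^ 2 = ρ at *
  generalize (1 - 3 * q) * q = σ at *
  generalize g p.2 = γ at *
  have j1 := mul_le_mul_of_nonneg_left i1 (pow_nonneg hg0 3)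
  have j2 : 0 ≤ 2 * γ * (8 * c + 1) * g₁ * (N * F + G) := by
    have : 0 ≤ g₁ := hg0.trans hgg
    exact mul_nonneg (by positivity) (by linarith)
  have j3 : 2 * γ * (8 * c + 1) * G * γ ≤ 2 * γ * (8 * c + 1) * G * g₁ := by gcongr
  have j4 : A ≤ (8 * c + 1) * g₁ * F := by
    calc A ≤ γ * F := hA
      _ ≤ g₁ * F := by gcongr
      _ ≤ (8 * c + 1) * (g₁ * F) := le_mul_of_one_le_left (mul_nonneg (hg0.trans hgg) hF)
          (by linarith)
      _ = _ := by ring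
  have j5 : (8 + C) * (γ ^ 2 * w ^ 2) ≤ γ ^ 3 * (σ * (w ^ 3 * ρ)) := by
    have e1 : 2 * A ≤ γ * (w * ρ) := by
      have := mul_le_mul_of_nonneg_left i5 hg0
      linarith
    calc (8 + C) * (γ ^ 2 * w ^ 2) ≤ 2 * σ * A * (γ ^ 2 * w ^ 2) := by gcongr
      _ = σ * (γ ^ 2 * w ^ 2) * (2 * A) := by ring
      _ ≤ σ * (γ ^ 2 * w ^ 2) * (γ * (w * ρ)) := by gcongr
      _ = _ := by ring
  have j6 : -(C * (1 + γ ^ 2 * w ^ 2)) ≤ γ * D := by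
    have e1 := mul_le_mul_of_nonneg_left i8 hg0
    have e2 : γ * w ≤ 1 + γ ^ 2 * w ^ 2 := by nlinarith [sq_nonneg (γ * w - 1)]
    have e3 := mul_le_mul_of_nonneg_left e2 hC
    linarith
  have j7 : (γ * N - 4 * c) ^ 2 ≤ 8 * (γ ^ 2 * w ^ 2) + 2 * (4 * c) ^ 2 := by
    have := mul_le_mul_of_nonneg_left i7 (sq_nonneg γ)
    nlinarith [sq_nonneg (γ * N + 4 * c)]
  have j8 : (γ * (N - m₀ * w) + (γ * (m₀ * w) + -(4 * c))) ^ 2 = (γ * N - 4 * c) ^ 2 := by ring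
  have j9 : 0 ≤ γ ^ 2 * G := by positivity
  rw [j8]
  linarith

end ConeCarleman

section DerivBound

variable {W : Type*} [NormedAddCommGroup W] [NormedSpace ℝ W] {ι : Type*} [Fintype ι]
  {e : ι → W} {t : W} {F G : W → ℝ} {B B' : ℝ} {p : W}

/-- The derivatives of `F` entering the cutoff error are at most `B` at `p`. -/
structure DerivBound (e : ι → W) (t : W) (F : W → ℝ) (B : ℝ) (p : W) : Prop where
  gradSq_le : gradSq e F p ≤ B
  abs_dirDeriv_le : |dirDeriv t F p| ≤ B
  abs_lapAlong_le : |lapAlong e F p| ≤ B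

theorem gradSq_comp {σ : ℝ → ℝ} (hσ : ContDiff ℝ ∞ σ) (hF : ContDiff ℝ ∞ F) :
    gradSq e (fun p => σ (F p)) p = deriv σ (F p) ^ 2 * gradSq e F p := by
  simp only [gradSq, dirDeriv_comp hσ hF, Finset.mul_sum, mul_pow]

theorem lapAlong_comp {σ : ℝ → ℝ} (hσ : ContDiff ℝ ∞ σ) (hF : ContDiff ℝ ∞ F) :
    lapAlong e (fun p => σ (F p)) p
      = deriv (deriv σ) (F p) * gradSq e F p + deriv σ (F p) * lapAlong e F p := by
  have hσ' : ContDiff ℝ ∞ (deriv σ) := hσ.deriv'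
  have hc : ContDiff ℝ ∞ fun p => deriv σ (F p) := hσ'.comp hF
  simp (disch := fun_prop) only [lapAlong, gradSq, dirDeriv_comp hσ hF, dirDeriv_mul hc,
    dirDeriv_comp hσ' hF, Finset.mul_sum, ← Finset.sum_add_distrib]
  exact Finset.sum_congr rfl fun i _ => by ring

namespace DerivBound

theorem comp (h : DerivBound e t F B p) (hF : ContDiff ℝ ∞ F) {σ : ℝ → ℝ} {S : ℝ}
    (hσ : ContDiff ℝ ∞ σ) (h1 : ∀ r, |deriv σ r| ≤ S) (h2 : ∀ r, |deriv (deriv σ) r| ≤ S) :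
    DerivBound e t (fun p => σ (F p)) ((S ^ 2 + 2 * S) * B) p := by
  have hS : 0 ≤ S := (abs_nonneg _).trans (h1 0)
  have hB : 0 ≤ B := (gradSq_nonneg e F p).trans h.gradSq_le
  have hG := gradSq_nonneg e F p
  refine ⟨?_, ?_, ?_⟩
  · rw [gradSq_comp hσ hF]
    have h3 : deriv σ (F p) ^ 2 ≤ S ^ 2 := sq_le_sq' (abs_le.1 (h1 _)).1 (abs_le.1 (h1 _)).2
    calc _ ≤ S ^ 2 * B := mul_le_mul h3 h.gradSq_le hG (sq_nonneg S)
      _ ≤ _ := by nlinarith [mul_nonneg hS hB]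
  · rw [dirDeriv_comp hσ hF, abs_mul]
    calc _ ≤ S * B := mul_le_mul (h1 _) h.abs_dirDeriv_le (abs_nonneg _) hS
      _ ≤ _ := by nlinarith [mul_nonneg hS hB, mul_nonneg (sq_nonneg S) hB]
  · rw [lapAlong_comp hσ hF]
    refine (abs_add_le _ _).trans ?_
    rw [abs_mul, abs_mul, abs_of_nonneg hG]
    have h3 := mul_le_mul (h2 (F p)) h.gradSq_le hG hS
    have h4 := mul_le_mul (h1 (F p)) h.abs_lapAlong_le (abs_nonneg _) hS
    nlinarith [mul_nonneg (sq_nonneg S) hB]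

theorem mul (hF : DerivBound e t F B p) (hG : DerivBound e t G B' p) (cF : ContDiff ℝ ∞ F)
    (cG : ContDiff ℝ ∞ G) (h1 : |F p| ≤ 1) (h2 : |G p| ≤ 1) :
    DerivBound e t (fun p => F p * G p) (2 * (B + B')) p := by
  have gF := gradSq_nonneg e F p
  have gG := gradSq_nonneg e G p
  have hB : 0 ≤ B := gF.trans hF.gradSq_le
  have hB' : 0 ≤ B' := gG.trans hG.gradSq_le
  have mul_le {a b D : ℝ} (ha : |a| ≤ 1) (hb : |b| ≤ D) : |a * b| ≤ D := by
    rw [abs_mul]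
    exact (mul_le_mul_of_nonneg_right ha (abs_nonneg b)).trans (by rwa [one_mul])
  refine ⟨(gradSq_mul_le cF cG p).trans ?_, ?_, ?_⟩
  · have h3 : F p ^ 2 ≤ 1 := (sq_le_one_iff_abs_le_one _).2 h1
    have h4 : G p ^ 2 ≤ 1 := (sq_le_one_iff_abs_le_one _).2 h2
    have h5 := mul_le_mul h3 hG.gradSq_le gG zero_le_one
    have h6 := mul_le_mul h4 hF.gradSq_le gF zero_le_one
    linarith
  · rw [dirDeriv_mul cF cG]
    have h3 := mul_le h1 hG.abs_dirDeriv_le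
    have h4 := mul_le h2 hF.abs_dirDeriv_le
    rw [mul_comm (G p)] at h4
    exact (abs_add_le _ _).trans (by linarith)
  · rw [lapAlong_mul cF cG]
    have h3 := mul_le h1 hG.abs_lapAlong_le
    have h4 := mul_le h2 hF.abs_lapAlong_le
    rw [mul_comm (G p)] at h4
    have h5 : |2 * ∑ i, dirDeriv (e i) F p * dirDeriv (e i) G p| ≤ B + B' := by
      have h6 := sum_dirDeriv_mul_sq_le e F G p
      refine abs_le_of_sq_le_sq ?_ (by positivity)
      nlinarith [mul_le_mul hF.gradSq_le hG.gradSq_le gG hB, sq_nonneg (B - B')]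
    exact (abs_add_le _ _).trans ((add_le_add_left (abs_add_le _ _) _).trans (by linarith))

theorem congr (h : DerivBound e t F B p) (hFG : G =ᶠ[𝓝 p] F) : DerivBound e t G B p :=
  ⟨hFG.gradSq.trans_le h.gradSq_le, by rw [hFG.dirDeriv.eq_of_nhds]; exact h.abs_dirDeriv_le,
    by rw [hFG.lapAlong]; exact h.abs_lapAlong_le⟩

end DerivBound

end DerivBound

/-- A smooth step from zero on `(-∞, l / 2]` to one on `[l, ∞)`. -/
theorem exists_smooth_step {l : ℝ} (hl : 0 < l) : ∃ (σ : ℝ → ℝ) (S : ℝ), ContDiff ℝ ∞ σ ∧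
    (∀ r, 0 ≤ σ r ∧ σ r ≤ 1) ∧ (∀ r ≤ l / 2, σ r = 0) ∧ (∀ r, l ≤ r → σ r = 1) ∧
    (∀ r, |deriv σ r| ≤ S) ∧ ∀ r, |deriv (deriv σ) r| ≤ S := by
  set σ : ℝ → ℝ := fun r => smoothTransition (2 / l * r - 1) with hσ
  have hc : ContDiff ℝ ∞ σ :=
    smoothTransition.contDiff.comp (by fun_prop : ContDiff ℝ ∞ fun r : ℝ => 2 / l * r - 1)
  have h0 : ∀ r ≤ l / 2, σ r = 0 := fun r hr => smoothTransition.zero_of_nonpos (by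
    have : 2 / l * r ≤ 2 / l * (l / 2) := by gcongr
    have : 2 / l * (l / 2) = 1 := by field_simp
    linarith)
  have h1 : ∀ r, l ≤ r → σ r = 1 := fun r hr => smoothTransition.one_of_one_le (by
    have : 2 / l * l ≤ 2 / l * r := by gcongr
    have : 2 / l * l = 2 := by field_simp
    linarith)
  have hc1 : ContDiff ℝ ∞ (deriv σ) := hc.deriv'
  have hc2 : ContDiff ℝ ∞ (deriv (deriv σ)) := hc1.deriv'
  have hloc : ∀ r ∉ Icc (l / 2) l, deriv σ =ᶠ[𝓝 r] fun _ => 0 := by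
    intro r hr
    have : ∃ a : ℝ, σ =ᶠ[𝓝 r] fun _ => a := by
      rcases lt_or_ge r (l / 2) with h | h
      · exact ⟨0, by filter_upwards [Iio_mem_nhds h] with y hy using h0 y (le_of_lt hy)⟩
      · have h' : l < r := by
          by_contra! hcon
          exact hr ⟨h, hcon⟩
        exact ⟨1, by filter_upwards [Ioi_mem_nhds h'] with y hy using h1 y (le_of_lt hy)⟩
    obtain ⟨a, ha⟩ := this
    filter_upwards [ha.eventuallyEq_nhds] with y hy
    rw [hy.deriv_eq]; simp
  obtain ⟨S₁, hS₁⟩ := isCompact_Icc.exists_bound_of_continuousOn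
    (hc1.continuous.continuousOn (s := Icc (l / 2) l))
  obtain ⟨S₂, hS₂⟩ := isCompact_Icc.exists_bound_of_continuousOn
    (hc2.continuous.continuousOn (s := Icc (l / 2) l))
  refine ⟨σ, max 0 (max S₁ S₂), hc, fun r => ⟨smoothTransition.nonneg _, smoothTransition.le_one _⟩,
    h0, h1, fun r => ?_, fun r => ?_⟩
  · by_cases hr : r ∈ Icc (l / 2) l
    · exact (hS₁ r hr).trans (by simp)
    · rw [(hloc r hr).eq_of_nhds]; simp
  · by_cases hr : r ∈ Icc (l / 2) l
    · exact (hS₂ r hr).trans (by simp)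
    · rw [(hloc r hr).deriv_eq]; simp

/-- A time weight that vanishes at time `s₂`, and its scaling. -/
noncomputable def coneTime (m s₂ Λ s : ℝ) : ℝ := Λ * rexp (-m * s) - Λ * rexp (-m * s₂)

section ConeTime

variable {m s₂ Λ s : ℝ}

@[fun_prop]
theorem contDiff_coneTime : ContDiff ℝ ∞ (coneTime m s₂ Λ) := by
  unfold coneTime; fun_prop

theorem coneTime_eq : coneTime m s₂ Λ s = Λ * coneTime m s₂ 1 s := by
  unfold coneTime; ring

theorem deriv_coneTime :
    deriv (coneTime m s₂ Λ) = fun s => (-m * Λ) * rexp (-m * s) := by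
  unfold coneTime
  rw [deriv_sub_const_fun, deriv_exp_mul]

theorem deriv_deriv_coneTime :
    deriv (deriv (coneTime m s₂ Λ)) = fun s => (-m * (-m * Λ)) * rexp (-m * s) := by
  rw [deriv_coneTime, deriv_exp_mul]

theorem coneTime_le (hΛ : 0 ≤ Λ) : coneTime m s₂ Λ s ≤ Λ * rexp (-m * s) := by
  unfold coneTime; linarith [mul_nonneg hΛ (exp_pos (-m * s₂)).le]

theorem coneTime_le_one (hm : 0 ≤ m) (hs : 0 ≤ s) : coneTime m s₂ 1 s ≤ 1 :=
  (coneTime_le zero_le_one).trans (by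
    rw [one_mul]; exact exp_le_one_iff.2 (by nlinarith))

theorem coneTime_pos_iff (hm : 0 < m) : 0 < coneTime m s₂ 1 s ↔ s < s₂ := by
  rw [coneTime, one_mul, one_mul, sub_pos, exp_lt_exp]
  constructor <;> intro h <;> nlinarith

end ConeTime

section ConeFun

variable {n : ℕ} {e : EuclideanSpace ℝ (Fin n)} {q ε κ m s₂ T Λ c l : ℝ}
  {p : EuclideanSpace ℝ (Fin n) × ℝ}

/-- The space-time Carleman weight on a cone. -/
noncomputable def coneFun (e : EuclideanSpace ℝ (Fin n)) (q ε m s₂ Λ : ℝ)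
    (p : EuclideanSpace ℝ (Fin n) × ℝ) : ℝ :=
  coneTime m s₂ Λ p.2 * coneWeight e q ε p.1 + (fun _ => (0 : ℝ)) p.2

@[fun_prop]
theorem contDiff_coneFun : ContDiff ℝ ∞ (coneFun e q ε m s₂ Λ) := by
  have h : ContDiff ℝ ∞ fun p : EuclideanSpace ℝ (Fin n) × ℝ => coneWeight e q ε p.1 :=
    contDiff_coneWeight.comp contDiff_fst
  have h' : ContDiff ℝ ∞ fun p : EuclideanSpace ℝ (Fin n) × ℝ => coneTime m s₂ Λ p.2 :=
    contDiff_coneTime.comp contDiff_snd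
  exact (h'.mul h).add contDiff_const

theorem coneFun_apply : coneFun e q ε m s₂ Λ p = coneTime m s₂ Λ p.2 * coneWeight e q ε p.1 :=
  add_zero _

theorem coneFun_eq : coneFun e q ε m s₂ Λ p = Λ * coneFun e q ε m s₂ 1 p := by
  rw [coneFun_apply, coneFun_apply, coneTime_eq, mul_assoc]

theorem coneWeight_le (h : ConeParams e q ε) (x : EuclideanSpace ℝ (Fin n)) :
    coneWeight e q ε x ≤ ‖x‖ ^ 2 / 2 := by
  have h1 := two_mul_coneWeight_le (ε := ε) h.norm_eq h.q_pos.le x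
  have h2 := mul_le_mul_of_nonneg_right (slowDecay_le_one h.ε_pos.le x) (sq_nonneg ‖x‖)
  linarith

/-- Where the weight is positive, the point lies before time `s₂`. -/
theorem coneFun_pos_iff (hm : 0 < m) (hw : 0 < coneWeight e q ε p.1) :
    0 < coneFun e q ε m s₂ 1 p ↔ p.2 < s₂ := by
  rw [coneFun_apply, mul_pos_iff_of_pos_right hw, coneTime_pos_iff hm]

theorem coneFun_le_coneWeight (hm : 0 ≤ m) (hw : 0 ≤ coneWeight e q ε p.1) (hp : 0 ≤ p.2) :
    coneFun e q ε m s₂ 1 p ≤ coneWeight e q ε p.1 := by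
  rw [coneFun_apply]
  exact (mul_le_mul_of_nonneg_right (coneTime_le_one hm hp) hw).trans (one_mul _).le

theorem coneWeight_pos (hκ : 0 ≤ κ) {x : EuclideanSpace ℝ (Fin n)} (hx : x ∈ axisCone e κ) :
    0 < coneWeight e (κ ^ 2) ε x := by
  have hx : κ * ‖x‖ < inner ℝ e x := hx
  refine mul_pos (slowDecay_pos x) ?_
  have h : (κ * ‖x‖) ^ 2 < inner ℝ e x ^ 2 := pow_lt_pow_left₀ hx (by positivity) two_ne_zero
  rw [coneQuad]
  nlinarith

theorem coneQuad_pos_of_coneWeight_pos {x : EuclideanSpace ℝ (Fin n)}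
    (hx : 0 < coneWeight e q ε x) : 0 < coneQuad e q x :=
  (mul_pos_iff_of_pos_left (slowDecay_pos x)).1 hx

theorem mem_axisCone_of_coneWeight_pos {x : EuclideanSpace ℝ (Fin n)}
    (hx : 0 < coneWeight e (κ ^ 2) ε x) (he : 0 ≤ inner ℝ e x) : x ∈ axisCone e κ := by
  have h := coneQuad_pos_of_coneWeight_pos hx
  rw [coneQuad] at h
  exact lt_of_pow_lt_pow_left₀ 2 he (by nlinarith)

theorem coneFun_derivBound (h : ConeParams e q ε) (hm : 0 ≤ m) (hx : 0 ≤ coneQuad e q p.1)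
    (hp : 0 ≤ p.2) (hps : p.2 ≤ s₂) :
    DerivBound spaceDir timeDir (coneFun e q ε m s₂ 1)
      ((2 + |coneConst n q| + m) * (1 + ‖p.1‖ ^ 2)) p := by
  have hr : 0 ≤ ‖p.1‖ ^ 2 := sq_nonneg _
  have hC := abs_nonneg (coneConst n q)
  have hg1 : coneTime m s₂ 1 p.2 ≤ 1 := coneTime_le_one hm hp
  have hg0 : 0 ≤ coneTime m s₂ 1 p.2 := by
    rw [coneTime, one_mul, one_mul, sub_nonneg, exp_le_exp]
    nlinarith
  have hs0 := slowDecay_pos (ε := ε) p.1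
  have hs1 := slowDecay_le_one h.ε_pos.le p.1
  have hw0 : 0 ≤ coneWeight e q ε p.1 := coneWeight_nonneg_iff.2 hx
  have hw := coneWeight_le h p.1
  refine ⟨?_, ?_, ?_⟩
  · unfold coneFun
    rw [gradSq_separable contDiff_coneWeight contDiff_coneTime contDiff_const]
    have h1 : coneTime m s₂ 1 p.2 ^ 2 ≤ 1 := pow_le_one₀ hg0 hg1
    have h2 : slowDecay ε p.1 ^ 2 ≤ 1 := pow_le_one₀ hs0.le hs1
    have h3 := gradSq_nonneg coordDir (coneWeight e q ε) p.1
    calc _ ≤ 1 * (2 * slowDecay ε p.1 ^ 2 * ‖p.1‖ ^ 2) := mul_le_mul h1 (h.gradSq_le hx) h3 zero_le_one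
      _ ≤ 1 * (2 * 1 * ‖p.1‖ ^ 2) := by gcongr
      _ ≤ _ := by nlinarith [mul_nonneg hC hr, mul_nonneg hm hr]
  · unfold coneFun
    rw [dirDeriv_timeDir_separable contDiff_coneWeight contDiff_coneTime contDiff_const,
      deriv_coneTime]
    simp only [deriv_const, add_zero]
    have h1 : rexp (-m * p.2) ≤ 1 := exp_le_one_iff.2 (by nlinarith)
    have h2 : |-m * 1 * rexp (-m * p.2)| ≤ m := by
      rw [abs_mul, abs_of_pos (exp_pos _), mul_one, abs_neg, abs_of_nonneg hm]
      exact mul_le_of_le_one_right hm h1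
    rw [abs_mul, abs_of_nonneg hw0]
    calc _ ≤ m * (‖p.1‖ ^ 2 / 2) := mul_le_mul h2 hw hw0 hm
      _ ≤ _ := by nlinarith [mul_nonneg hC hr, mul_nonneg hm hr]
  · unfold coneFun
    rw [lapAlong_separable contDiff_coneWeight contDiff_coneTime contDiff_const]
    have h1 : |coneLap e q ε p.1| ≤ 2 := by
      refine abs_le_of_sq_le_sq ((h.coneLap_sq_le hx).trans ?_) zero_le_two
      nlinarith
    have h2 : |coneConst n q * slowDecay ε p.1| ≤ |coneConst n q| := by
      rw [abs_mul, abs_of_pos hs0]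
      exact mul_le_of_le_one_right hC hs1
    have h3 : lapAlong coordDir (coneWeight e q ε) p.1
        = coneLap e q ε p.1 - coneConst n q * slowDecay ε p.1 := by
      rw [coneLap]; ring
    rw [abs_mul, abs_of_nonneg hg0, h3]
    calc _ ≤ 1 * (2 + |coneConst n q|) :=
          mul_le_mul hg1 ((abs_sub _ _).trans (add_le_add h1 h2)) (abs_nonneg _) zero_le_one
      _ ≤ _ := by nlinarith [mul_nonneg hC hr, mul_nonneg hm hr]

/-- Cutoffs localizing to the superlevel set `l / 2 ≤ coneFun` inside a ball of radius `R`. -/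
theorem exists_cone_cutoff (h : ConeParams e (κ ^ 2) ε) (hκ : 0 ≤ κ) (hm : 0 < m) (hl : 0 < l)
    (hsT : s₂ < T) (hc : 0 ≤ c) :
    ∃ D : ℝ, 0 ≤ D ∧ ∀ R : ℝ, 1 ≤ R → ∃ η : EuclideanSpace ℝ (Fin n) × ℝ → ℝ,
      ContDiff ℝ ∞ η ∧ HasCompactSupport η ∧ tsupport η ⊆ axisCone e κ ×ˢ Iio T ∧
      (∀ p ∈ tsupport η, 0 < p.2 → p.2 < s₂ ∧ l / 2 ≤ coneFun e (κ ^ 2) ε m s₂ 1 p) ∧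
      (∀ p, 0 < p.2 → p.2 < s₂ → ‖p.1‖ ≤ 1 / 2 * R → p.1 ∈ axisCone e κ →
        l < coneFun e (κ ^ 2) ε m s₂ 1 p → η =ᶠ[𝓝 p] fun _ => 1) ∧
      ∀ p ∈ tsupport η, 0 < p.2 →
        cutoffError spaceDir timeDir c η p ≤ D * (1 + ‖p.1‖ ^ 2) ^ 2 := by
  obtain ⟨σ, S, hσ, hσ01, hσ0, hσ1, hS1, hS2⟩ := exists_smooth_step hl
  obtain ⟨B, hB0, hB⟩ := exists_scaled_cutoff (n := n) (R₁ := 1 / 2) (R₂ := 1) one_pos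
    (by norm_num) hsT
  have hS0 : 0 ≤ S := (abs_nonneg _).trans (hS1 0)
  set C := 2 + |coneConst n (κ ^ 2)| + m with hC
  have hC0 : 0 ≤ C := by positivity
  set D := 2 * ((S ^ 2 + 2 * S) * C + B) with hD
  have hD0 : 0 ≤ D := by positivity
  refine ⟨(16 + 4 * c) * D + 16 * D ^ 2, by positivity, fun R hR => ?_⟩
  obtain ⟨Θ, hΘ, hΘc, hΘs, hΘ01, hΘ1, hΘB⟩ := hB 0 R hR
  rw [one_mul] at hΘs
  set F := coneFun e (κ ^ 2) ε m s₂ 1 with hF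
  have hFc : ContDiff ℝ ∞ F := contDiff_coneFun
  set K : Set (EuclideanSpace ℝ (Fin n) × ℝ) := (Metric.closedBall 0 R ×ˢ Icc 0 s₂) ∩
    {p | 0 ≤ inner ℝ e p.1 ∧ l / 2 ≤ coneWeight e (κ ^ 2) ε p.1} with hK
  have hwc : Continuous fun p : EuclideanSpace ℝ (Fin n) × ℝ => coneWeight e (κ ^ 2) ε p.1 :=
    contDiff_coneWeight.continuous.comp continuous_fst
  have hKc : IsCompact K := by
    have hic : Continuous fun p : EuclideanSpace ℝ (Fin n) × ℝ => inner ℝ e p.1 :=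
      continuous_const.inner continuous_fst
    refine ((isCompact_closedBall _ _).prod isCompact_Icc).inter_right ?_
    exact (isClosed_le continuous_const hic).inter (isClosed_le continuous_const hwc)
  have hO : IsOpen (axisCone e κ ×ˢ (univ : Set ℝ)) := isOpen_axisCone.prod isOpen_univ
  have hKO : K ⊆ axisCone e κ ×ˢ (univ : Set ℝ) := fun p hp =>
    ⟨mem_axisCone_of_coneWeight_pos (by linarith [hp.2.2]) hp.2.1, mem_univ _⟩
  obtain ⟨χ, hχ, hχc, hχs, hχ01, hχ1⟩ := exists_contDiff_cutoff hKc hO hKO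
  have hσF : ContDiff ℝ ∞ fun p => σ (F p) := hσ.comp hFc
  have hinner {x : EuclideanSpace ℝ (Fin n)} (hx : x ∈ axisCone e κ) : 0 ≤ inner ℝ e x :=
    (mul_nonneg hκ (norm_nonneg x)).trans (le_of_lt hx)
  have hsub1 : tsupport (fun p => σ (F p) * Θ p * χ p) ⊆ {p | l / 2 ≤ F p} := by
    refine closure_minimal (fun p hp => ?_) (isClosed_le continuous_const hFc.continuous)
    by_contra hcon
    have : σ (F p) = 0 := hσ0 _ (le_of_lt (not_le.1 hcon))
    exact hp (by simp [this])
  have hsub2 : tsupport (fun p => σ (F p) * Θ p * χ p) ⊆ tsupport Θ :=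
    (tsupport_mul_subset_left (f := fun p => σ (F p) * Θ p) (g := χ)).trans
      (tsupport_mul_subset_right (f := fun p => σ (F p)) (g := Θ))
  have hsub3 : tsupport (fun p => σ (F p) * Θ p * χ p) ⊆ tsupport χ :=
    tsupport_mul_subset_right (f := fun p => σ (F p) * Θ p) (g := χ)
  have hsupp : ∀ p ∈ tsupport (fun p => σ (F p) * Θ p * χ p), 0 < p.2 → p.2 < s₂ ∧ p ∈ K := by
    intro p hp hp0
    have h1 : l / 2 ≤ F p := hsub1 hp
    have h2 := (hχs (hsub3 hp)).1
    have h3 := coneWeight_pos (ε := ε) hκ h2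
    have h4 : p.2 < s₂ := (coneFun_pos_iff hm h3).1 (by linarith)
    exact ⟨h4, ⟨Metric.ball_subset_closedBall (hΘs (hsub2 hp)).1, hp0.le, h4.le⟩, hinner h2,
      h1.trans (coneFun_le_coneWeight hm.le h3.le hp0.le)⟩
  refine ⟨fun p => σ (F p) * Θ p * χ p, (hσF.mul hΘ).mul hχ, hχc.mul_left, fun p hp =>
    ⟨(hχs (hsub3 hp)).1, (hΘs (hsub2 hp)).2⟩, fun p hp hp0 => ⟨(hsupp p hp hp0).1, hsub1 hp⟩, ?_, ?_⟩
  · intro p hp0 hps hpR hpx hpF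
    have h3 := coneWeight_pos (ε := ε) hκ hpx
    have hpK : p ∈ K := ⟨⟨mem_closedBall_zero_iff.2 (by linarith), hp0.le, hps.le⟩, hinner hpx, by
      have := coneFun_le_coneWeight (s₂ := s₂) hm.le h3.le hp0.le
      linarith⟩
    filter_upwards [hχ1 p hpK, hΘ1 p ⟨mem_closedBall_zero_iff.2 hpR, hp0.le, hps.le⟩,
      hFc.continuous.continuousAt.eventually (lt_mem_nhds hpF)] with y h1 h2 h4
    rw [h1, h2, hσ1 _ (le_of_lt h4)]; norm_num
  · intro p hp hp0
    obtain ⟨hps, hpK⟩ := hsupp p hp hp0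
    have hr : 0 ≤ ‖p.1‖ ^ 2 := sq_nonneg _
    have hq := coneQuad_pos_of_coneWeight_pos (by linarith [hpK.2.2] : 0 < coneWeight e (κ ^ 2) ε p.1)
    have hb := ((coneFun_derivBound h hm.le hq.le hp0.le hps.le).comp hFc hσ hS1 hS2).mul
      ⟨(hΘB p).1, (hΘB p).2.1, (hΘB p).2.2⟩ hσF hΘ
      (abs_le.2 ⟨by linarith [hσ01 (F p)], (hσ01 _).2⟩)
      (abs_le.2 ⟨by linarith [hΘ01 p], (hΘ01 _).2⟩)
    have hb' := hb.congr (G := fun p => σ (F p) * Θ p * χ p) (by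
      filter_upwards [hχ1 p hpK] with y hy
      rw [hy, mul_one])
    have hle : 2 * ((S ^ 2 + 2 * S) * (C * (1 + ‖p.1‖ ^ 2)) + B) ≤ D * (1 + ‖p.1‖ ^ 2) := by
      rw [hD]; nlinarith [mul_nonneg hB0 hr]
    have := abs_cutoffError_le hc (hb'.1.trans hle) (hb'.2.trans hle) (hb'.3.trans hle)
    refine this.trans ?_
    nlinarith [mul_nonneg (by positivity : 0 ≤ (16 + 4 * c) * D * (1 + ‖p.1‖ ^ 2)) hr]

end ConeFun

theorem exists_forall_coneThreshold (n : ℕ) (c : ℝ) {q : ℝ} (hq : 0 < (1 - 3 * q) * q) :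
    ∃ A₀, ∀ A, A₀ ≤ A → ConeThreshold n q c A := by
  refine ⟨max (1 + 2 * c + 2 * (4 * c) ^ 2 + |coneConst n q| * (8 + 2 * n))
    ((8 + |coneConst n q| * (8 + 2 * n)) / (2 * ((1 - 3 * q) * q))), fun A hA =>
    ⟨(le_max_left _ _).trans hA, ?_⟩⟩
  have h := (le_max_right _ _).trans hA
  rw [div_le_iff₀ (by positivity)] at h
  linarith

theorem exists_slowDecay_le (n : ℕ) {ε δ : ℝ} (hε : 0 < ε) (hδ : 0 < δ) :
    ∃ R₀ : ℝ, ∀ R, R₀ ≤ R → ∀ x : EuclideanSpace ℝ (Fin n), 1 / 2 * R ≤ ‖x‖ →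
      slowDecay ε x ≤ δ := by
  obtain ⟨N, hN⟩ := eventually_atTop.1 ((tendsto_rpow_neg_atTop hε).eventually (gt_mem_nhds hδ))
  refine ⟨max 2 (2 * N), fun R hR x hx => (hN _ ?_).le⟩
  have h1 := (le_max_left _ _).trans hR
  have h2 := (le_max_right _ _).trans hR
  nlinarith

namespace BackwardSol

variable {n : ℕ} {Ω : Set (EuclideanSpace ℝ (Fin n))} {T c M : ℝ}
  {U : EuclideanSpace ℝ (Fin n) × ℝ → ℝ} {e : EuclideanSpace ℝ (Fin n)} {κ κ₀ ε l s₂ a : ℝ}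

/-- The region in which the Carleman estimate on a cone controls the solution. -/
def coneRegion (e : EuclideanSpace ℝ (Fin n)) (κ ε m s₂ l r : ℝ) :
    Set (EuclideanSpace ℝ (Fin n) × ℝ) :=
  ((axisCone e κ ∩ Metric.ball 0 r) ×ˢ Ioo 0 s₂) ∩ {p | 2 * l < coneFun e (κ ^ 2) ε m s₂ 1 p}

theorem isOpen_coneRegion {m r : ℝ} : IsOpen (coneRegion e κ ε m s₂ l r) :=
  ((isOpen_axisCone.inter Metric.isOpen_ball).prod isOpen_Ioo).inter
    (isOpen_lt continuous_const contDiff_coneFun.continuous)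

/-- The Carleman estimate on a cone. -/
theorem exists_setLIntegral_coneRegion_le (h : BackwardSol Ω T c M U)
    (hP : ConeParams e (κ ^ 2) ε) (hκ : 0 ≤ κ) (hΩ : axisCone e κ ⊆ Ω) (hl : 0 < l)
    (hsT : s₂ < T) (ha : 0 < a) (r : ℝ) :
    ∃ D Λ₀ : ℝ, ∀ Λ, Λ₀ ≤ Λ →
      ∫⁻ p in coneRegion e κ ε (8 * c + 1) s₂ l r, ENNReal.ofReal (U p ^ 2) ≤
        ENNReal.ofReal (D * rexp (-(2 * l * Λ))) *
          ∫⁻ p in {x | x ∈ axisCone e κ ∧ √l ≤ ‖x‖} ×ˢ Ioo 0 s₂,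
            ENNReal.ofReal (rexp (a * ‖p.1‖ ^ 2) * (gradSq spaceDir U p + U p ^ 2)) := by
  have hc := h.nonneg
  set m := 8 * c + 1 with hm
  have hm0 : 0 < m := by positivity
  obtain ⟨D, hD0, hD⟩ := exists_cone_cutoff hP hκ hm0 hl hsT hc
  obtain ⟨A₀, hA₀⟩ := exists_forall_coneThreshold n c (mul_pos hP.gap_pos hP.q_pos)
  obtain ⟨C, hC0, hC⟩ := exists_pow_le_exp_sq 4 (half_pos ha)
  refine ⟨D * (2 + 2 * C), max 1 (2 * A₀ / l), fun Λ hΛ => ?_⟩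
  have hΛ0 : 0 < Λ := zero_lt_one.trans_le ((le_max_left _ _).trans hΛ)
  have hΛA : A₀ ≤ Λ * (l / 2) := by
    have := (le_max_right _ _).trans hΛ
    rw [div_le_iff₀ hl] at this
    linarith
  obtain ⟨R₀, hR₀⟩ := exists_slowDecay_le n hP.ε_pos (by positivity : 0 < a / (2 * Λ))
  set R := max (max 1 R₀) (2 * r) with hR
  have hR1 : 1 ≤ R := (le_max_left _ _).trans (le_max_left _ _)
  have hRR : R₀ ≤ R := (le_max_right _ _).trans (le_max_left _ _)
  have hRr : 2 * r ≤ R := le_max_right _ _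
  obtain ⟨η, hη, hηc, hηs, hηF, hη1, hηE⟩ := hD R hR1
  have hpos : ∀ p ∈ tsupport η, 0 < coneWeight e (κ ^ 2) ε p.1 := fun p hp =>
    coneWeight_pos hκ (hηs hp).1
  have hquad : ∀ p ∈ tsupport η, 0 ≤ coneQuad e (κ ^ 2) p.1 := fun p hp =>
    (coneQuad_pos_of_coneWeight_pos (hpos p hp)).le
  have htime : ∀ p ∈ tsupport η, 0 < p.2 → 0 ≤ coneTime m s₂ Λ p.2 := fun p hp hp0 => by
    rw [coneTime_eq]
    exact mul_nonneg hΛ0.le ((coneTime_pos_iff hm0).2 (hηF p hp hp0).1).le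
  have hslow : ContDiff ℝ ∞ fun p : EuclideanSpace ℝ (Fin n) × ℝ => slowDecay ε p.1 :=
    contDiff_slowDecay.comp contDiff_fst
  have htc : ContDiff ℝ ∞ fun p : EuclideanSpace ℝ (Fin n) × ℝ => coneTime m s₂ Λ p.2 :=
    contDiff_coneTime.comp contDiff_snd
  have key := h.carleman (φ := coneFun e (κ ^ 2) ε m s₂ Λ) hη contDiff_coneFun
    (b := fun p => coneTime m s₂ Λ p.2 * (fun x => coneConst n (κ ^ 2) * slowDecay ε x) p.1
      + -(4 * c)) ((htc.mul (contDiff_const.mul hslow)).add contDiff_const) hηc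
    (hηs.trans (prod_mono hΩ Subset.rfl))
    (fun p hp hp0 ξ => hP.commForm_le contDiff_coneTime (hquad p hp) (htime p hp hp0) ξ)
    (fun p hp hp0 => hP.le_commPotential hc contDiff_coneTime (hquad p hp) (htime p hp hp0)
      (g₁ := Λ * rexp (-m * p.2)) (by rw [deriv_coneTime]; ring) (coneTime_le hΛ0.le)
      (by rw [deriv_deriv_coneTime]; ring) (A := Λ * (l / 2)) (by
        rw [← coneFun_apply, coneFun_eq]
        exact mul_le_mul_of_nonneg_left (hηF p hp hp0).2 hΛ0.le) (hA₀ _ hΛA))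
  have hS : MeasurableSet ({x | x ∈ axisCone e κ ∧ √l ≤ ‖x‖} ×ˢ Ioo 0 s₂ :
      Set (EuclideanSpace ℝ (Fin n) × ℝ)) :=
    (isOpen_axisCone.measurableSet.inter
      (isClosed_le continuous_const continuous_norm).measurableSet).prod measurableSet_Ioo
  have lower : ∫⁻ p in coneRegion e κ ε m s₂ l r, ENNReal.ofReal (U p ^ 2) ≤
      ENNReal.ofReal (rexp (-(4 * l * Λ))) * ∫⁻ p in posTime n,
        ENNReal.ofReal ((η p * rexp (coneFun e (κ ^ 2) ε m s₂ Λ p) * U p) ^ 2) := by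
    rw [← lintegral_const_mul' _ _ ENNReal.ofReal_ne_top]
    refine setLIntegral_le_of_subset_support isOpen_coneRegion.measurableSet measurableSet_posTime
      (fun p hp hp' => (hp' hp.1.2.1).elim) fun p hp _ => ?_
    have hx : ‖p.1‖ < r := mem_ball_zero_iff.1 hp.1.1.2
    have hpF : 2 * l < coneFun e (κ ^ 2) ε m s₂ 1 p := hp.2
    rw [(hη1 p hp.1.2.1 hp.1.2.2 (by linarith) hp.1.1.1 (by linarith)).eq_of_nhds, one_mul,
      ← ENNReal.ofReal_mul (exp_pos _).le, mul_pow, ← mul_assoc, ← Real.exp_nat_mul,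
      ← Real.exp_add]
    refine ENNReal.ofReal_le_ofReal (le_mul_of_one_le_left (sq_nonneg _) (one_le_exp ?_))
    rw [coneFun_eq]
    push_cast
    nlinarith
  have upper : ∫⁻ p in posTime n, ENNReal.ofReal (cutoffError spaceDir timeDir c η p *
      (gradSq spaceDir U p + U p ^ 2) * rexp (coneFun e (κ ^ 2) ε m s₂ Λ p) ^ 2) ≤
      ENNReal.ofReal (D * (2 + 2 * C) * rexp (2 * l * Λ)) *
        ∫⁻ p in {x | x ∈ axisCone e κ ∧ √l ≤ ‖x‖} ×ˢ Ioo 0 s₂,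
          ENNReal.ofReal (rexp (a * ‖p.1‖ ^ 2) * (gradSq spaceDir U p + U p ^ 2)) := by
    rw [← lintegral_const_mul' _ _ ENNReal.ofReal_ne_top]
    refine setLIntegral_le_of_subset_support measurableSet_posTime hS ?_ fun p hp0 _ => ?_
    · intro p hp0 hp'
      have hpt : p ∉ tsupport η := fun hpt => hp' ⟨⟨(hηs hpt).1, Real.sqrt_le_iff.2
        ⟨norm_nonneg _, ?_⟩⟩, hp0, (hηF p hpt hp0).1⟩
      · rw [cutoffError_eq_zero_of_notMem_tsupport hpt]
        simp
      · have h1 := (hηF p hpt hp0).2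
        have h2 := coneFun_le_coneWeight (s₂ := s₂) hm0.le (hpos p hpt).le (le_of_lt hp0)
        linarith [coneWeight_le hP p.1]
    have hE0 := cutoffError_nonneg (e := spaceDir) (t := timeDir) hc η p
    have hU0 : 0 ≤ gradSq spaceDir U p + U p ^ 2 := by
      have := gradSq_nonneg spaceDir U p; positivity
    rw [← ENNReal.ofReal_mul (by positivity)]
    refine ENNReal.ofReal_le_ofReal ?_
    by_cases hpt : p ∉ tsupport η
    · rw [cutoffError_eq_zero_of_notMem_tsupport hpt, zero_mul, zero_mul]
      positivity
    rw [not_not] at hpt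
    by_cases hin : ‖p.1‖ ≤ 1 / 2 * R ∧ l < coneFun e (κ ^ 2) ε m s₂ 1 p
    · rw [cutoffError_eq_zero_of_eventuallyEq
        (hη1 p hp0 (hηF p hpt hp0).1 hin.1 (hηs hpt).1 hin.2), zero_mul, zero_mul]
      positivity
    have hr : 0 ≤ ‖p.1‖ ^ 2 := sq_nonneg _
    have hφ : 2 * coneFun e (κ ^ 2) ε m s₂ Λ p ≤ 2 * l * Λ + a / 2 * ‖p.1‖ ^ 2 := by
      rw [coneFun_eq]
      by_cases hx : ‖p.1‖ ≤ 1 / 2 * R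
      · have : coneFun e (κ ^ 2) ε m s₂ 1 p ≤ l := not_lt.1 fun hcon => hin ⟨hx, hcon⟩
        nlinarith [mul_nonneg ha.le hr]
      · have h1 := hR₀ R hRR p.1 (le_of_lt (not_le.1 hx))
        have h2 := coneFun_le_coneWeight (s₂ := s₂) hm0.le (hpos p hpt).le (le_of_lt hp0)
        have h3 := two_mul_coneWeight_le (ε := ε) hP.norm_eq hP.q_pos.le p.1
        have h4 : 2 * coneFun e (κ ^ 2) ε m s₂ 1 p ≤ a / (2 * Λ) * ‖p.1‖ ^ 2 := by
          linarith [mul_le_mul_of_nonneg_right h1 hr]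
        have h5 : Λ * (a / (2 * Λ) * ‖p.1‖ ^ 2) = a / 2 * ‖p.1‖ ^ 2 := by field_simp
        nlinarith [mul_le_mul_of_nonneg_left h4 hΛ0.le, mul_pos hl hΛ0]
    have hexp : rexp (coneFun e (κ ^ 2) ε m s₂ Λ p) ^ 2
        ≤ rexp (2 * l * Λ) * rexp (a / 2 * ‖p.1‖ ^ 2) := by
      rw [← Real.exp_nat_mul, ← Real.exp_add]
      exact exp_le_exp.2 (by push_cast; linarith)
    have hpoly : (1 + ‖p.1‖ ^ 2) ^ 2 ≤ (2 + 2 * C) * rexp (a / 2 * ‖p.1‖ ^ 2) := by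
      have h1 := hC ‖p.1‖ (norm_nonneg _)
      have h2 : 1 ≤ rexp (a / 2 * ‖p.1‖ ^ 2) := one_le_exp (by positivity)
      nlinarith [sq_nonneg (1 - ‖p.1‖ ^ 2)]
    have hsplit : rexp (a * ‖p.1‖ ^ 2) = rexp (a / 2 * ‖p.1‖ ^ 2) * rexp (a / 2 * ‖p.1‖ ^ 2) := by
      rw [← Real.exp_add]; ring_nf
    calc _ ≤ D * ((2 + 2 * C) * rexp (a / 2 * ‖p.1‖ ^ 2)) * (gradSq spaceDir U p + U p ^ 2) *
          (rexp (2 * l * Λ) * rexp (a / 2 * ‖p.1‖ ^ 2)) := by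
          gcongr
          exact (hηE p hpt hp0).trans (by gcongr)
      _ = _ := by rw [hsplit]; ring
  refine (lower.trans (mul_le_mul_right (key.trans upper) _)).trans ?_
  rw [← mul_assoc, ← ENNReal.ofReal_mul (exp_pos _).le]
  have : rexp (-(2 * l * Λ)) = rexp (-(4 * l * Λ)) * rexp (2 * l * Λ) := by
    rw [← Real.exp_add]; ring_nf
  refine mul_le_mul_left (ENNReal.ofReal_le_ofReal (le_of_eq ?_)) _
  rw [this]
  ring

theorem eq_zero_of_mem_coneRegion (h : BackwardSol Ω T c M U)
    (hP : ConeParams e (κ ^ 2) ε) (hκ₀ : 0 ≤ κ₀) (hκ : κ₀ < κ) (hκ1 : κ ≤ 1)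
    (hΩ : axisCone e κ₀ ⊆ Ω) (hl : 0 < l) (hs : 0 < s₂) (hsT : s₂ < T) {r : ℝ}
    {p : EuclideanSpace ℝ (Fin n) × ℝ} (hp : p ∈ coneRegion e κ ε (8 * c + 1) s₂ l r) :
    U p = 0 := by
  have hΩ' : axisCone e κ ⊆ Ω := fun x hx => hΩ
    ((mul_le_mul_of_nonneg_right hκ.le (norm_nonneg x)).trans_lt hx)
  obtain ⟨a, ha, hI⟩ := h.exists_lintegral_exp_mul_lt_top hP.norm_eq hκ₀ hκ hκ1 hΩ
    (Real.sqrt_pos.2 hl) hs hsT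
  obtain ⟨D, Λ₀, hD⟩ := h.exists_setLIntegral_coneRegion_le hP (hκ₀.trans hκ.le) hΩ' hl hsT ha r
  set I := ∫⁻ p in {x | x ∈ axisCone e κ ∧ √l ≤ ‖x‖} ×ˢ Ioo 0 s₂,
    ENNReal.ofReal (rexp (a * ‖p.1‖ ^ 2) * (gradSq spaceDir U p + U p ^ 2)) with hIdef
  have hlim : Tendsto (fun Λ : ℝ => ENNReal.ofReal (D * rexp (-(2 * l * Λ))) * I) atTop (𝓝 0) := by
    have h1 : Tendsto (fun Λ : ℝ => D * rexp (-(2 * l * Λ))) atTop (𝓝 (D * 0)) :=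
      (tendsto_exp_neg_atTop_nhds_zero.comp
        (tendsto_id.const_mul_atTop (by positivity : 0 < 2 * l))).const_mul D
    have h2 := ENNReal.Tendsto.mul_const (ENNReal.tendsto_ofReal h1) (Or.inr hI.ne) (b := I)
    simpa using h2
  have hzero : ∫⁻ p in coneRegion e κ ε (8 * c + 1) s₂ l r, ENNReal.ofReal (U p ^ 2) = 0 :=
    le_antisymm (ge_of_tendsto hlim (eventually_atTop.2 ⟨Λ₀, hD⟩)) zero_le
  have hcont : ContinuousOn U (coneRegion e κ ε (8 * c + 1) s₂ l r) :=
    h.contDiffOn.continuousOn.mono fun p hp =>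
      ⟨hΩ' hp.1.1.1, hp.1.2.1, hp.1.2.2.trans hsT⟩
  have hmeas := isOpen_coneRegion (e := e) (κ := κ) (ε := ε) (m := 8 * c + 1) (s₂ := s₂) (l := l)
    (r := r) |>.measurableSet
  have hm2 : AEMeasurable (fun p => ENNReal.ofReal (U p ^ 2))
      (volume.restrict (coneRegion e κ ε (8 * c + 1) s₂ l r)) :=
    ((hcont.pow 2).aemeasurable hmeas).ennreal_ofReal
  rw [lintegral_eq_zero_iff' hm2] at hzero
  have hae : U =ᵐ[volume.restrict (coneRegion e κ ε (8 * c + 1) s₂ l r)] fun _ => 0 := by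
    filter_upwards [hzero] with p hp
    have : U p ^ 2 ≤ 0 := ENNReal.ofReal_eq_zero.1 hp
    exact pow_eq_zero_iff two_ne_zero |>.1 (le_antisymm this (sq_nonneg _))
  exact Measure.eqOn_open_of_ae_eq hae isOpen_coneRegion hcont continuousOn_const hp

/-- Solutions vanish in every strictly smaller cone of aperture above the critical one. -/
theorem eq_zero_of_mem_axisCone (h : BackwardSol Ω T c M U) (he : ‖e‖ = 1) (hκ₀ : 0 ≤ κ₀)
    (hκ : κ₀ < κ) (hκ3 : 3 * κ ^ 2 < 1) (hΩ : axisCone e κ₀ ⊆ Ω) {x : EuclideanSpace ℝ (Fin n)}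
    (hx : x ∈ axisCone e κ) {s : ℝ} (hs : s ∈ Ioo 0 T) : U (x, s) = 0 := by
  have hc := h.nonneg
  have hκ0 : 0 < κ := hκ₀.trans_lt hκ
  have hgap : 0 < (1 - 3 * κ ^ 2) * κ ^ 2 := mul_pos (by linarith) (by positivity)
  obtain ⟨ε, hP⟩ : ∃ ε, ConeParams e (κ ^ 2) ε :=
    ⟨(1 - 3 * κ ^ 2) * κ ^ 2 / (300 * (n + 1)), he, by positivity, by positivity, by
      rw [mul_div_cancel₀ _ (by positivity)]⟩
  obtain ⟨s₂, hs2, hsT⟩ := exists_between hs.2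
  have hF : 0 < coneFun e (κ ^ 2) ε (8 * c + 1) s₂ 1 (x, s) :=
    (coneFun_pos_iff (p := (x, s)) (by positivity) (coneWeight_pos hκ0.le hx)).2 hs2
  obtain ⟨l, hl⟩ : ∃ l, 3 * l = coneFun e (κ ^ 2) ε (8 * c + 1) s₂ 1 (x, s) :=
    ⟨_, mul_div_cancel₀ _ three_ne_zero⟩
  have hκ1 : κ ≤ 1 := by nlinarith
  have hl0 : 0 < l := by linarith
  have hmem : (x, s) ∈ coneRegion e κ ε (8 * c + 1) s₂ l (‖x‖ + 1) := by
    refine ⟨⟨⟨hx, mem_ball_zero_iff.2 (lt_add_one _)⟩, hs.1, hs2⟩, ?_⟩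
    rw [mem_ofPred_eq, ← hl]
    linarith
  exact h.eq_zero_of_mem_coneRegion hP hκ₀ hκ hκ1 hΩ hl0 (hs.1.trans hs2) hsT hmem

end BackwardSol

section Slices

variable {E : Type*} [NormedAddCommGroup E] [NormedSpace ℝ E] {G : E × ℝ → ℝ} {p : E × ℝ}

theorem fderiv_slice_fst (hG : DifferentiableAt ℝ G p) (v : E) :
    fderiv ℝ (fun y => G (y, p.2)) p.1 v = fderiv ℝ G p (v, 0) := by
  have h := hG.hasFDerivAt.comp (x := p.1) (f := fun y => (y, p.2)) (hasFDerivAt_prodMk_left p.1 p.2)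
  rw [show (fun y => G (y, p.2)) = G ∘ fun y => (y, p.2) from rfl, h.fderiv]
  simp

theorem deriv_slice_snd (hG : DifferentiableAt ℝ G p) :
    deriv (fun s => G (p.1, s)) p.2 = fderiv ℝ G p (0, 1) := by
  have h := hG.hasFDerivAt.comp (x := p.2) (f := fun s => (p.1, s)) (hasFDerivAt_prodMk_right p.1 p.2)
  have h' := h.hasDerivAt.deriv
  rw [show (fun s => G (p.1, s)) = G ∘ fun s => (p.1, s) from rfl, h']
  simp

end Slices

section BackwardUniqueness

variable {n : ℕ} {Ω : Set (EuclideanSpace ℝ (Fin n))}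

theorem sq_norm_gradient (f : EuclideanSpace ℝ (Fin n) → ℝ) (x : EuclideanSpace ℝ (Fin n)) :
    ‖gradient f x‖ ^ 2 = ∑ i, fderiv ℝ f x (EuclideanSpace.single i 1) ^ 2 := by
  rw [norm_sq_eq_sum]
  refine Finset.sum_congr rfl fun i _ => ?_
  have h : inner ℝ (gradient f x) (EuclideanSpace.single i (1 : ℝ))
      = fderiv ℝ f x (EuclideanSpace.single i 1) := by
    rw [gradient, InnerProductSpace.toDual_symm_apply]
  rw [← h, EuclideanSpace.inner_single_right]
  simp

theorem gradSq_spaceDir_eq {G : EuclideanSpace ℝ (Fin n) × ℝ → ℝ}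
    {p : EuclideanSpace ℝ (Fin n) × ℝ} (hG : DifferentiableAt ℝ G p) :
    gradSq spaceDir G p = ‖gradient (fun y => G (y, p.2)) p.1‖ ^ 2 := by
  rw [sq_norm_gradient]
  simp only [fderiv_slice_fst hG]
  rfl

theorem lapAlong_spaceDir_eq {G : EuclideanSpace ℝ (Fin n) × ℝ → ℝ}
    {p : EuclideanSpace ℝ (Fin n) × ℝ} (hG : ContDiffAt ℝ ∞ G p) :
    lapAlong spaceDir G p = lap (fun y => G (y, p.2)) p.1 := by
  refine Finset.sum_congr rfl fun i _ => ?_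
  have hd : DifferentiableAt ℝ (fun q => fderiv ℝ G q (spaceDir i)) p := by
    have : ContDiffAt ℝ ∞ (fderiv ℝ G) p := hG.fderiv_right (by simp)
    exact (this.differentiableAt (by simp)).clm_apply (differentiableAt_const _)
  have hev : ∀ᶠ q in 𝓝 p, DifferentiableAt ℝ G q := by
    have h1 : ContDiffAt ℝ 1 G p := hG.of_le (by simp)
    filter_upwards [h1.eventually (by simp)] with q hq using hq.differentiableAt (by simp)
  have hev' : (fun y => fderiv ℝ (fun y => G (y, p.2)) y (EuclideanSpace.single i 1))
      =ᶠ[𝓝 p.1] fun y => fderiv ℝ G (y, p.2) (spaceDir i) := by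
    have hc : Tendsto (fun y => (y, p.2)) (𝓝 p.1) (𝓝 p) :=
      Continuous.tendsto (by fun_prop : Continuous fun y : EuclideanSpace ℝ (Fin n) => (y, p.2)) p.1
    filter_upwards [hc.eventually hev] with y hy
    exact fderiv_slice_fst (p := (y, p.2)) hy _
  rw [hev'.fderiv_eq]
  exact (fderiv_slice_fst hd _).symm

/-- Reversing time turns a solution as in the definition of backward uniqueness into a
backward solution vanishing at time zero. -/
theorem backwardSol_of_hasBU_hypotheses (hΩ : IsOpen Ω) {T c M : ℝ} (hT : 0 < T)
    {u : EuclideanSpace ℝ (Fin n) → ℝ → ℝ}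
    (hu : ContDiffOn ℝ ∞ (fun p : EuclideanSpace ℝ (Fin n) × ℝ => u p.1 p.2) (Ω ×ˢ Ioo 0 T))
    (hM : ∀ x ∈ Ω, ∀ t ∈ Ioo 0 T, |u x t| ≤ M)
    (hpde : ∀ x ∈ Ω, ∀ t ∈ Ioo 0 T, |deriv (u x) t - lap (fun y => u y t) x| ≤
      c * (‖gradient (fun y => u y t) x‖ + |u x t|))
    (hlim : ∀ x ∈ Ω, Tendsto (u x) (𝓝[<] T) (𝓝 0)) :
    BackwardSol Ω T (2 * c ^ 2) M fun p => u p.1 (T - p.2) := by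
  have hmem : ∀ s ∈ Ioo 0 T, T - s ∈ Ioo 0 T := fun s hs => ⟨by linarith [hs.2], by linarith [hs.1]⟩
  have hsm : ContDiffOn ℝ ∞ (fun p : EuclideanSpace ℝ (Fin n) × ℝ => u p.1 (T - p.2))
      (Ω ×ˢ Ioo 0 T) :=
    hu.comp (f := fun p : EuclideanSpace ℝ (Fin n) × ℝ => (p.1, T - p.2))
      (ContDiff.contDiffOn (by fun_prop)) fun p hp => ⟨hp.1, hmem _ hp.2⟩
  refine ⟨hΩ, hT, by positivity, hsm, fun x hx s hs => hM x hx _ (hmem s hs), fun p hp => ?_,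
    fun x hx => ?_⟩
  · have hat := hsm.contDiffAt ((hΩ.prod isOpen_Ioo).mem_nhds hp)
    have hd := hat.differentiableAt (by simp)
    have ht : dirDeriv timeDir (fun p : EuclideanSpace ℝ (Fin n) × ℝ => u p.1 (T - p.2)) p
        = -deriv (u p.1) (T - p.2) :=
      (deriv_slice_snd hd).symm.trans (deriv_comp_const_sub (f := u p.1) T p.2)
    rw [ht, lapAlong_spaceDir_eq hat, gradSq_spaceDir_eq hd]
    have h := hpde p.1 hp.1 _ (hmem _ hp.2)
    set g := ‖gradient (fun y => u y (T - p.2)) p.1‖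
    set v := u p.1 (T - p.2)
    have h2 := sq_le_sq' (by linarith [abs_nonneg (deriv (u p.1) (T - p.2) -
      lap (fun y => u y (T - p.2)) p.1)]) h
    rw [sq_abs] at h2
    have h3 : (g + |v|) ^ 2 ≤ 2 * (g ^ 2 + v ^ 2) := by
      rw [← sq_abs v]; nlinarith [sq_nonneg (g - |v|)]
    have h4 := mul_le_mul_of_nonneg_left h3 (sq_nonneg c)
    calc _ = (deriv (u p.1) (T - p.2) - lap (fun y => u y (T - p.2)) p.1) ^ 2 := by ring
      _ ≤ _ := by linarith
  · refine (hlim x hx).comp (tendsto_nhdsWithin_iff.2 ⟨?_, ?_⟩)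
    · refine Tendsto.mono_left ?_ nhdsWithin_le_nhds
      exact Continuous.tendsto' (by fun_prop) _ _ (by simp)
    · filter_upwards [self_mem_nhdsWithin] with s hs
      have : 0 < s := hs
      exact (by linarith : T - s < T)

/-- An open set covered by cones of aperture above the critical one has the backward uniqueness
property. -/
theorem hasBU_of_forall_exists_axisCone (hΩ : IsOpen Ω)
    (h : ∀ x ∈ Ω, ∃ (e : EuclideanSpace ℝ (Fin n)) (κ₀ κ : ℝ), ‖e‖ = 1 ∧ 0 ≤ κ₀ ∧ κ₀ < κ ∧
      3 * κ ^ 2 < 1 ∧ axisCone e κ₀ ⊆ Ω ∧ x ∈ axisCone e κ) : HasBU n Ω := by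
  intro T hT c _ u hu ⟨M, hM⟩ hpde hlim x hx t ht
  have hsol := backwardSol_of_hasBU_hypotheses hΩ hT hu hM hpde hlim
  obtain ⟨e, κ₀, κ, he, hκ₀, hκ, hκ3, hsub, hxe⟩ := h x hx
  have := hsol.eq_zero_of_mem_axisCone he hκ₀ hκ hκ3 hsub hxe (s := T - t)
    ⟨by linarith [ht.2], by linarith [ht.1]⟩
  simpa using this

section Covering

theorem exists_mem_axisCone_of_lt {e x : EuclideanSpace ℝ (Fin n)} {k : ℝ} (hk : 3 * k ^ 2 < 1)
    (hx : x ∈ axisCone e k) : ∃ κ, k < κ ∧ 3 * κ ^ 2 < 1 ∧ x ∈ axisCone e κ := by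
  have hx : k * ‖x‖ < inner ℝ e x := hx
  have h1 : ∀ᶠ κ in 𝓝[>] k, 3 * κ ^ 2 < 1 :=
    ((by fun_prop : Continuous fun κ : ℝ => 3 * κ ^ 2).continuousAt.eventually_lt_const hk).filter_mono
      nhdsWithin_le_nhds
  have h2 : ∀ᶠ κ in 𝓝[>] k, κ * ‖x‖ < inner ℝ e x :=
    ((by fun_prop : Continuous fun κ : ℝ => κ * ‖x‖).continuousAt.eventually_lt_const hx).filter_mono
      nhdsWithin_le_nhds
  obtain ⟨κ, hκ, h3, h4⟩ := ((eventually_mem_nhdsWithin (s := Ioi k)).and (h1.and h2)).exists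
  exact ⟨κ, hκ, h3, h4⟩

/-- A point of a cone with obtuse half-angle lies in a half-space inside the cone. -/
theorem exists_halfSpace_of_mem_axisCone {d x : EuclideanSpace ℝ (Fin n)} {k σ : ℝ}
    (hd : ‖d‖ = 1) (hk : k < 0) (hσ : 0 < σ) (hkσ : σ ^ 2 + k ^ 2 = 1) (hx : x ∈ axisCone d k) :
    ∃ e : EuclideanSpace ℝ (Fin n), ‖e‖ = 1 ∧ axisCone e 0 ⊆ axisCone d k ∧ x ∈ axisCone e 0 := by
  have hx : k * ‖x‖ < inner ℝ d x := hx
  rcases lt_or_ge 0 (inner ℝ d x) with h0 | h0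
  · refine ⟨d, hd, fun y hy => ?_, ?_⟩
    · have hy : 0 * ‖y‖ < inner ℝ d y := hy
      change k * ‖y‖ < inner ℝ d y
      nlinarith [norm_nonneg y]
    · change 0 * ‖x‖ < inner ℝ d x
      rwa [zero_mul]
  have hproj : ∀ y : EuclideanSpace ℝ (Fin n),
      ‖y - inner ℝ d y • d‖ ^ 2 = ‖y‖ ^ 2 - inner ℝ d y ^ 2 := fun y => by
    rw [norm_sub_sq_real, norm_smul, hd, inner_smul_right, real_inner_comm, Real.norm_eq_abs,
      mul_one, sq_abs]
    ring
  have hdd : inner ℝ d d = (1 : ℝ) := by rw [real_inner_self_eq_norm_sq, hd, one_pow]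
  set w := x - inner ℝ d x • d with hw
  have hwd : inner ℝ w d = (0 : ℝ) := by
    rw [hw, inner_sub_left, inner_smul_left, hdd, real_inner_comm]; simp
  have hr2 := hproj x
  rw [← hw] at hr2
  have hrx : σ * ‖x‖ < ‖w‖ := by
    refine lt_of_pow_lt_pow_left₀ 2 (norm_nonneg w) ?_
    rw [hr2]
    nlinarith
  have hr : 0 < ‖w‖ := (mul_nonneg hσ.le (norm_nonneg x)).trans_lt hrx
  have hinner : ∀ y, inner ℝ (σ • d + (-k / ‖w‖) • w) y
      = σ * inner ℝ d y + -k / ‖w‖ * inner ℝ w y := fun y => by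
    rw [inner_add_left, inner_smul_left, inner_smul_left]; simp
  refine ⟨σ • d + (-k / ‖w‖) • w, ?_, fun y hy => ?_, ?_⟩
  · have h1 : ‖σ • d + (-k / ‖w‖) • w‖ ^ 2 = 1 := by
      rw [norm_add_sq_real, norm_smul, norm_smul, inner_smul_left, inner_smul_right,
        real_inner_comm, hwd, hd, mul_pow, mul_pow, Real.norm_eq_abs, Real.norm_eq_abs, sq_abs,
        sq_abs, div_pow, div_mul_cancel₀ _ (by positivity), neg_sq]
      linarith
    exact (pow_eq_one_iff_of_nonneg (norm_nonneg _) two_ne_zero).1 h1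
  · have hy : 0 * ‖y‖ < inner ℝ (σ • d + (-k / ‖w‖) • w) y := hy
    rw [zero_mul, hinner] at hy
    change k * ‖y‖ < inner ℝ d y
    by_contra! hcon
    have h1 : ‖y - inner ℝ d y • d‖ ≤ σ * ‖y‖ := by
      refine le_of_sq_le_sq ?_ (by positivity)
      rw [hproj]
      nlinarith [mul_nonneg (neg_nonneg.2 hk.le) (norm_nonneg y)]
    have h2 : inner ℝ w y = inner ℝ w (y - inner ℝ d y • d) := by
      rw [inner_sub_right, inner_smul_right, hwd]; ring
    have h3 : inner ℝ w y ≤ ‖w‖ * (σ * ‖y‖) := by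
      rw [h2]
      exact (real_inner_le_norm _ _).trans (by gcongr)
    have h4 : -k / ‖w‖ * inner ℝ w y ≤ -k / ‖w‖ * (‖w‖ * (σ * ‖y‖)) :=
      mul_le_mul_of_nonneg_left h3 (div_nonneg (by linarith) hr.le)
    have h5 : -k / ‖w‖ * (‖w‖ * (σ * ‖y‖)) = -k * (σ * ‖y‖) := by field_simp
    nlinarith
  · change 0 * ‖x‖ < inner ℝ (σ • d + (-k / ‖w‖) • w) x
    have h2 : inner ℝ w x = ‖w‖ ^ 2 := by
      have : x = w + inner ℝ d x • d := by rw [hw, sub_add_cancel]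
      conv_lhs => rw [this]
      rw [inner_add_right, inner_smul_right, hwd, real_inner_self_eq_norm_sq]; ring
    have h5 : -k / ‖w‖ * ‖w‖ ^ 2 = -k * ‖w‖ := by field_simp
    rw [zero_mul, hinner, h2, h5]
    nlinarith

end Covering

theorem cone_eq_axisCone [NeZero n] (θ : ℝ) :
    cone n θ = axisCone (EuclideanSpace.single 0 1) (Real.cos (θ / 2)) := by
  ext x
  simp [cone, axisCone, mul_comm, EuclideanSpace.inner_single_left]

theorem hasBU_cone [NeZero n] {θ : ℝ} (h1 : 2 * Real.arccos (1 / √3) < θ) (h2 : θ < 2 * π) :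
    HasBU n (cone n θ) := by
  set d : EuclideanSpace ℝ (Fin n) := EuclideanSpace.single 0 1
  have hd : ‖d‖ = 1 := by simp [d]
  have hβ : 0 ≤ Real.arccos (1 / √3) := Real.arccos_nonneg _
  have h3 : (0 : ℝ) < √3 := by positivity
  have hk : Real.cos (θ / 2) < 1 / √3 := by
    have h31 : 1 / √3 ≤ 1 := by
      rw [div_le_one h3]
      exact Real.one_le_sqrt.2 (by norm_num)
    have h4 := Real.cos_lt_cos_of_nonneg_of_le_pi hβ (by linarith : θ / 2 ≤ π)
      (by linarith : Real.arccos (1 / √3) < θ / 2)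
    rwa [Real.cos_arccos (by linarith [(by positivity : 0 < 1 / √3)]) h31] at h4
  have hσ : 0 < Real.sin (θ / 2) := Real.sin_pos_of_pos_of_lt_pi (by linarith) (by linarith)
  rw [cone_eq_axisCone]
  refine hasBU_of_forall_exists_axisCone isOpen_axisCone fun x hx => ?_
  rcases lt_or_ge (Real.cos (θ / 2)) 0 with hc | hc
  · obtain ⟨e, he, hsub, hxe⟩ := exists_halfSpace_of_mem_axisCone hd hc hσ
      (Real.sin_sq_add_cos_sq _) hx
    obtain ⟨κ, hκ, hκ3, hxκ⟩ := exists_mem_axisCone_of_lt (by norm_num) hxe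
    exact ⟨e, 0, κ, he, le_rfl, hκ, hκ3, hsub, hxκ⟩
  · have hk3 : 3 * Real.cos (θ / 2) ^ 2 < 1 := by
      rw [lt_div_iff₀ h3] at hk
      have h4 := pow_lt_pow_left₀ hk (by positivity) two_ne_zero
      rw [mul_pow, Real.sq_sqrt zero_le_three] at h4
      linarith
    obtain ⟨κ, hκ, hκ3, hxκ⟩ := exists_mem_axisCone_of_lt hk3 hx
    exact ⟨d, _, κ, hd, hc, hκ, hκ3, Subset.rfl, hxκ⟩

end BackwardUniqueness

/-- Cones with opening angle larger than `2 arccos (1/√3)` have the backward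
uniqueness property; in particular the critical angle is at most `2 arccos (1/√3)`. -/
theorem cone_hasBU (n : ℕ) [NeZero n] (hn : 2 ≤ n) :
    (∀ θ : ℝ, 2 * Real.arccos (1 / Real.sqrt 3) < θ → θ < 2 * π →
      HasBU n (cone n θ)) ∧
    sInf {θ : ℝ | θ ∈ Set.Ioo 0 (2 * π) ∧ HasBU n (cone n θ)} ≤
      2 * Real.arccos (1 / Real.sqrt 3) := by
  refine ⟨fun θ h1 h2 => hasBU_cone h1 h2, ?_⟩
  have h0 : 0 ≤ Real.arccos (1 / √3) := Real.arccos_nonneg _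
  have hπ : 2 * Real.arccos (1 / √3) < 2 * π := by
    have := Real.arccos_le_pi_div_two.2 (by positivity : 0 ≤ 1 / √3)
    linarith [Real.pi_pos]
  by_contra! hcon
  obtain ⟨θ, h1, h2⟩ := exists_between (lt_min hcon hπ)
  have h3 := h2.trans_le (min_le_right _ _)
  exact absurd (h2.trans_le (min_le_left _ _)) (not_lt.2 (csInf_le
    ⟨0, fun t ht => ht.1.1.le⟩ ⟨⟨by linarith, h3⟩, hasBU_cone h1 h3⟩))
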